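/- arXiv:1512.07138 — 4 statements merged into one kernel-verified Lean document; each statement's English description precedes it below -/
import Mathlib

section
/- Let g satisfy (g*), (g₀), (g∞) and let a be a T-periodic locally integrable weight satisfying (a*) with m positivity intervals I⁺_i and m negativity intervals I⁻_i. Then for every ρ > 0 there exists λ* = λ*(ρ) > 0 such that for each λ > λ* there exist constants r, R with 0 < r < ρ < R and a constant μ*(λ) > 0 such that for every μ > μ*(λ) and every string S = (S₁,…,S_m) ∈ {0,1,2}^m with S ≠ (0,…,0), the equation u'' + (λa⁺(t) − μa⁻(t)) g(u) = 0 has a positive T-periodic solution u such that, for each i = 1,…,m: max_{t∈I⁺_i} u(t) < r if S_i = 0; r < max_{t∈I⁺_i} u(t) < ρ if S_i = 1; and ρ < max_{t∈I⁺_i} u(t) < R if S_i = 2. In particular, the equation has at least 3^m − 1 positive T-periodic solutions. -/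
open MeasureTheory Set Filter Topology

/-- A Carathéodory solution of `u'' + q(t) G(u) = 0` on all of `ℝ`:
`u` is `C¹` with derivative `v`, and `v t = v t₀ - ∫_{t₀}^{t} q s * G (u s) ds`. -/
def IsSolR (q G u v : ℝ → ℝ) : Prop :=
  (∀ t, HasDerivAt u (v t) t) ∧
    ∀ t₀ t : ℝ, v t = v t₀ - ∫ s in t₀..t, q s * G (u s)


/-- A continuous nowhere vanishing planar field has a continuous choice of polar angle. -/
theorem exists_continuous_angle {f k : ℝ × ℝ → ℝ} (hf : Continuous f) (hk : Continuous k)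
    (hne : ∀ z, f z = 0 → k z ≠ 0) (z₀ : ℝ × ℝ) (h₀ : 0 < f z₀) :
    ∃ θ : ℝ × ℝ → ℝ, Continuous θ ∧ |θ z₀| < Real.pi / 2 ∧
      ∀ z, ∃ ρ, 0 < ρ ∧ f z = ρ * Real.cos (θ z) ∧ k z = ρ * Real.sin (θ z) := by
  have hF : ∀ z, (⟨f z, k z⟩ : ℂ) ≠ 0 := by
    intro z h
    rw [Complex.ext_iff] at h
    exact hne z h.1 h.2
  let F : C(ℝ × ℝ, {z : ℂ // z ≠ 0}) :=
    ⟨fun z => ⟨⟨f z, k z⟩, hF z⟩, by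
      refine Continuous.subtype_mk ?_ _
      have : (fun z => (⟨f z, k z⟩ : ℂ)) = fun z => (f z : ℂ) + (k z : ℂ) * Complex.I := by
        funext z; apply Complex.ext <;> simp
      rw [this]
      fun_prop⟩
  have : SimplyConnectedSpace (ℝ × ℝ) := SimplyConnectedSpace.ofContractible _
  obtain ⟨L, ⟨hL0, hL⟩, -⟩ := Complex.isCoveringMap_exp.existsUnique_continuousMap_lifts F z₀
    (Complex.log ⟨f z₀, k z₀⟩) (by
      apply Subtype.ext
      exact Complex.exp_log (hF z₀))
  have hLz : ∀ z, Complex.exp (L z) = ⟨f z, k z⟩ := fun z =>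
    congrArg Subtype.val (congrFun hL z)
  refine ⟨fun z => (L z).im, Complex.continuous_im.comp L.continuous, ?_, fun z => ?_⟩
  · simp only [hL0, Complex.log_im]
    exact Complex.abs_arg_lt_pi_div_two_iff.2 (Or.inl h₀)
  · refine ⟨Real.exp (L z).re, Real.exp_pos _, ?_, ?_⟩
    · rw [← Complex.exp_re, hLz]
    · rw [← Complex.exp_im, hLz]

/-- Two-dimensional Poincaré–Miranda theorem. -/
theorem exists_zero_of_sign_on_sides {f k : ℝ × ℝ → ℝ} (hf : Continuous f) (hk : Continuous k)
    {x₀ x₁ y₀ y₁ : ℝ} (hx : x₀ ≤ x₁) (hy : y₀ ≤ y₁)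
    (hl : ∀ y ∈ Icc y₀ y₁, 0 < f (x₀, y)) (hr : ∀ y ∈ Icc y₀ y₁, f (x₁, y) < 0)
    (hb : ∀ x ∈ Icc x₀ x₁, k (x, y₀) ≤ 0) (ht : ∀ x ∈ Icc x₀ x₁, 0 ≤ k (x, y₁)) :
    ∃ z, f z = 0 ∧ k z = 0 := by
  by_contra! hne
  obtain ⟨θ, hθ, h0, hρ⟩ := exists_continuous_angle hf hk hne (x₀, y₀) (hl _ ⟨le_rfl, hy⟩)
  have hπ := Real.pi_pos
  have hcosl : ∀ y ∈ Icc y₀ y₁, 0 < Real.cos (θ (x₀, y)) := by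
    intro y hy
    obtain ⟨ρ, h1, h2, -⟩ := hρ (x₀, y)
    have := hl y hy
    rw [h2] at this
    exact pos_of_mul_pos_right this h1.le
  have hcosr : ∀ y ∈ Icc y₀ y₁, Real.cos (θ (x₁, y)) < 0 := by
    intro y hy
    obtain ⟨ρ, h1, h2, -⟩ := hρ (x₁, y)
    have := hr y hy
    rw [h2] at this
    by_contra! h
    exact absurd this (not_lt.2 (mul_nonneg h1.le h))
  have hsinb : ∀ x ∈ Icc x₀ x₁, Real.sin (θ (x, y₀)) ≤ 0 := by
    intro x hx
    obtain ⟨ρ, h1, -, h2⟩ := hρ (x, y₀)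
    have := hb x hx
    rw [h2] at this
    by_contra! h
    exact absurd this (not_le.2 (mul_pos h1 h))
  have hsint : ∀ x ∈ Icc x₀ x₁, 0 ≤ Real.sin (θ (x, y₁)) := by
    intro x hx
    obtain ⟨ρ, h1, -, h2⟩ := hρ (x, y₁)
    have := ht x hx
    rw [h2] at this
    by_contra! h
    exact absurd this (not_le.2 (mul_neg_of_pos_of_neg h1 h))
  have ivx : ∀ (y c : ℝ), c ∈ uIcc (θ (x₀, y)) (θ (x₁, y)) → ∃ x ∈ Icc x₀ x₁, θ (x, y) = c := by
    intro y c hc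
    have := intermediate_value_uIcc (f := fun x => θ (x, y)) (a := x₀) (b := x₁)
      (by fun_prop) hc
    rwa [uIcc_of_le hx] at this
  have ivy : ∀ (x c : ℝ), c ∈ uIcc (θ (x, y₀)) (θ (x, y₁)) → ∃ y ∈ Icc y₀ y₁, θ (x, y) = c := by
    intro x c hc
    have := intermediate_value_uIcc (f := fun y => θ (x, y)) (a := y₀) (b := y₁)
      (by fun_prop) hc
    rwa [uIcc_of_le hy] at this
  rw [abs_lt] at h0
  have hlt1 : θ (x₀, y₁) < Real.pi / 2 := by
    by_contra! h
    obtain ⟨y, hy, e⟩ := ivy x₀ (Real.pi / 2) (mem_uIcc.2 (Or.inl ⟨h0.2.le, h⟩))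
    have := hcosl y hy
    rw [e, Real.cos_pi_div_two] at this
    exact lt_irrefl _ this
  have hlt2 : -(Real.pi / 2) < θ (x₀, y₁) := by
    by_contra! h
    obtain ⟨y, hy, e⟩ := ivy x₀ (-(Real.pi / 2)) (mem_uIcc.2 (Or.inr ⟨h, h0.1.le⟩))
    have := hcosl y hy
    rw [e, Real.cos_neg, Real.cos_pi_div_two] at this
    exact lt_irrefl _ this
  have hrb : θ (x₁, y₀) ≤ 0 := by
    by_contra! h
    have h1 : θ (x₀, y₀) ≤ 0 := by
      by_contra! h1
      exact absurd (hsinb x₀ ⟨le_rfl, hx⟩) (not_le.2 (Real.sin_pos_of_pos_of_lt_pi h1 (by linarith)))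
    obtain ⟨x, hx, e⟩ := ivx y₀ (min (θ (x₁, y₀)) (Real.pi / 2)) (mem_uIcc.2 (Or.inl
      ⟨h1.trans (le_min h.le (by linarith)), min_le_left _ _⟩))
    have := hsinb x hx
    rw [e] at this
    refine absurd this (not_le.2 (Real.sin_pos_of_pos_of_lt_pi (lt_min h (by linarith)) ?_))
    exact (min_le_right _ _).trans_lt (by linarith)
  have hrt : 0 ≤ θ (x₁, y₁) := by
    by_contra! h
    have h1 : 0 ≤ θ (x₀, y₁) := by
      by_contra! h1
      exact absurd (hsint x₀ ⟨le_rfl, hx⟩) (not_le.2 (Real.sin_neg_of_neg_of_neg_pi_lt h1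
        (by linarith)))
    obtain ⟨x, hx, e⟩ := ivx y₁ (max (θ (x₁, y₁)) (-(Real.pi / 2))) (mem_uIcc.2 (Or.inr
      ⟨le_max_left _ _, (max_le h.le (by linarith)).trans h1⟩))
    have := hsint x hx
    rw [e] at this
    refine absurd this (not_le.2 (Real.sin_neg_of_neg_of_neg_pi_lt (max_lt h (by linarith)) ?_))
    exact lt_of_lt_of_le (by linarith) (le_max_right _ _)
  obtain ⟨y, hy, e⟩ := ivy x₁ 0 (mem_uIcc.2 (Or.inl ⟨hrb, hrt⟩))
  have := hcosr y hy
  rw [e, Real.cos_zero] at this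
  linarith

/-- If a closed subset `W` of a rectangle meets every path from the bottom to the top, a continuous
function that is nonnegative on the left and nonpositive on the right part of `W` vanishes on `W`. -/
theorem exists_zero_of_meets_paths {x₀ x₁ y₀ y₁ : ℝ} (hx : x₀ < x₁) (hy : y₀ ≤ y₁)
    {W : Set (ℝ × ℝ)} (hW : IsClosed W) {f : ℝ × ℝ → ℝ} (hf : Continuous f)
    (hl : ∀ z ∈ W, z.1 = x₀ → 0 ≤ f z) (hr : ∀ z ∈ W, z.1 = x₁ → f z ≤ 0)
    (hpath : ∀ γ : ℝ → ℝ × ℝ, Continuous γ → (∀ s, γ s ∈ Icc x₀ x₁ ×ˢ Icc y₀ y₁) →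
      (γ 0).2 = y₀ → (γ 1).2 = y₁ → ∃ s ∈ Icc (0 : ℝ) 1, γ s ∈ W) :
    ∃ z ∈ W, z ∈ Icc x₀ x₁ ×ˢ Icc y₀ y₁ ∧ f z = 0 := by
  by_contra! hne
  set X : Set (ℝ × ℝ) := Icc x₀ x₁ ×ˢ Icc y₀ y₁ with hX
  have hXc : IsClosed X := isClosed_Icc.prod isClosed_Icc
  set cl : ℝ × ℝ → ℝ × ℝ := fun z => (max x₀ (min x₁ z.1), max y₀ (min y₁ z.2)) with hcl
  have hclc : Continuous cl := by fun_prop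
  have hclX : ∀ z, cl z ∈ X := fun z =>
    ⟨⟨le_max_left _ _, max_le hx.le (min_le_left _ _)⟩, ⟨le_max_left _ _, max_le hy (min_le_left _ _)⟩⟩
  have hclid : ∀ z ∈ X, cl z = z := by
    rintro ⟨a, b⟩ ⟨⟨h1, h2⟩, h3, h4⟩
    simp only [] at h1 h2 h3 h4
    simp [hcl, h1, h2, h3, h4]
  obtain ⟨h0, h0p, h0m, h0I⟩ := exists_continuous_zero_one_of_isClosed
    (s := (W ∩ X ∩ {z | 0 ≤ f z}) ∪ (X ∩ {z | z.1 = x₀}))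
    (t := (W ∩ X ∩ {z | f z ≤ 0}) ∪ (X ∩ {z | z.1 = x₁}))
    (((hW.inter hXc).inter (isClosed_le continuous_const hf)).union
      (hXc.inter (isClosed_eq continuous_fst continuous_const)))
    (((hW.inter hXc).inter (isClosed_le hf continuous_const)).union
      (hXc.inter (isClosed_eq continuous_fst continuous_const)))
    (by
      rw [Set.disjoint_left]
      rintro z (⟨⟨h1, h2⟩, h3⟩ | ⟨h2, h3⟩) (⟨⟨h4, h5⟩, h6⟩ | ⟨h5, h6⟩)
      · exact hne z h1 h2 (le_antisymm h6 h3)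
      · exact hne z h1 h2 (le_antisymm (hr z h1 h6) h3)
      · exact hne z h4 h5 (le_antisymm h6 (hl z h4 h3))
      · simp only [mem_ofPred_eq] at h3 h6
        linarith)
  set J : ℝ × ℝ → ℝ := fun z => 1 - 2 * h0 (cl z) with hJ
  have hJc : Continuous J := by fun_prop
  have hJ1 : ∀ z, |J z| ≤ 1 := by
    intro z
    have := h0I (cl z)
    rw [abs_le]
    constructor <;> simp only [hJ] <;> linarith [this.1, this.2]
  set O : Set (ℝ × ℝ) := {z | |J z| < 1} with hO
  have hOo : IsOpen O := isOpen_lt hJc.abs continuous_const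
  have hOW : ∀ z ∈ O, cl z ∉ W := by
    intro z hz hzW
    rcases le_total 0 (f (cl z)) with h | h
    · have := h0p (Or.inl ⟨⟨hzW, hclX z⟩, h⟩)
      simp only [hO, hJ, mem_ofPred_eq, this] at hz
      norm_num at hz
    · have := h0m (Or.inl ⟨⟨hzW, hclX z⟩, h⟩)
      simp only [hO, hJ, mem_ofPred_eq, this] at hz
      norm_num at hz
  set C : Set (ℝ × ℝ) := {z | ∃ b : ℝ × ℝ, b.2 ≤ y₀ ∧ JoinedIn O b z} with hC
  have hCO : C ⊆ O := by
    rintro z ⟨b, -, h⟩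
    exact h.target_mem
  have hCtop : ∀ z ∈ C, z.2 < y₁ := by
    rintro z ⟨b, hb, γ, hγ⟩
    by_contra! hz
    obtain ⟨s, hs, hsW⟩ := hpath (fun s => cl (γ.extend s)) (hclc.comp γ.continuous_extend)
      (fun s => hclX _) (by simp [hcl, hb]) (by simp [hcl, hz, hy])
    have : γ.extend s ∈ O := by
      rw [Path.extend_apply γ hs]
      exact hγ _
    exact hOW _ this hsW
  classical
  set k : ℝ × ℝ → ℝ := fun z => if z ∈ C then -(1 - |J z|) else 1 - |J z| with hk
  have hkabs : ∀ z, |k z| = 1 - |J z| := by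
    intro z
    have := hJ1 z
    simp only [hk]
    split_ifs
    · rw [abs_neg, abs_of_nonneg (by linarith)]
    · rw [abs_of_nonneg (by linarith)]
  have hkc : Continuous k := by
    rw [continuous_iff_continuousAt]
    intro z
    by_cases hz : z ∈ O
    · obtain ⟨U, ⟨hU, hUc⟩, hUO⟩ := (path_connected_basis z).mem_iff.1 (hOo.mem_nhds hz)
      have hmem : ∀ w ∈ U, (w ∈ C ↔ z ∈ C) := by
        intro w hw
        have hj : JoinedIn O z w := (hUc.joinedIn _ (mem_of_mem_nhds hU) _ hw).mono hUO
        exact ⟨fun ⟨b, hb, h⟩ => ⟨b, hb, h.trans hj.symm⟩, fun ⟨b, hb, h⟩ => ⟨b, hb, h.trans hj⟩⟩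
      by_cases hzC : z ∈ C
      · refine ContinuousAt.congr (f := fun w => -(1 - |J w|)) (by fun_prop) ?_
        filter_upwards [hU] with w hw
        simp [hk, (hmem w hw).2 hzC]
      · refine ContinuousAt.congr (f := fun w => 1 - |J w|) (by fun_prop) ?_
        filter_upwards [hU] with w hw
        simp [hk, mt (hmem w hw).1 hzC]
    · have hz1 : |J z| = 1 := le_antisymm (hJ1 z) (not_lt.1 hz)
      have hkz : k z = 0 := by
        rw [← abs_eq_zero, hkabs, hz1, sub_self]
      rw [ContinuousAt, hkz, tendsto_zero_iff_abs_tendsto_zero]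
      have : Tendsto (fun w => 1 - |J w|) (𝓝 z) (𝓝 (1 - |J z|)) :=
        (continuous_const.sub hJc.abs).tendsto z
      rw [hz1, sub_self] at this
      exact this.congr fun w => (hkabs w).symm
  obtain ⟨z, hz1, hz2⟩ := exists_zero_of_sign_on_sides hJc hkc hx.le hy (by
      intro y hy
      have hm : (x₀, y) ∈ X := ⟨⟨le_rfl, hx.le⟩, hy⟩
      have := h0p (Or.inr ⟨hm, rfl⟩)
      simp only [hJ, hclid _ hm, this]
      norm_num) (by
      intro y hy
      have hm : (x₁, y) ∈ X := ⟨⟨hx.le, le_rfl⟩, hy⟩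
      have := h0m (Or.inr ⟨hm, rfl⟩)
      simp only [hJ, hclid _ hm, this]
      norm_num) (by
      intro x _
      by_cases hO' : (x, y₀) ∈ O
      · have : (x, y₀) ∈ C := ⟨(x, y₀), le_rfl, JoinedIn.refl hO'⟩
        simp only [hk, this, if_true]
        linarith [hJ1 (x, y₀)]
      · have : k (x, y₀) = 0 := by
          rw [← abs_eq_zero, hkabs, le_antisymm (hJ1 _) (not_lt.1 hO'), sub_self]
        exact this.le) (by
      intro x _
      have : (x, y₁) ∉ C := fun h => lt_irrefl _ (hCtop _ h)
      simp only [hk, this, if_false]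
      linarith [hJ1 (x, y₁)])
  have := hkabs z
  rw [hz1, hz2] at this
  norm_num at this

/-- A continuous function running from below `c` to above `d` has a subinterval on which it stays in
`[c, d]` and whose endpoints are mapped to `c` and `d`. -/
theorem exists_crossing_subinterval {f : ℝ → ℝ} (hf : Continuous f) {a b c d : ℝ}
    (ha : f a ≤ c) (hcd : c ≤ d) (hb : d ≤ f b) :
    ∃ c' ∈ uIcc a b, ∃ d' ∈ uIcc a b, f c' = c ∧ f d' = d ∧ ∀ s ∈ uIcc c' d', f s ∈ Icc c d := by
  wlog hab : a ≤ b generalizing a b f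
  · obtain ⟨c', hc', d', hd', h1, h2, h3⟩ := this (f := fun s => f (-s)) (a := -a) (b := -b)
      (by fun_prop) (by simpa using ha) (by simpa using hb) (by linarith)
    have key : ∀ x y z : ℝ, x ∈ uIcc y z → -x ∈ uIcc (-y) (-z) := by
      intro x y z h
      rw [mem_uIcc] at h ⊢
      rcases h with h | h
      · right; constructor <;> linarith [h.1, h.2]
      · left; constructor <;> linarith [h.1, h.2]
    refine ⟨-c', ?_, -d', ?_, h1, h2, fun s hs => ?_⟩
    · simpa using key _ _ _ hc'
    · simpa using key _ _ _ hd'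
    · have := h3 (-s) (by simpa using key _ _ _ hs)
      simpa using this
  obtain ⟨d', ⟨⟨hd1, hd2⟩, hd3⟩, hdl⟩ := (isCompact_Icc.inter_right
    (isClosed_le continuous_const hf) : IsCompact (Icc a b ∩ {s | d ≤ f s})).exists_isLeast
    ⟨b, ⟨hab, le_rfl⟩, hb⟩
  have hfd : f d' = d := by
    obtain ⟨s, hs, e⟩ := intermediate_value_Icc hd1 hf.continuousOn ⟨ha.trans hcd, hd3⟩
    have : d' ≤ s := hdl ⟨⟨hs.1, hs.2.trans hd2⟩, e.ge⟩
    rw [le_antisymm this hs.2, e]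
  obtain ⟨c', ⟨⟨hc1, hc2⟩, hc3⟩, hcl⟩ := (isCompact_Icc.inter_right
    (isClosed_le hf continuous_const) : IsCompact (Icc a d' ∩ {s | f s ≤ c})).exists_isGreatest
    ⟨a, ⟨le_rfl, hd1⟩, ha⟩
  have hfc : f c' = c := by
    obtain ⟨s, hs, e⟩ := intermediate_value_Icc hc2 hf.continuousOn ⟨hc3, hcd.trans hfd.ge⟩
    have : s ≤ c' := hcl ⟨⟨hc1.trans hs.1, hs.2⟩, e.le⟩
    rw [le_antisymm hs.1 this, e]
  rw [uIcc_of_le hab]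
  refine ⟨c', ⟨hc1, hc2.trans hd2⟩, d', ⟨hd1, hd2⟩, hfc, hfd, fun s hs => ?_⟩
  rw [uIcc_of_le hc2] at hs
  constructor
  · by_contra! h
    have : s ≤ c' := hcl ⟨⟨hc1.trans hs.1, hs.2⟩, h.le⟩
    rw [le_antisymm this hs.1, hfc] at h
    exact lt_irrefl _ h
  · by_contra! h
    have : d' ≤ s := hdl ⟨⟨hc1.trans hs.1, hs.2.trans hd2⟩, h.le⟩
    rw [le_antisymm hs.2 this, hfd] at h
    exact lt_irrefl _ h

/-- The pair `(u, v)`, sampled at the times `t`, behaves between the indices `A` and `B` like a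
concave function and its slope, the slope decreasing at the rate `w * γ`. -/
structure ConcaveArc {ι : Type*} [LinearOrder ι] (t : ι → ℝ) (w : ℝ → ℝ) (A B : ι)
    (γ u v : ι → ℝ) : Prop where
  lower : ∀ x y, A ≤ x → x ≤ y → y ≤ B → v y * (t y - t x) ≤ u y - u x
  upper : ∀ x y, A ≤ x → x ≤ y → y ≤ B → u y - u x ≤ v x * (t y - t x)
  drop_ge : ∀ x y, A ≤ x → x ≤ y → y ≤ B → ∀ c, (∀ z, x ≤ z → z ≤ y → c ≤ γ z) →
    c * (∫ s in t x..t y, w s) ≤ v x - v y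
  drop_le : ∀ x y, A ≤ x → x ≤ y → y ≤ B → ∀ c, (∀ z, x ≤ z → z ≤ y → γ z ≤ c) →
    v x - v y ≤ c * (∫ s in t x..t y, w s)

section Blocks

variable {ι : Type*} [LinearOrder ι] {t : ι → ℝ} {w : ℝ → ℝ} {γ u v : ι → ℝ} {O A B α β α' β' : ι}
  {ℓ T R c : ℝ}

/-- On an arc of positive weight a nonnegative solution cannot have maximum `ρ` when the weight is
large. -/
theorem ConcaveArc.weight_le (h : ConcaveArc t w A B γ u v) (ht : Monotone t)
    (hAα : A ≤ α) (hαβ : α ≤ β) (hβB : β ≤ B) {ρ : ℝ} (hρ : 0 ≤ ρ) (hℓ : 0 < ℓ)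
    (h1 : ℓ ≤ t α - t A) (h2 : ℓ ≤ t B - t β) (hT : t B - t A ≤ T)
    (hA : 0 ≤ u A) (hB : 0 ≤ u B) (hle : ∀ z, A ≤ z → z ≤ B → u z ≤ ρ)
    {k : ι} (hk1 : A ≤ k) (hk2 : k ≤ B) (hk : u k = ρ)
    (hc : ∀ z, u z ∈ Icc (ρ * ℓ / T) ρ → c ≤ γ z) :
    c * (∫ s in t α..t β, w s) ≤ 2 * ρ / ℓ := by
  have hT0 : 0 < T := by linarith [ht hαβ]
  have hmid : ∀ z, α ≤ z → z ≤ β → ρ * ℓ / T ≤ u z := by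
    intro z hz1 hz2
    have hAz := hAα.trans hz1
    have hzB := hz2.trans hβB
    rw [div_le_iff₀ hT0]
    have tz1 := ht hz1
    have tz2 := ht hz2
    have tk1 := ht hk1
    have tk2 := ht hk2
    have uz0 : 0 ≤ u z := by
      have a1 := h.lower A z le_rfl hAz hzB
      have a2 := h.upper z B hAz hzB le_rfl
      by_contra! hneg
      rcases le_total 0 (v z) with hv | hv
      · have := mul_nonneg hv (by linarith : 0 ≤ t z - t A)
        linarith
      · have := mul_nonpos_of_nonpos_of_nonneg hv (by linarith : 0 ≤ t B - t z)
        linarith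
    rcases le_total z k with hzk | hkz
    · have a1 := h.lower A z le_rfl hAz hzB
      have a2 := h.upper z k hAz hzk hk2
      have tzk := ht hzk
      have m1 := mul_le_mul_of_nonneg_right a1 (by linarith : 0 ≤ t k - t z)
      have m2 := mul_le_mul_of_nonneg_right a2 (by linarith : 0 ≤ t z - t A)
      have m3 : ρ * (t z - t A) ≤ u z * (t k - t A) := by
        rw [hk] at m2
        nlinarith [mul_nonneg hA (by linarith : 0 ≤ t k - t z)]
      calc ρ * ℓ ≤ ρ * (t z - t A) := by gcongr; linarith
        _ ≤ u z * (t k - t A) := m3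
        _ ≤ u z * T := by gcongr; linarith
    · have a1 := h.lower k z hk1 hkz hzB
      have a2 := h.upper z B hAz hzB le_rfl
      have tzk := ht hkz
      have m1 := mul_le_mul_of_nonneg_right a1 (by linarith : 0 ≤ t B - t z)
      have m2 := mul_le_mul_of_nonneg_right a2 (by linarith : 0 ≤ t z - t k)
      have m3 : ρ * (t B - t z) ≤ u z * (t B - t k) := by
        rw [hk] at m1
        nlinarith [mul_nonneg hB (by linarith : 0 ≤ t z - t k)]
      calc ρ * ℓ ≤ ρ * (t B - t z) := by gcongr; linarith
        _ ≤ u z * (t B - t k) := m3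
        _ ≤ u z * T := by gcongr; linarith
  have d := h.drop_ge α β hAα hαβ hβB c fun z hz1 hz2 =>
    hc z ⟨hmid z hz1 hz2, hle z (hAα.trans hz1) (hz2.trans hβB)⟩
  have l1 := h.lower A α le_rfl hAα (hαβ.trans hβB)
  have l2 := h.upper β B (hAα.trans hαβ) hβB le_rfl
  have b1 : v α ≤ ρ / ℓ := by
    rw [le_div_iff₀ hℓ]
    by_contra! hcon
    have : 0 < v α := pos_of_mul_pos_left (hρ.trans_lt hcon) hℓ.le
    nlinarith [hle α hAα (hαβ.trans hβB), mul_le_mul_of_nonneg_left h1 this.le]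
  have b2 : -(ρ / ℓ) ≤ v β := by
    rw [neg_le, le_div_iff₀ hℓ]
    by_contra! hcon
    have : 0 < -v β := pos_of_mul_pos_left (hρ.trans_lt hcon) hℓ.le
    nlinarith [hle β (hAα.trans hαβ) hβB, mul_le_mul_of_nonneg_left h2 this.le]
  have : 2 * ρ / ℓ = ρ / ℓ + ρ / ℓ := by ring
  linarith

/-- On an arc where `-u` is concave, the values are bounded by the endpoint values. -/
theorem ConcaveArc.le_of_endpoints (h : ConcaveArc t w O A γ (-u) (-v)) (ht : Monotone t)
    (hO : u O ≤ R) (hA : u A ≤ R) {z : ι} (hz1 : O ≤ z) (hz2 : z ≤ A) : u z ≤ R := by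
  have a1 := h.lower O z le_rfl hz1 hz2
  have a2 := h.upper z A hz1 hz2 le_rfl
  simp only [Pi.neg_apply] at a1 a2
  by_contra! hcon
  rcases le_total 0 (v z) with hv | hv
  · have := mul_nonneg hv (sub_nonneg.2 (ht hz2))
    linarith
  · have := mul_nonpos_of_nonpos_of_nonneg hv (sub_nonneg.2 (ht hz1))
    linarith

/-- On a convex arc that stays in `[b, R]` over its middle part the weight cannot be large. -/
theorem ConcaveArc.weight_le_of_convex (h : ConcaveArc t w O A γ (-u) (-v)) (ht : Monotone t)
    (hOα : O ≤ α) (hαβ : α ≤ β) (hβA : β ≤ A) (hℓ : 0 < ℓ) (hR : 0 ≤ R)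
    (h1 : ℓ ≤ t α - t O) (h2 : ℓ ≤ t A - t β)
    (hO : u O ≤ R) (hA : u A ≤ R) {b : ℝ} (hb : 0 ≤ b)
    (hge : ∀ z, α ≤ z → z ≤ β → b ≤ u z)
    (hc : ∀ z, u z ∈ Icc b R → c ≤ γ z) :
    c * (∫ s in t α..t β, w s) ≤ 2 * R / ℓ := by
  have d := h.drop_ge α β hOα hαβ hβA c fun z hz1 hz2 =>
    hc z ⟨hge z hz1 hz2, h.le_of_endpoints ht hO hA (hOα.trans hz1) (hz2.trans hβA)⟩
  have l1 := h.lower O α le_rfl hOα (hαβ.trans hβA)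
  have l2 := h.upper β A (hOα.trans hαβ) hβA le_rfl
  simp only [Pi.neg_apply] at d l1 l2
  have g1 := hge α le_rfl hαβ
  have g2 := hge β hαβ le_rfl
  have b1 : v β ≤ R / ℓ := by
    rw [le_div_iff₀ hℓ]
    by_contra! hcon
    have : 0 < v β := pos_of_mul_pos_left (hR.trans_lt hcon) hℓ.le
    nlinarith [mul_le_mul_of_nonneg_left h2 this.le]
  have b2 : -(R / ℓ) ≤ v α := by
    rw [neg_le, le_div_iff₀ hℓ]
    by_contra! hcon
    have : 0 < -v α := pos_of_mul_pos_left (hR.trans_lt hcon) hℓ.le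
    nlinarith [mul_le_mul_of_nonneg_left h1 this.le]
  have : 2 * R / ℓ = R / ℓ + R / ℓ := by ring
  linarith

/-- A solution entering a strongly negative arc with slope at least `κ` leaves it above `R`. -/
theorem ConcaveArc.lt_of_slope_ge (h : ConcaveArc t w O A γ (-u) (-v)) (ht : Monotone t)
    (hOα : O ≤ α) (hαβ : α ≤ β) (hβA : β ≤ A) (hℓ : 0 < ℓ) (hR : 0 ≤ R)
    (h1 : ℓ ≤ t α - t O) (h2 : ℓ ≤ t A - t β)
    (hO0 : 0 ≤ u O) (hO : u O ≤ R) {κ : ℝ} (hκ : 0 ≤ κ) (hv : κ ≤ v O)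
    (hc : ∀ z, u z ∈ Icc (κ * ℓ) R → c ≤ γ z)
    (hw : 2 * R / ℓ < c * (∫ s in t α..t β, w s)) : R < u A := by
  by_contra! hA
  refine absurd (h.weight_le_of_convex ht hOα hαβ hβA hℓ hR h1 h2 hO hA (by positivity) ?_ hc)
    (not_le.2 hw)
  intro z hz1 hz2
  have a := h.upper O z le_rfl (hOα.trans hz1) (hz2.trans hβA)
  simp only [Pi.neg_apply] at a
  have tz := ht hz1
  nlinarith [mul_le_mul hv (by linarith : ℓ ≤ t z - t O) hℓ.le (hκ.trans hv)]

/-- After a strongly negative arc, a solution whose maximum on the following positive arc is `x`,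
where the nonlinearity is small compared with `x`, leaves that arc with a definite positive slope. -/
theorem ConcaveArc.slope_ge {w' : ℝ → ℝ} (h : ConcaveArc t w O A γ (-u) (-v))
    (h' : ConcaveArc t w' A B γ u v) (ht : Monotone t)
    (hOα : O ≤ α) (hαβ : α ≤ β) (hβA : β ≤ A) (hℓ : 0 < ℓ)
    (h1 : ℓ ≤ t α - t O) (h2 : ℓ ≤ t A - t β) (hT0 : 0 < T)
    (hT : t A - t O ≤ T) (hT' : t B - t A ≤ T) {x ε : ℝ} (hx : 0 < x) (hxR : x ≤ R)
    (hO : u O ≤ R) (hA : 0 ≤ u A) (hle : ∀ z, A ≤ z → z ≤ B → u z ≤ x)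
    {k : ι} (hk1 : A ≤ k) (hk2 : k ≤ B) (hk : u k = x)
    (hc : ∀ z, u z ∈ Icc (x / 2) R → c ≤ γ z)
    (hw : 2 * R / ℓ < c * (∫ s in t α..t β, w s))
    (hε : ∀ z, A ≤ z → z ≤ B → γ z ≤ ε)
    (hw' : ε * (∫ s in t A..t B, w' s) ≤ x / (8 * T)) :
    x / (8 * T) ≤ v B ∧ 0 ≤ u B := by
  have hAB := hk1.trans hk2
  have hvA : x / (4 * T) ≤ v A := by
    by_contra! hv
    have hbd : ∀ d, 0 ≤ d → d ≤ T → v A * d ≤ x / 4 := by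
      intro d hd0 hd
      have : x / (4 * T) * T = x / 4 := by field_simp
      calc v A * d ≤ x / (4 * T) * d := by gcongr
        _ ≤ x / (4 * T) * T := by gcongr
        _ = x / 4 := this
    have uA : 3 * x / 4 ≤ u A := by
      have a := h'.upper A k le_rfl hk1 hk2
      have := hbd (t k - t A) (sub_nonneg.2 (ht hk1)) (by linarith [ht hk2])
      linarith
    refine absurd (h.weight_le_of_convex ht hOα hαβ hβA hℓ (hx.le.trans hxR) h1 h2 hO
      ((hle A le_rfl hAB).trans hxR) (by positivity) ?_ hc) (not_le.2 hw)
    intro z hz1 hz2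
    have a := h.lower z A (hOα.trans hz1) (hz2.trans hβA) le_rfl
    simp only [Pi.neg_apply] at a
    have := hbd (t A - t z) (sub_nonneg.2 (ht (hz2.trans hβA)))
      (by linarith [ht (hOα.trans hz1)])
    linarith
  have d := h'.drop_le A B le_rfl hAB le_rfl ε hε
  have e : x / (4 * T) = x / (8 * T) + x / (8 * T) := by field_simp; ring
  have hvB : x / (8 * T) ≤ v B := by linarith
  refine ⟨hvB, ?_⟩
  have a := h'.lower A B le_rfl hAB le_rfl
  have : 0 ≤ v B * (t B - t A) :=
    mul_nonneg (le_trans (by positivity) hvB) (sub_nonneg.2 (ht hAB))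
  linarith

end Blocks

/-- Kicked approximation of `u'' + q G(u) = 0`: the slope is constant between consecutive times of
the grid `t` and jumps by the mass of `q` times `G u` at the end of each step. -/
noncomputable def orbit (t : ℕ → ℝ) (q G : ℝ → ℝ) (z : ℝ × ℝ) : ℕ → ℝ × ℝ
  | 0 => z
  | k + 1 =>
    ((orbit t q G z k).1 + (t (k + 1) - t k) * (orbit t q G z k).2,
      (orbit t q G z k).2 - (∫ s in t k..t (k + 1), q s) *
        G ((orbit t q G z k).1 + (t (k + 1) - t k) * (orbit t q G z k).2))

section Orbit

variable {t : ℕ → ℝ} {q G : ℝ → ℝ} {z : ℝ × ℝ}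

theorem orbit_fst_succ (k : ℕ) : (orbit t q G z (k + 1)).1 =
    (orbit t q G z k).1 + (t (k + 1) - t k) * (orbit t q G z k).2 := rfl

theorem orbit_snd_succ (k : ℕ) : (orbit t q G z (k + 1)).2 =
    (orbit t q G z k).2 - (∫ s in t k..t (k + 1), q s) * G (orbit t q G z (k + 1)).1 := rfl

theorem continuous_orbit (hG : Continuous G) (k : ℕ) : Continuous fun z => orbit t q G z k := by
  induction k with
  | zero => exact continuous_id
  | succ k ih =>
    simp only [orbit]
    fun_prop

/-- Once nonpositive with nonpositive slope, the orbit goes on along a straight line. -/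
theorem orbit_sink (ht : Monotone t) (hG : ∀ s ≤ 0, G s = 0) {k l : ℕ} (hkl : k ≤ l)
    (hu : (orbit t q G z k).1 ≤ 0) (hv : (orbit t q G z k).2 ≤ 0) :
    (orbit t q G z l).1 ≤ (orbit t q G z k).1 ∧ (orbit t q G z l).2 = (orbit t q G z k).2 := by
  induction l, hkl using Nat.le_induction with
  | base => exact ⟨le_rfl, rfl⟩
  | succ l _ ih =>
    have h1 : (orbit t q G z (l + 1)).1 ≤ (orbit t q G z k).1 := by
      rw [orbit_fst_succ, ih.2]
      have := mul_nonpos_of_nonneg_of_nonpos (sub_nonneg.2 (ht l.le_succ)) hv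
      linarith [ih.1]
    refine ⟨h1, ?_⟩
    rw [orbit_snd_succ, hG _ (h1.trans hu), ih.2]
    ring

theorem orbit_pos_or_slope_nonpos (ht : StrictMono t) (hG : ∀ s ≤ 0, G s = 0) (hz : 0 ≤ z.1)
    (k : ℕ) : 0 < (orbit t q G z (k + 1)).1 ∨ (orbit t q G z (k + 1)).2 ≤ 0 := by
  have key : ∀ k, (0 ≤ (orbit t q G z k).1 ∨ (orbit t q G z k).2 ≤ 0) →
      0 < (orbit t q G z (k + 1)).1 ∨ (orbit t q G z (k + 1)).2 ≤ 0 := by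
    intro k h
    by_contra! hcon
    rw [orbit_snd_succ, hG _ hcon.1, mul_zero, sub_zero] at hcon
    have h0 := h.resolve_right (not_le.2 hcon.2)
    have := mul_pos (sub_pos.2 (ht k.lt_succ_self)) hcon.2
    rw [orbit_fst_succ] at hcon
    linarith [hcon.1]
  induction k with
  | zero => exact key 0 (Or.inl hz)
  | succ k ih => exact key (k + 1) (ih.imp_left le_of_lt)

/-- A negative value of the orbit bounds all later values. -/
theorem orbit_le_of_neg (ht : StrictMono t) (hG : ∀ s ≤ 0, G s = 0) (hz : 0 ≤ z.1) {k l : ℕ}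
    (hkl : k ≤ l) (hk : (orbit t q G z k).1 < 0) :
    (orbit t q G z l).1 ≤ (orbit t q G z k).1 := by
  cases k with
  | zero => exact absurd hk (not_lt.2 hz)
  | succ k =>
    exact (orbit_sink ht.monotone hG hkl hk.le
      ((orbit_pos_or_slope_nonpos ht hG hz k).resolve_left (not_lt.2 hk.le))).1

end Orbit

theorem concaveArc_of_recurrence {t : ℕ → ℝ} (ht : Monotone t) {w : ℝ → ℝ} {A B : ℕ}
    {γ u v : ℕ → ℝ} (hwi : ∀ k, IntervalIntegrable w volume (t k) (t (k + 1)))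
    (hw : ∀ s, 0 ≤ w s) (hγ : ∀ k, 0 ≤ γ k)
    (hu : ∀ k, A ≤ k → k < B → u (k + 1) = u k + (t (k + 1) - t k) * v k)
    (hv : ∀ k, A ≤ k → k < B → v (k + 1) = v k - (∫ s in t k..t (k + 1), w s) * γ (k + 1)) :
    ConcaveArc t w A B γ u v := by
  have hw0 : ∀ k, 0 ≤ ∫ s in t k..t (k + 1), w s := fun k =>
    intervalIntegral.integral_nonneg (ht k.le_succ) fun s _ => hw s
  have hanti : ∀ k, A ≤ k → k < B → v (k + 1) ≤ v k := by
    intro k h1 h2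
    rw [hv k h1 h2]
    linarith [mul_nonneg (hw0 k) (hγ (k + 1))]
  have hanti' : ∀ x y, A ≤ x → x ≤ y → y ≤ B → v y ≤ v x := by
    intro x y hx hxy
    induction y, hxy using Nat.le_induction with
    | base => exact fun _ => le_rfl
    | succ y h ih => exact fun hy => (hanti y (hx.trans h) hy).trans (ih (by omega))
  have hint : ∀ x y, x ≤ y → IntervalIntegrable w volume (t x) (t y) := fun x y hxy =>
    IntervalIntegrable.trans_iterate_Ico hxy fun k _ => hwi k
  refine ⟨?_, ?_, ?_, ?_⟩
  · intro x y hx hxy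
    induction y, hxy using Nat.le_induction with
    | base => simp
    | succ y h ih =>
      intro hy
      have := ih (by omega)
      rw [hu y (hx.trans h) hy]
      have a := hanti y (hx.trans h) hy
      have t1 := ht h
      have t2 := ht y.le_succ
      nlinarith [mul_le_mul_of_nonneg_right a (sub_nonneg.2 t1),
        mul_le_mul_of_nonneg_right a (sub_nonneg.2 t2)]
  · intro x y hx hxy
    induction y, hxy using Nat.le_induction with
    | base => simp
    | succ y h ih =>
      intro hy
      have := ih (by omega)
      rw [hu y (hx.trans h) hy]
      have a := hanti' x y hx h (by omega)
      have t2 := ht y.le_succ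
      nlinarith [mul_le_mul_of_nonneg_right a (sub_nonneg.2 t2)]
  · intro x y hx hxy
    induction y, hxy using Nat.le_induction with
    | base => simp
    | succ y h ih =>
      intro hy c hc
      have := ih (by omega) c fun z h1 h2 => hc z h1 (by omega)
      rw [hv y (hx.trans h) hy, ← intervalIntegral.integral_add_adjacent_intervals (hint x y h)
        (hwi y)]
      have := mul_le_mul_of_nonneg_right (hc (y + 1) (by omega) le_rfl) (hw0 y)
      linarith
  · intro x y hx hxy
    induction y, hxy using Nat.le_induction with
    | base => simp
    | succ y h ih =>
      intro hy c hc
      have := ih (by omega) c fun z h1 h2 => hc z h1 (by omega)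
      rw [hv y (hx.trans h) hy, ← intervalIntegral.integral_add_adjacent_intervals (hint x y h)
        (hwi y)]
      have := mul_le_mul_of_nonneg_right (hc (y + 1) (by omega) le_rfl) (hw0 y)
      linarith

theorem concaveArc_of_hasDerivAt {w γ u v : ℝ → ℝ} {A B : ℝ}
    (hwi : ∀ x y, IntervalIntegrable w volume x y)
    (hw : ∀ s, 0 ≤ w s) (hγ : ∀ s, 0 ≤ γ s) (hγc : Continuous γ)
    (hu : ∀ s, HasDerivAt u (v s) s)
    (hv : ∀ x y, A ≤ x → x ≤ y → y ≤ B → v y = v x - ∫ s in x..y, w s * γ s) :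
    ConcaveArc (fun s : ℝ => s) w A B γ u v := by
  have hwγ : ∀ x y, IntervalIntegrable (fun s => w s * γ s) volume x y := fun x y =>
    (hwi x y).mul_continuousOn hγc.continuousOn
  have hanti : ∀ x y, A ≤ x → x ≤ y → y ≤ B → v y ≤ v x := by
    intro x y hx hxy hy
    rw [hv x y hx hxy hy]
    linarith [intervalIntegral.integral_nonneg (μ := volume) hxy
      fun s _ => mul_nonneg (hw s) (hγ s)]
  have hmvt : ∀ x y, x < y → ∃ c ∈ Ioo x y, v c * (y - x) = u y - u x := by
    intro x y hxy
    obtain ⟨c, hc, e⟩ := exists_hasDerivAt_eq_slope u v hxy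
      (fun s _ => (hu s).continuousAt.continuousWithinAt) fun s _ => hu s
    refine ⟨c, hc, ?_⟩
    rw [e, div_mul_cancel₀ _ (sub_ne_zero.2 hxy.ne')]
  refine ⟨?_, ?_, ?_, ?_⟩
  · intro x y hx hxy hy
    rcases hxy.eq_or_lt with rfl | hlt
    · simp
    obtain ⟨c, hc, e⟩ := hmvt x y hlt
    rw [← e]
    exact mul_le_mul_of_nonneg_right (hanti c y (hx.trans hc.1.le) hc.2.le hy) (by linarith)
  · intro x y hx hxy hy
    rcases hxy.eq_or_lt with rfl | hlt
    · simp
    obtain ⟨c, hc, e⟩ := hmvt x y hlt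
    rw [← e]
    exact mul_le_mul_of_nonneg_right (hanti x c hx hc.1.le (hc.2.le.trans hy)) (by linarith)
  · intro x y hx hxy hy c hc
    rw [hv x y hx hxy hy, sub_sub_cancel, ← intervalIntegral.integral_const_mul]
    refine intervalIntegral.integral_mono_on hxy ((hwi x y).const_mul c) (hwγ x y) ?_
    intro s hs
    rw [mul_comm]
    exact mul_le_mul_of_nonneg_left (hc s hs.1 hs.2) (hw s)
  · intro x y hx hxy hy c hc
    rw [hv x y hx hxy hy, sub_sub_cancel, ← intervalIntegral.integral_const_mul]
    refine intervalIntegral.integral_mono_on hxy (hwγ x y) ((hwi x y).const_mul c) ?_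
    intro s hs
    rw [mul_comm c]
    exact mul_le_mul_of_nonneg_left (hc s hs.1 hs.2) (hw s)

/-- What a solution does while crossing an interval `[O, A]` of negative weight followed by an
interval `[A, B]` of positive weight. -/
structure BlockLaw {ι : Type*} [LinearOrder ι] (u v : ι → ℝ) (r ρ R κ : ℝ) (O A B : ι) :
    Prop where
  le_top : u O ≤ R → u A ≤ R → ∀ z, O ≤ z → z ≤ A → u z ≤ R
  ne_mid : 0 ≤ u A → 0 ≤ u B → (∀ z, A ≤ z → z ≤ B → u z ≤ ρ) →
    ∀ k, A ≤ k → k ≤ B → u k ≠ ρ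
  slope_ge : ∀ x, x = r ∨ x = R → u O ≤ R → 0 ≤ u A → (∀ z, A ≤ z → z ≤ B → u z ≤ x) →
    ∀ k, A ≤ k → k ≤ B → u k = x → κ ≤ v B ∧ 0 ≤ u B
  gt_top : 0 ≤ u O → u O ≤ R → κ ≤ v O → R < u A

theorem blockLaw_of_arcs {ι : Type*} [LinearOrder ι] {t : ι → ℝ} {w w' : ℝ → ℝ} {G : ℝ → ℝ}
    {u v : ι → ℝ} {O α' β' A α β B : ι} {ℓ T r ρ R c cρ ε : ℝ}
    (h : ConcaveArc t w O A (fun k => G (u k)) (-u) (-v))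
    (h' : ConcaveArc t w' A B (fun k => G (u k)) u v) (ht : Monotone t)
    (hOα : O ≤ α') (hαβ' : α' ≤ β') (hβA : β' ≤ A) (hAα : A ≤ α) (hαβ : α ≤ β) (hβB : β ≤ B)
    (hℓ : 0 < ℓ) (hT : 0 < T) (h1 : ℓ ≤ t α' - t O) (h2 : ℓ ≤ t A - t β')
    (h3 : ℓ ≤ t α - t A) (h4 : ℓ ≤ t B - t β) (h5 : t A - t O ≤ T) (h6 : t B - t A ≤ T)
    (hr : 0 < r) (hrρ : r < ρ) (hρR : ρ < R)
    (hcρ : ∀ s ∈ Icc (ρ * ℓ / T) ρ, cρ ≤ G s)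
    (hwρ : 2 * ρ / ℓ < cρ * ∫ s in t α..t β, w' s)
    (hc : ∀ s ∈ Icc (min (r / 2) (r / (8 * T) * ℓ)) R, c ≤ G s)
    (hw : 2 * R / ℓ < c * ∫ s in t α'..t β', w s)
    (hεr : ∀ s ≤ r, G s ≤ ε * r) (hεR : ∀ s ≤ R, G s ≤ ε * R)
    (hw' : ε * (∫ s in t A..t B, w' s) ≤ 1 / (8 * T)) :
    BlockLaw u v r ρ R (r / (8 * T)) O A B := by
  have hR : 0 < R := by linarith
  refine ⟨fun hO hA z hz1 hz2 => h.le_of_endpoints ht hO hA hz1 hz2, ?_, ?_, ?_⟩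
  · intro hA hB hle k hk1 hk2 hk
    have := h'.weight_le ht hAα hαβ hβB (by linarith) hℓ h3 h4 h6 hA hB hle hk1 hk2 hk
      fun z hz => hcρ _ hz
    linarith
  · intro x hx hO hA hle k hk1 hk2 hk
    have hxr : r ≤ x := by rcases hx with rfl | rfl <;> linarith
    have hxR : x ≤ R := by rcases hx with rfl | rfl <;> linarith
    have hx0 : 0 < x := hr.trans_le hxr
    have hεx : ∀ s ≤ x, G s ≤ ε * x := by rcases hx with rfl | rfl <;> assumption
    have key := h.slope_ge h' ht hOα hαβ' hβA hℓ h1 h2 hT h5 h6 hx0 hxR hO hA hle hk1 hk2 hk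
      (fun z hz => hc _ ⟨(min_le_left _ _).trans (by linarith [hz.1]), hz.2⟩) hw
      (ε := ε * x) (fun z hz1 hz2 => hεx _ (hle z hz1 hz2)) (by
        calc ε * x * (∫ s in t A..t B, w' s) = x * (ε * ∫ s in t A..t B, w' s) := by ring
          _ ≤ x * (1 / (8 * T)) := mul_le_mul_of_nonneg_left hw' hx0.le
          _ = x / (8 * T) := by ring)
    exact ⟨(div_le_div_of_nonneg_right hxr (by positivity)).trans key.1, key.2⟩
  · intro hO0 hO hv
    exact h.lt_of_slope_ge ht hOα hαβ' hβA hℓ hR.le h1 h2 hO0 hO (by positivity) hv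
      (fun z hz => hc _ ⟨(min_le_right _ _).trans hz.1, hz.2⟩) hw

/-- The closed range of the maximum prescribed by a symbol. -/
def strip (r ρ R : ℝ) : Fin 3 → Set ℝ := ![Iic r, Icc r ρ, Icc ρ R]

theorem isClosed_strip (r ρ R : ℝ) (j : Fin 3) : IsClosed (strip r ρ R j) := by
  fin_cases j
  · exact isClosed_Iic
  · exact isClosed_Icc
  · exact isClosed_Icc

theorem le_of_mem_strip {r ρ R x : ℝ} (hrρ : r < ρ) (hρR : ρ < R) {j : Fin 3}
    (hx : x ∈ strip r ρ R j) : x ≤ R := by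
  fin_cases j
  · exact (mem_Iic.1 hx).trans (hrρ.trans hρR).le
  · exact (mem_Icc.1 hx).2.trans hρR.le
  · exact (mem_Icc.1 hx).2

theorem le_of_mem_strip_of_ne {r ρ R x : ℝ} (hrρ : r < ρ) {j : Fin 3} (hj : j ≠ 0)
    (hx : x ∈ strip r ρ R j) : r ≤ x := by
  fin_cases j
  · exact absurd rfl hj
  · exact (mem_Icc.1 hx).1
  · exact hrρ.le.trans (mem_Icc.1 hx).1

theorem exists_strip_crossing {f : ℝ → ℝ} (hf : Continuous f) {r ρ R : ℝ} (hr : 0 < r)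
    (hrρ : r < ρ) (hρR : ρ < R) {a b : ℝ} (ha : f a < 0) (hb : R < f b) (j : Fin 3) :
    ∃ c ∈ uIcc a b, ∃ d ∈ uIcc a b, (f c < 0 ∨ f c = ρ) ∧ (f d = r ∨ f d = R) ∧
      ∀ s ∈ uIcc c d, f s ∈ strip r ρ R j := by
  fin_cases j
  · obtain ⟨c, hc, d, hd, h1, h2, h3⟩ := exists_crossing_subinterval hf (a := a) (b := b) le_rfl
      (ha.le.trans hr.le) (by linarith)
    exact ⟨c, hc, d, hd, Or.inl (h1.trans_lt ha), Or.inl h2, fun s hs => (h3 s hs).2⟩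
  · obtain ⟨c, hc, d, hd, h1, h2, h3⟩ := exists_crossing_subinterval hf (a := a) (b := b)
      (c := r) (by linarith) hrρ.le (by linarith)
    exact ⟨d, hd, c, hc, Or.inr h2, Or.inl h1, fun s hs => h3 s (uIcc_comm d c ▸ hs)⟩
  · obtain ⟨c, hc, d, hd, h1, h2, h3⟩ := exists_crossing_subinterval hf (a := a) (b := b)
      (c := ρ) (by linarith) hρR.le hb.le
    exact ⟨c, hc, d, hd, Or.inr h1, Or.inr h2, h3⟩

/-- The maximum of a sequence over the integers from `A` to `B`. -/
def peak (u : ℕ → ℝ) (A B : ℕ) : ℝ :=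
  (insert A (Finset.Icc A B)).sup' (Finset.insert_nonempty _ _) u

theorem le_peak {u : ℕ → ℝ} {A B k : ℕ} (h1 : A ≤ k) (h2 : k ≤ B) : u k ≤ peak u A B :=
  Finset.le_sup' u (Finset.mem_insert_of_mem (Finset.mem_Icc.2 ⟨h1, h2⟩))

theorem exists_eq_peak (u : ℕ → ℝ) {A B : ℕ} (hAB : A ≤ B) :
    ∃ k, A ≤ k ∧ k ≤ B ∧ u k = peak u A B := by
  obtain ⟨k, hk, e⟩ := Finset.exists_mem_eq_sup' (Finset.insert_nonempty A (Finset.Icc A B)) u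
  rcases Finset.mem_insert.1 hk with rfl | hk
  · exact ⟨k, le_rfl, hAB, e.symm⟩
  · exact ⟨k, (Finset.mem_Icc.1 hk).1, (Finset.mem_Icc.1 hk).2, e.symm⟩

theorem continuous_peak {X : Type*} [TopologicalSpace X] {u : X → ℕ → ℝ}
    (hu : ∀ k, Continuous fun s => u s k) (A B : ℕ) : Continuous fun s => peak (u s) A B :=
  Continuous.finset_sup'_apply _ fun k _ => hu k

/-- Along a path of orbits which stretches over the first interval of positive weight, there is a
piece following a given itinerary and stretching over the final time. -/
theorem exists_itinerary_piece {u v : ℝ → ℕ → ℝ} (hu : ∀ k, Continuous fun s => u s k)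
    (hneg : ∀ s k l, k ≤ l → u s k < 0 → u s l < 0)
    {O A : ℕ → ℕ} (hOA : ∀ i, O i ≤ A i) (hAO : ∀ i, A i ≤ O (i + 1)) {m : ℕ} (hm : 0 < m)
    {r ρ R κ : ℝ} (hr : 0 < r) (hrρ : r < ρ) (hρR : ρ < R)
    (hlaw : ∀ s, ∀ i < m, BlockLaw (u s) (v s) r ρ R κ (O i) (A i) (O (i + 1)))
    (hstart : ∀ s, u s (O 0) ≤ R) (h0 : peak (u 0) (A 0) (O 1) < 0)
    (h1 : R < peak (u 1) (A 0) (O 1)) (S : ℕ → Fin 3) :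
    ∃ s₀ ∈ Icc (0 : ℝ) 1, ∃ s₁ ∈ Icc (0 : ℝ) 1, u s₀ (O m) < 0 ∧
      (κ ≤ v s₁ (O m) ∧ 0 ≤ u s₁ (O m)) ∧
      ∀ s ∈ uIcc s₀ s₁, ∀ i < m, peak (u s) (A i) (O (i + 1)) ∈ strip r ρ R (S i) := by
  have huIcc : ∀ {a b c : ℝ}, a ∈ Icc (0 : ℝ) 1 → b ∈ Icc (0 : ℝ) 1 → c ∈ uIcc a b →
      c ∈ Icc (0 : ℝ) 1 := fun ha hb hc => (uIcc_subset_Icc ha hb) hc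
  -- the value at the start of a block is at most `R` once the previous strip is respected
  have htop : ∀ s j, (∀ i < j, peak (u s) (A i) (O (i + 1)) ∈ strip r ρ R (S i)) →
      u s (O j) ≤ R := by
    intro s j hj
    cases j with
    | zero => exact hstart s
    | succ j => exact (le_peak (hAO j) le_rfl).trans (le_of_mem_strip hrρ hρR (hj j j.lt_succ_self))
  have hstep : ∀ j < m, ∀ a ∈ Icc (0 : ℝ) 1, ∀ b ∈ Icc (0 : ℝ) 1,
      peak (u a) (A j) (O (j + 1)) < 0 → R < peak (u b) (A j) (O (j + 1)) →
      (∀ s ∈ uIcc a b, ∀ i < j, peak (u s) (A i) (O (i + 1)) ∈ strip r ρ R (S i)) →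
      ∃ s₀ ∈ Icc (0 : ℝ) 1, ∃ s₁ ∈ Icc (0 : ℝ) 1, u s₀ (O (j + 1)) < 0 ∧
        (κ ≤ v s₁ (O (j + 1)) ∧ 0 ≤ u s₁ (O (j + 1))) ∧
        ∀ s ∈ uIcc s₀ s₁, ∀ i < j + 1, peak (u s) (A i) (O (i + 1)) ∈ strip r ρ R (S i) := by
    intro j hj a ha b hb hna hRb hab
    obtain ⟨c, hc, d, hd, hfc, hfd, hcd⟩ := exists_strip_crossing
      (continuous_peak hu (A j) (O (j + 1))) hr hrρ hρR hna hRb (S j)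
    have hA : ∀ s, 0 < peak (u s) (A j) (O (j + 1)) → 0 ≤ u s (A j) := by
      intro s hs
      by_contra! hlt
      obtain ⟨k, hk1, _, hk⟩ := exists_eq_peak (u s) (hAO j)
      linarith [hneg s _ _ hk1 hlt]
    refine ⟨c, huIcc ha hb hc, d, huIcc ha hb hd, ?_, ?_, ?_⟩
    · rcases hfc with hfc | hfc
      · exact (le_peak (hAO j) le_rfl).trans_lt hfc
      · by_contra! hB
        obtain ⟨k, hk1, hk2, hk⟩ := exists_eq_peak (u c) (hAO j)
        exact (hlaw c j hj).ne_mid (hA c (by linarith)) hB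
          (fun z hz1 hz2 => (le_peak hz1 hz2).trans_eq hfc) k hk1 hk2 (hk.trans hfc)
    · obtain ⟨k, hk1, hk2, hk⟩ := exists_eq_peak (u d) (hAO j)
      refine (hlaw d j hj).slope_ge _ hfd (htop d j (hab d hd)) (hA d ?_)
        (fun z hz1 hz2 => le_peak hz1 hz2) k hk1 hk2 hk
      rcases hfd with h | h <;> linarith
    · intro s hs i hi
      rcases Nat.lt_succ_iff_lt_or_eq.1 hi with hi | rfl
      · exact hab s (uIcc_subset_uIcc hc hd hs) i hi
      · exact hcd s hs
  have hall : ∀ j < m, ∃ s₀ ∈ Icc (0 : ℝ) 1, ∃ s₁ ∈ Icc (0 : ℝ) 1, u s₀ (O (j + 1)) < 0 ∧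
      (κ ≤ v s₁ (O (j + 1)) ∧ 0 ≤ u s₁ (O (j + 1))) ∧
      ∀ s ∈ uIcc s₀ s₁, ∀ i < j + 1, peak (u s) (A i) (O (i + 1)) ∈ strip r ρ R (S i) := by
    intro j
    induction j with
    | zero =>
      exact fun hj => hstep 0 hj 0 ⟨le_rfl, zero_le_one⟩ 1 ⟨zero_le_one, le_rfl⟩ h0 h1
        fun s _ i hi => absurd hi (Nat.not_lt_zero i)
    | succ j ih =>
      intro hj
      obtain ⟨a, ha, b, hb, hna, ⟨hvb, hub⟩, hab⟩ := ih (by omega)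
      refine hstep (j + 1) hj a ha b hb ?_ ?_ hab
      · obtain ⟨k, hk1, _, hk⟩ := exists_eq_peak (u a) (hAO (j + 1))
        rw [← hk]
        exact hneg a _ _ ((hOA _).trans hk1) hna
      · exact ((hlaw b (j + 1) hj).gt_top hub (htop b _ (hab b right_mem_uIcc)) hvb).trans_le
          (le_peak le_rfl (hAO _))
  obtain ⟨j, rfl⟩ : ∃ j, m = j + 1 := ⟨m - 1, by omega⟩
  exact hall j j.lt_succ_self

/-- The kicked system has a periodic orbit with any prescribed nontrivial itinerary. -/
theorem exists_periodic_orbit {t : ℕ → ℝ} {q G : ℝ → ℝ} (ht : StrictMono t) (hGc : Continuous G)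
    (hG : ∀ s ≤ 0, G s = 0) {O A : ℕ → ℕ} (hO : O 0 = 0) (hA : 0 < A 0) (hOA : ∀ i, O i ≤ A i)
    (hAO : ∀ i, A i ≤ O (i + 1)) {m : ℕ} (hm : 0 < m) {r ρ R κ : ℝ} (hr : 0 < r) (hrρ : r < ρ)
    (hρR : ρ < R) (hκ : 0 < κ)
    (hlaw : ∀ z, ∀ i < m, BlockLaw (fun k => (orbit t q G z k).1) (fun k => (orbit t q G z k).2)
      r ρ R κ (O i) (A i) (O (i + 1)))
    {S : ℕ → Fin 3} (hS : ∃ i < m, S i ≠ 0) :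
    ∃ z, orbit t q G z (O m) = z ∧ (∀ k ≤ O m, (orbit t q G z k).1 ∈ Icc 0 R) ∧
      ∀ i < m, peak (fun k => (orbit t q G z k).1) (A i) (O (i + 1)) ∈ strip r ρ R (S i) := by
  have hR : 0 < R := by linarith
  have hcont : ∀ k, Continuous fun z => orbit t q G z k := continuous_orbit hGc
  have hOmono : Monotone O := monotone_nat_of_le_succ fun i => (hOA i).trans (hAO i)
  have hOm : 0 < O m := hA.trans_le ((hAO 0).trans (hOmono hm))
  have hh : 0 < t 1 - t 0 := sub_pos.2 (ht zero_lt_one)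
  set V : ℝ := R / (t 1 - t 0) + 1 with hV
  have hV0 : 0 < V := by positivity
  set Φ : ℝ × ℝ → ℝ × ℝ := fun z => orbit t q G z (O m) with hΦ
  set d : ℝ × ℝ → ℝ := fun z => min ((Φ z).2 - z.2) (Φ z).1 with hd
  have hΦc : Continuous Φ := hcont _
  have hdc : Continuous d := by fun_prop
  set itin : ℝ × ℝ → Prop := fun z =>
    ∀ i < m, peak (fun k => (orbit t q G z k).1) (A i) (O (i + 1)) ∈ strip r ρ R (S i) with hitin
  have hlast : ∀ z j, j ≤ m → z.1 ≤ R → itin z → (orbit t q G z (O j)).1 ≤ R := by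
    intro z j hj hz h
    cases j with
    | zero => rw [hO]; exact hz
    | succ j =>
      exact (le_peak (u := fun k => (orbit t q G z k).1) (hAO j) le_rfl).trans
        (le_of_mem_strip hrρ hρR (h j hj))
  have hWc : IsClosed {z | itin z ∧ d z = 0} := by
    refine IsClosed.and ?_ (isClosed_eq hdc continuous_const)
    simp only [hitin, ofPred_forall]
    refine isClosed_iInter fun i => isClosed_iInter fun _ => ?_
    exact (isClosed_strip r ρ R (S i)).preimage
      (continuous_peak (u := fun z k => (orbit t q G z k).1) (fun k => (hcont k).fst) _ _)
  obtain ⟨z, ⟨hz1, hz2⟩, ⟨hzx, hzy⟩, hz3⟩ := exists_zero_of_meets_paths (x₀ := 0) (x₁ := R)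
      (y₀ := -V) (y₁ := κ) hR (by linarith) hWc (f := fun z => (Φ z).1 - z.1) (by fun_prop)
      (by
        rintro z ⟨_, h⟩ hz
        have : 0 ≤ (Φ z).1 := h ▸ min_le_right _ _
        simpa [hz] using this)
      (by
        rintro z ⟨h, _⟩ hz
        have := hlast z m le_rfl hz.le h
        simp only [hΦ, hz]
        linarith)
      (by
        intro γ hγ hbox hbot htop
        have hneg : ∀ s k l, k ≤ l → (orbit t q G (γ s) k).1 < 0 →
            (orbit t q G (γ s) l).1 < 0 := fun s k l hkl h =>
          (orbit_le_of_neg ht hG (hbox s).1.1 hkl h).trans_lt h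
        have hu : ∀ k, Continuous fun s => (orbit t q G (γ s) k).1 := fun k =>
          ((hcont k).comp hγ).fst
        obtain ⟨s₀, hs₀, s₁, hs₁, h0, ⟨h1, h1'⟩, h2⟩ := exists_itinerary_piece
          (u := fun s k => (orbit t q G (γ s) k).1) (v := fun s k => (orbit t q G (γ s) k).2)
          hu hneg hOA hAO hm hr hrρ hρR (fun s i hi => hlaw (γ s) i hi)
          (fun s => by rw [hO]; exact (hbox s).1.2)
          (by
            obtain ⟨k, hk1, _, hk⟩ := exists_eq_peak (fun k => (orbit t q G (γ 0) k).1) (hAO 0)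
            rw [← hk]
            refine hneg 0 1 k (by omega) ?_
            rw [orbit_fst_succ]
            change (γ 0).1 + (t 1 - t 0) * (γ 0).2 < 0
            rw [hbot, hV]
            have : (t 1 - t 0) * -(R / (t 1 - t 0) + 1) = -R - (t 1 - t 0) := by
              field_simp
              ring
            rw [this]
            linarith [(hbox 0).1.2])
          (by
            refine lt_of_lt_of_le ?_ (le_peak le_rfl (hAO 0))
            refine (hlaw (γ 1) 0 hm).gt_top ?_ ?_ ?_
            · rw [hO]; exact (hbox 1).1.1
            · rw [hO]; exact (hbox 1).1.2
            · rw [hO]; exact htop.ge)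
          S
        have hmem : (0 : ℝ) ∈ uIcc (d (γ s₀)) (d (γ s₁)) := by
          refine mem_uIcc.2 (Or.inl ⟨(min_le_right _ _).trans h0.le, le_min ?_ h1'⟩)
          have := (hbox s₁).2.2
          simp only [hΦ]
          linarith
        obtain ⟨s, hs, e⟩ := intermediate_value_uIcc (hdc.comp hγ).continuousOn hmem
        exact ⟨s, uIcc_subset_Icc hs₀ hs₁ hs, h2 s hs, e⟩)
  have hfst : (Φ z).1 = z.1 := sub_eq_zero.1 hz3
  have hsnd : (Φ z).2 = z.2 := by
    by_contra hne
    have h1 : 0 ≤ (Φ z).2 - z.2 := hz2 ▸ min_le_left _ _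
    have h2 : (Φ z).1 = 0 := by
      rcases min_choice ((Φ z).2 - z.2) (Φ z).1 with h | h
      · exact absurd (sub_eq_zero.1 (h.symm.trans hz2)) hne
      · exact h.symm.trans hz2
    obtain ⟨N, hN⟩ : ∃ N, O m = N + 1 := ⟨O m - 1, by omega⟩
    have h3 : (Φ z).2 ≤ 0 := by
      have := orbit_pos_or_slope_nonpos (q := q) ht hG hzx.1 N
      rw [← hN] at this
      exact this.resolve_left h2.not_gt
    obtain ⟨i, hi, hSi⟩ := hS
    obtain ⟨k, _, _, hk⟩ := exists_eq_peak (fun k => (orbit t q G z k).1) (hAO i)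
    have h4 := le_of_mem_strip_of_ne hrρ hSi (hz1 i hi)
    have h5 := (orbit_sink (q := q) ht.monotone hG (z := z) (Nat.zero_le k)
      (by change z.1 ≤ 0; rw [← hfst, h2]) (by change z.2 ≤ 0; linarith)).1
    change _ ≤ z.1 at h5
    rw [← hfst, h2] at h5
    linarith
  refine ⟨z, Prod.ext hfst hsnd, fun k hk => ⟨?_, ?_⟩, hz1⟩
  · by_contra! h
    have := orbit_le_of_neg ht hG hzx.1 hk h
    change (Φ z).1 ≤ _ at this
    linarith [hzx.1]
  · have : ∀ j ≤ m, ∀ k ≤ O j, (orbit t q G z k).1 ≤ R := by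
      intro j
      induction j with
      | zero =>
        intro _ k hk
        rw [hO] at hk
        rw [Nat.le_zero.1 hk]
        exact hzx.2
      | succ j ih =>
        intro hj k hk
        have hpk : ∀ k, A j ≤ k → k ≤ O (j + 1) → (orbit t q G z k).1 ≤ R := fun k h1 h2 =>
          (le_peak (u := fun k => (orbit t q G z k).1) h1 h2).trans
            (le_of_mem_strip hrρ hρR (hz1 j hj))
        rcases le_total k (O j) with h | h
        · exact ih (by omega) k h
        rcases le_total k (A j) with h' | h'
        · exact (hlaw z j hj).le_top (hlast z j (by omega) hzx.2 hz1) (hpk _ le_rfl (hAO j)) k h h'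
        · exact hpk k h' hk
    exact this m le_rfl k hk

/-- A uniformly bounded and uniformly Lipschitz sequence on a compact interval has a uniformly
convergent subsequence. -/
theorem exists_subseq_tendstoUniformlyOn_of_lipschitz {U : ℕ → ℝ → ℝ} {a b K : ℝ} (hab : a ≤ b)
    {L : NNReal} (hK : ∀ n, ∀ x ∈ Icc a b, |U n x| ≤ K) (hL : ∀ n, LipschitzWith L (U n)) :
    ∃ φ : ℕ → ℕ, StrictMono φ ∧ ∃ V : ℝ → ℝ, Continuous V ∧
      TendstoUniformlyOn (fun n => U (φ n)) V atTop (Icc a b) := by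
  let F : ℕ → BoundedContinuousFunction (Icc a b) ℝ := fun n =>
    BoundedContinuousFunction.mkOfCompact
      ⟨fun x => U n x, (hL n).continuous.comp continuous_subtype_val⟩
  have hcomp : IsCompact (closure (range F)) := by
    refine BoundedContinuousFunction.arzela_ascoli (Icc (-K) K) isCompact_Icc _ ?_ ?_
    · rintro _ x ⟨n, rfl⟩
      exact abs_le.1 (hK n x x.2)
    · refine (LipschitzWith.uniformEquicontinuous _ L ?_).equicontinuous
      rintro ⟨_, n, rfl⟩ x y
      exact hL n x y
  obtain ⟨f, _, φ, hφ, hlim⟩ := hcomp.tendsto_subseq fun n => subset_closure (mem_range_self n)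
  refine ⟨φ, hφ, IccExtend hab f, f.continuous.Icc_extend', ?_⟩
  rw [tendstoUniformlyOn_iff_tendstoUniformly_comp_coe]
  have h := BoundedContinuousFunction.tendsto_iff_tendstoUniformly.1 hlim
  have e : IccExtend hab f ∘ Subtype.val = f := by
    ext x
    simp [IccExtend_val]
  rw [e]
  exact h

/-- Kicked sums converge to integrals as the mesh of the grid tends to zero. -/
theorem tendsto_kick_sum {t : ℕ → ℕ → ℝ} {N : ℕ → ℕ} {a b : ℝ} (ht : ∀ n, Monotone (t n))
    (h0 : ∀ n, t n 0 = a) (hN : ∀ n, t n (N n) = b)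
    (hmesh : ∀ ε > 0, ∀ᶠ n in atTop, ∀ k < N n, t n (k + 1) - t n k < ε) {q : ℝ → ℝ}
    (hq : ∀ x y, IntervalIntegrable q volume x y) {φ : ℕ → ℝ → ℝ} {f : ℝ → ℝ}
    (hf : Continuous f) (hlim : TendstoUniformlyOn φ f atTop (Icc a b)) :
    Tendsto (fun n => ∑ k ∈ Finset.range (N n), (∫ s in t n k..t n (k + 1), q s) *
      φ n (t n (k + 1))) atTop (𝓝 (∫ s in a..b, q s * f s)) := by
  have hqf : ∀ x y, IntervalIntegrable (fun s => q s * f s) volume x y := fun x y =>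
    (hq x y).mul_continuousOn hf.continuousOn
  have hab : a ≤ b := by rw [← h0 0, ← hN 0]; exact ht 0 (Nat.zero_le _)
  set Q := ∫ s in a..b, |q s| with hQ
  have hQ0 : 0 ≤ Q := intervalIntegral.integral_nonneg hab fun s _ => abs_nonneg _
  rw [Metric.tendsto_atTop']
  suffices h : ∀ ε > 0, ∀ᶠ n in atTop, |(∑ k ∈ Finset.range (N n),
      (∫ s in t n k..t n (k + 1), q s) * φ n (t n (k + 1))) - ∫ s in a..b, q s * f s| ≤ ε * Q by
    intro ε hε
    obtain ⟨n₀, hn₀⟩ := eventually_atTop.1 (h (ε / (Q + 1)) (by positivity))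
    refine ⟨n₀, fun n hn => (hn₀ n hn.le).trans_lt ?_⟩
    rw [div_mul_eq_mul_div, div_lt_iff₀ (by positivity)]
    nlinarith
  intro ε hε
  have huc := (isCompact_Icc (a := a) (b := b)).uniformContinuousOn_of_continuous hf.continuousOn
  obtain ⟨δ, hδ, hδf⟩ := Metric.uniformContinuousOn_iff.1 huc (ε / 2) (by positivity)
  filter_upwards [hmesh δ hδ, Metric.tendstoUniformlyOn_iff.1 hlim (ε / 2) (by positivity)]
    with n hn1 hn2
  have hcell : ∀ k < N n, ∀ s ∈ Icc (t n k) (t n (k + 1)), |φ n (t n (k + 1)) - f s| ≤ ε := by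
    intro k hk s hs
    have m1 : t n (k + 1) ∈ Icc a b :=
      ⟨h0 n ▸ ht n (Nat.zero_le _), hN n ▸ ht n (Nat.succ_le_of_lt hk)⟩
    have m2 : s ∈ Icc a b := ⟨(h0 n ▸ ht n (Nat.zero_le k)).trans hs.1, hs.2.trans m1.2⟩
    have e1 := hn2 _ m1
    have e2 := hδf _ m1 s m2 (by
      rw [Real.dist_eq, abs_of_nonneg (by linarith [hs.2])]
      linarith [hn1 k hk, hs.1])
    rw [dist_comm] at e1
    rw [← Real.dist_eq]
    linarith [dist_triangle (φ n (t n (k + 1))) (f (t n (k + 1))) (f s)]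
  have e1 : ∫ s in a..b, q s * f s =
      ∑ k ∈ Finset.range (N n), ∫ s in t n k..t n (k + 1), q s * f s := by
    rw [intervalIntegral.sum_integral_adjacent_intervals fun k _ => hqf _ _, h0, hN]
  have e2 : Q = ∑ k ∈ Finset.range (N n), ∫ s in t n k..t n (k + 1), |q s| := by
    rw [intervalIntegral.sum_integral_adjacent_intervals fun k _ => (hq _ _).abs, h0, hN]
  rw [e1, ← Finset.sum_sub_distrib, e2, Finset.mul_sum]
  refine (Finset.abs_sum_le_sum_abs _ _).trans (Finset.sum_le_sum fun k hk => ?_)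
  have hk' := Finset.mem_range.1 hk
  have hle := ht n k.le_succ
  rw [← intervalIntegral.integral_mul_const, ← intervalIntegral.integral_sub
    ((hq _ _).mul_const _) (hqf _ _), ← intervalIntegral.integral_const_mul]
  refine (intervalIntegral.abs_integral_le_integral_abs hle).trans ?_
  refine intervalIntegral.integral_mono_on hle
    ((((hq _ _).mul_const _).sub (hqf _ _)).abs) ((hq _ _).abs.const_mul ε) fun s hs => ?_
  rw [← mul_sub, abs_mul, mul_comm]
  exact mul_le_mul_of_nonneg_right (hcell k hk' s hs) (abs_nonneg _)

section Hinge

variable {t : ℕ → ℝ} {q G : ℝ → ℝ} {z : ℝ × ℝ}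

theorem orbit_eq_sum (j : ℕ) :
    (orbit t q G z j).2 = z.2 - ∑ k ∈ Finset.range j,
      (∫ s in t k..t (k + 1), q s) * G (orbit t q G z (k + 1)).1 ∧
    (orbit t q G z j).1 = z.1 + z.2 * (t j - t 0) - ∑ k ∈ Finset.range j,
      (∫ s in t k..t (k + 1), q s) * (G (orbit t q G z (k + 1)).1 * (t j - t (k + 1))) := by
  induction j with
  | zero => simp [orbit]
  | succ j ih =>
    rw [orbit_snd_succ, orbit_fst_succ, Finset.sum_range_succ, Finset.sum_range_succ]
    refine ⟨by rw [← orbit_fst_succ, ih.1]; ring, ?_⟩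
    have e : ∑ k ∈ Finset.range j, (∫ s in t k..t (k + 1), q s) *
        (G (orbit t q G z (k + 1)).1 * (t (j + 1) - t (k + 1))) =
        ∑ k ∈ Finset.range j, (∫ s in t k..t (k + 1), q s) *
        (G (orbit t q G z (k + 1)).1 * (t j - t (k + 1))) + (t (j + 1) - t j) *
        ∑ k ∈ Finset.range j, (∫ s in t k..t (k + 1), q s) * G (orbit t q G z (k + 1)).1 := by
      rw [Finset.mul_sum, ← Finset.sum_add_distrib]
      exact Finset.sum_congr rfl fun k _ => by ring
    rw [e, ih.1, ih.2]
    ring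

/-- The piecewise linear interpolation of the positions of an orbit. -/
noncomputable def hinge (t : ℕ → ℝ) (q G : ℝ → ℝ) (z : ℝ × ℝ) (N : ℕ) (x : ℝ) : ℝ :=
  z.1 + z.2 * (x - t 0) - ∑ k ∈ Finset.range N,
    (∫ s in t k..t (k + 1), q s) * (G (orbit t q G z (k + 1)).1 * max (x - t (k + 1)) 0)

theorem hinge_grid (ht : Monotone t) {j N : ℕ} (hj : j ≤ N) :
    hinge t q G z N (t j) = (orbit t q G z j).1 := by
  rw [hinge, (orbit_eq_sum j).2]
  congr 1
  rw [← Finset.sum_subset (Finset.range_mono hj)]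
  · refine Finset.sum_congr rfl fun k hk => ?_
    rw [max_eq_left (sub_nonneg.2 (ht (Nat.succ_le_of_lt (Finset.mem_range.1 hk))))]
  · intro k _ hk
    have : j ≤ k + 1 := by
      have := Finset.mem_range.not.1 hk
      omega
    rw [max_eq_right (sub_nonpos.2 (ht this))]
    ring

theorem sum_abs_kick_le (ht : Monotone t) (hq : ∀ x y, IntervalIntegrable q volume x y) {C : ℝ}
    (hC : ∀ s, |G s| ≤ C) (N : ℕ) :
    ∑ k ∈ Finset.range N, |(∫ s in t k..t (k + 1), q s) * G (orbit t q G z (k + 1)).1| ≤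
      (∫ s in t 0..t N, |q s|) * C := by
  rw [← intervalIntegral.sum_integral_adjacent_intervals fun k _ => (hq _ _).abs, Finset.sum_mul]
  refine Finset.sum_le_sum fun k _ => ?_
  rw [abs_mul]
  exact mul_le_mul (intervalIntegral.abs_integral_le_integral_abs (ht k.le_succ)) (hC _)
    (abs_nonneg _) (intervalIntegral.integral_nonneg (ht k.le_succ) fun s _ => abs_nonneg _)

theorem abs_hinge_sub_le (ht : Monotone t) (hq : ∀ x y, IntervalIntegrable q volume x y) {C : ℝ}
    (hC : ∀ s, |G s| ≤ C) (N : ℕ) (x y : ℝ) :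
    |hinge t q G z N x - hinge t q G z N y| ≤
      (|z.2| + (∫ s in t 0..t N, |q s|) * C) * |x - y| := by
  have e : hinge t q G z N x - hinge t q G z N y = z.2 * (x - y) - ∑ k ∈ Finset.range N,
      ((∫ s in t k..t (k + 1), q s) * G (orbit t q G z (k + 1)).1) *
        (max (x - t (k + 1)) 0 - max (y - t (k + 1)) 0) := by
    have : ∑ k ∈ Finset.range N, ((∫ s in t k..t (k + 1), q s) * G (orbit t q G z (k + 1)).1) *
        (max (x - t (k + 1)) 0 - max (y - t (k + 1)) 0) =
        ∑ k ∈ Finset.range N, (∫ s in t k..t (k + 1), q s) *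
          (G (orbit t q G z (k + 1)).1 * max (x - t (k + 1)) 0) -
        ∑ k ∈ Finset.range N, (∫ s in t k..t (k + 1), q s) *
          (G (orbit t q G z (k + 1)).1 * max (y - t (k + 1)) 0) := by
      rw [← Finset.sum_sub_distrib]
      exact Finset.sum_congr rfl fun k _ => by ring
    rw [this, hinge, hinge]
    ring
  have hsum := sum_abs_kick_le (z := z) ht hq hC N
  rw [e, add_mul]
  refine (abs_sub _ _).trans (add_le_add (abs_mul _ _).le ?_)
  refine le_trans ?_ (mul_le_mul_of_nonneg_right hsum (abs_nonneg _))
  rw [Finset.sum_mul]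
  refine (Finset.abs_sum_le_sum_abs _ _).trans (Finset.sum_le_sum fun k _ => ?_)
  rw [abs_mul]
  refine mul_le_mul_of_nonneg_left ?_ (abs_nonneg _)
  refine (abs_max_sub_max_le_abs _ _ _).trans_eq ?_
  congr 1
  ring

/-- The initial slope of a periodic orbit is bounded. -/
theorem abs_slope_le_of_periodic (ht : Monotone t) (hq : ∀ x y, IntervalIntegrable q volume x y)
    {C : ℝ} (hC : ∀ s, |G s| ≤ C) {N : ℕ} (hN : t 0 < t N) (hz : (orbit t q G z N).1 = z.1) :
    |z.2| ≤ (∫ s in t 0..t N, |q s|) * C := by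
  have h := (orbit_eq_sum (t := t) (q := q) (G := G) (z := z) N).2
  rw [hz] at h
  have e : z.2 * (t N - t 0) = ∑ k ∈ Finset.range N,
      (∫ s in t k..t (k + 1), q s) * (G (orbit t q G z (k + 1)).1 * (t N - t (k + 1))) := by
    linarith
  have hpos : 0 < t N - t 0 := sub_pos.2 hN
  refine le_of_mul_le_mul_right ?_ hpos
  calc |z.2| * (t N - t 0) = |z.2 * (t N - t 0)| := by rw [abs_mul, abs_of_pos hpos]
    _ ≤ ∑ k ∈ Finset.range N, |(∫ s in t k..t (k + 1), q s) * G (orbit t q G z (k + 1)).1| *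
        (t N - t 0) := by
      rw [e]
      refine (Finset.abs_sum_le_sum_abs _ _).trans (Finset.sum_le_sum fun k hk => ?_)
      rw [← mul_assoc, abs_mul]
      refine mul_le_mul_of_nonneg_left ?_ (abs_nonneg _)
      have h1 := ht (Nat.succ_le_of_lt (Finset.mem_range.1 hk))
      have h2 := ht (Nat.zero_le (k + 1))
      rw [abs_of_nonneg (sub_nonneg.2 h1)]
      linarith
    _ ≤ _ := by
      rw [← Finset.sum_mul]
      exact mul_le_mul_of_nonneg_right (sum_abs_kick_le ht hq hC N) hpos.le

end Hinge

/-- Periodic orbits of the kicked systems over finer and finer grids accumulate at a function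
satisfying the integral equation of the periodic problem. -/
theorem exists_limit_of_periodic_orbits {t : ℕ → ℕ → ℝ} {N : ℕ → ℕ} {a b : ℝ} (hab : a < b)
    (ht : ∀ n, Monotone (t n)) (h0 : ∀ n, t n 0 = a) (hN : ∀ n, t n (N n) = b)
    (hmesh : ∀ ε > 0, ∀ᶠ n in atTop, ∀ k < N n, t n (k + 1) - t n k < ε) {q G : ℝ → ℝ}
    (hq : ∀ x y, IntervalIntegrable q volume x y) (hG : UniformContinuous G) {C : ℝ}
    (hC : ∀ s, |G s| ≤ C) {z : ℕ → ℝ × ℝ} (hz : ∀ n, orbit (t n) q G (z n) (N n) = z n) {R : ℝ}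
    (hzR : ∀ n, (z n).1 ∈ Icc 0 R) :
    ∃ φ : ℕ → ℕ, StrictMono φ ∧ ∃ U : ℝ → ℝ, ∃ y : ℝ, Continuous U ∧
      (∀ x ∈ Icc a b, U x = U a + y * (x - a) - ∫ s in a..b, q s * (G (U s) * max (x - s) 0)) ∧
      (∫ s in a..b, q s * G (U s)) = 0 ∧ U b = U a ∧
      ∀ ε > 0, ∀ᶠ n in atTop, ∀ k ≤ N (φ n),
        |(orbit (t (φ n)) q G (z (φ n)) k).1 - U (t (φ n) k)| ≤ ε := by
  set Q := (∫ s in a..b, |q s|) * C with hQ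
  have hC0 : 0 ≤ C := (abs_nonneg _).trans (hC 0)
  have hQ0 : 0 ≤ Q :=
    mul_nonneg (intervalIntegral.integral_nonneg hab.le fun s _ => abs_nonneg _) hC0
  have hy : ∀ n, |(z n).2| ≤ Q := by
    intro n
    have := abs_slope_le_of_periodic (z := z n) (ht n) hq hC (N := N n)
      (by rw [h0, hN]; exact hab) (by rw [hz])
    rwa [h0, hN] at this
  obtain ⟨y, _, φ₁, hφ₁, hylim⟩ := (isCompact_Icc (a := -Q) (b := Q)).tendsto_subseq
    fun n => abs_le.1 (hy n)
  have hinge_sub : ∀ n x x', |hinge (t n) q G (z n) (N n) x - hinge (t n) q G (z n) (N n) x'| ≤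
      (Q + Q) * |x - x'| := by
    intro n x x'
    refine (abs_hinge_sub_le (ht n) hq hC (N n) x x').trans ?_
    rw [h0, hN]
    gcongr
    exact hy n
  have hinge_zero : ∀ n, hinge (t n) q G (z n) (N n) a = (z n).1 := by
    intro n
    rw [← h0 n, hinge_grid (ht n) (Nat.zero_le _)]
    rfl
  obtain ⟨φ₂, hφ₂, U, hU, hUlim⟩ := exists_subseq_tendstoUniformlyOn_of_lipschitz
    (U := fun n => hinge (t (φ₁ n)) q G (z (φ₁ n)) (N (φ₁ n))) (K := R + (Q + Q) * (b - a))
    (L := ⟨Q + Q, by positivity⟩) hab.le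
    (by
      intro n x hx
      have h1 := hinge_sub (φ₁ n) x a
      have h2 := hzR (φ₁ n)
      rw [hinge_zero, abs_of_nonneg (sub_nonneg.2 hx.1)] at h1
      have h3 : (Q + Q) * (x - a) ≤ (Q + Q) * (b - a) :=
        mul_le_mul_of_nonneg_left (by linarith [hx.2]) (by positivity)
      rw [abs_le] at h1 ⊢
      exact ⟨by linarith [h1.1, h2.1, h2.2], by linarith [h1.2, h2.2]⟩)
    (fun n => LipschitzWith.of_dist_le_mul fun x x' => hinge_sub (φ₁ n) x x')
  set φ := fun n => φ₁ (φ₂ n) with hφdef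
  have hφ : StrictMono φ := hφ₁.comp hφ₂
  have hylim' : Tendsto (fun n => (z (φ n)).2) atTop (𝓝 y) := hylim.comp hφ₂.tendsto_atTop
  have hpt : ∀ x ∈ Icc a b, Tendsto (fun n => hinge (t (φ n)) q G (z (φ n)) (N (φ n)) x) atTop
      (𝓝 (U x)) := fun x hx => hUlim.tendsto_at hx
  have hxlim : Tendsto (fun n => (z (φ n)).1) atTop (𝓝 (U a)) :=
    (hpt a ⟨le_rfl, hab.le⟩).congr fun n => hinge_zero _
  have hend : ∀ n, hinge (t n) q G (z n) (N n) b = (z n).1 := by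
    intro n
    rw [← hN n, hinge_grid (ht n) le_rfl, hz]
  have hmesh' : ∀ ε > 0, ∀ᶠ n in atTop, ∀ k < N (φ n), t (φ n) (k + 1) - t (φ n) k < ε :=
    fun ε hε => hφ.tendsto_atTop.eventually (hmesh ε hε)
  have hGlim : TendstoUniformlyOn (fun n => G ∘ hinge (t (φ n)) q G (z (φ n)) (N (φ n))) (G ∘ U)
      atTop (Icc a b) := hG.comp_tendstoUniformlyOn hUlim
  -- convergence of the kicked sums against a fixed continuous test function
  have hsum : ∀ H : ℝ → ℝ, Continuous H → Tendsto (fun n => ∑ k ∈ Finset.range (N (φ n)),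
      (∫ s in t (φ n) k..t (φ n) (k + 1), q s) *
        (G (orbit (t (φ n)) q G (z (φ n)) (k + 1)).1 * H (t (φ n) (k + 1)))) atTop
      (𝓝 (∫ s in a..b, q s * (G (U s) * H s))) := by
    intro H hH
    obtain ⟨D, hD⟩ := (isCompact_Icc (a := a) (b := b)).exists_bound_of_continuousOn
      hH.continuousOn
    have hlim : TendstoUniformlyOn
        (fun n x => G (hinge (t (φ n)) q G (z (φ n)) (N (φ n)) x) * H x)
        (fun x => G (U x) * H x) atTop (Icc a b) := by
      rw [Metric.tendstoUniformlyOn_iff] at hGlim ⊢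
      intro ε hε
      have hD0 : 0 ≤ D := (norm_nonneg _).trans (hD a ⟨le_rfl, hab.le⟩)
      filter_upwards [hGlim (ε / (D + 1)) (by positivity)] with n hn x hx
      have h1 := hn x hx
      have h2 := hD x hx
      rw [Real.dist_eq] at h1 ⊢
      rw [← sub_mul, abs_mul]
      rw [lt_div_iff₀ (by positivity)] at h1
      refine lt_of_le_of_lt (mul_le_mul_of_nonneg_left ?_ (abs_nonneg _)) h1
      rw [Real.norm_eq_abs] at h2
      linarith
    refine (tendsto_kick_sum (fun n => ht (φ n)) (fun n => h0 _) (fun n => hN _) hmesh' hq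
      (hG.continuous.comp hU |>.mul hH) hlim).congr fun n => ?_
    refine Finset.sum_congr rfl fun k hk => ?_
    rw [hinge_grid (ht _) (Nat.succ_le_of_lt (Finset.mem_range.1 hk))]
  refine ⟨φ, hφ, U, y, hU, ?_, ?_, ?_, ?_⟩
  · intro x hx
    refine tendsto_nhds_unique (hpt x hx) ?_
    have h1 := (hxlim.add (hylim'.mul_const (x - a))).sub
      (hsum (fun s => max (x - s) 0) (by fun_prop))
    refine h1.congr fun n => ?_
    rw [hinge, h0]
  · have h1 := hsum (fun _ => 1) continuous_const
    simp only [mul_one] at h1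
    refine tendsto_nhds_unique h1 (tendsto_const_nhds.congr fun n => ?_)
    have h2 := (orbit_eq_sum (t := t (φ n)) (q := q) (G := G) (z := z (φ n)) (N (φ n))).1
    rw [hz] at h2
    linarith
  · refine tendsto_nhds_unique (hpt b ⟨hab.le, le_rfl⟩) (hxlim.congr fun n => ?_)
    rw [hend]
  · intro ε hε
    filter_upwards [Metric.tendstoUniformlyOn_iff.1 hUlim ε hε] with n hn k hk
    have hmem : t (φ n) k ∈ Icc a b := ⟨h0 (φ n) ▸ ht _ (Nat.zero_le _), hN (φ n) ▸ ht _ hk⟩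
    have h1 := hn _ hmem
    rw [dist_comm, Real.dist_eq, hinge_grid (ht _) hk] at h1
    exact h1.le

theorem hasDerivAt_integral_mul_sub {f : ℝ → ℝ} (hf : ∀ x y, IntervalIntegrable f volume x y)
    (a x : ℝ) : HasDerivAt (fun x => ∫ s in a..x, f s * (x - s)) (∫ s in a..x, f s) x := by
  have hfs : ∀ c x y, IntervalIntegrable (fun s => f s * (c - s)) volume x y := fun c x y =>
    (hf x y).mul_continuousOn (by fun_prop)
  have key : ∀ x', |(∫ s in a..x', f s * (x' - s)) - (∫ s in a..x, f s * (x - s)) -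
      (x' - x) * ∫ s in a..x, f s| ≤ |(∫ s in x..x', |f s|)| * |x' - x| := by
    intro x'
    have e : (∫ s in a..x', f s * (x' - s)) - (∫ s in a..x, f s * (x - s)) -
        (x' - x) * (∫ s in a..x, f s) = ∫ s in x..x', f s * (x' - s) := by
      rw [← intervalIntegral.integral_add_adjacent_intervals (hfs x' a x) (hfs x' x x'),
        ← intervalIntegral.integral_const_mul]
      have : ∫ s in a..x, f s * (x' - s) = (∫ s in a..x, f s * (x - s)) +
          ∫ s in a..x, (x' - x) * f s := by
        rw [← intervalIntegral.integral_add (hfs x a x) ((hf a x).const_mul _)]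
        exact intervalIntegral.integral_congr fun s _ => by ring
      rw [this]
      ring
    rw [e]
    have h := intervalIntegral.norm_integral_le_abs_of_norm_le (μ := volume) (a := x) (b := x')
      (f := fun s => f s * (x' - s)) (g := fun s => |f s| * |x' - x|) ?_
      ((hf x x').abs.mul_const _)
    · rwa [intervalIntegral.integral_mul_const, abs_mul, abs_abs] at h
    · refine (ae_restrict_mem measurableSet_uIoc).mono fun s hs => ?_
      rw [Real.norm_eq_abs, abs_mul]
      refine mul_le_mul_of_nonneg_left ?_ (abs_nonneg _)
      exact abs_sub_right_of_mem_uIcc (uIoc_subset_uIcc hs)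
  rw [hasDerivAt_iff_isLittleO, Asymptotics.isLittleO_iff]
  intro c hc
  have hcont : Continuous fun x' => ∫ s in x..x', |f s| :=
    intervalIntegral.continuous_primitive (fun y z => (hf y z).abs) x
  have hlim := (hcont.abs.tendsto x)
  simp only [intervalIntegral.integral_same, abs_zero] at hlim
  filter_upwards [hlim.eventually (gt_mem_nhds hc)] with x' hx'
  rw [smul_eq_mul]
  exact (key x').trans (mul_le_mul_of_nonneg_right hx'.le (abs_nonneg _))

/-- A solution of the integral equation over one period extends to a periodic solution. -/
theorem exists_isSolR_of_integral_eq {q G U : ℝ → ℝ} {a T y : ℝ} (hT : 0 < T)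
    (hqT : ∀ x, q (x + T) = q x) (hq : ∀ x y, IntervalIntegrable q volume x y)
    (hG : Continuous G) (hU : Continuous U)
    (heq : ∀ x ∈ Icc a (a + T), U x = U a + y * (x - a) -
      ∫ s in a..a + T, q s * (G (U s) * max (x - s) 0))
    (hint : (∫ s in a..a + T, q s * G (U s)) = 0) (hUT : U (a + T) = U a) :
    ∃ u v : ℝ → ℝ, IsSolR q G u v ∧ (∀ x, u (x + T) = u x) ∧ ∀ x ∈ Icc a (a + T), u x = U x := by
  set P : ℝ → ℝ := fun x => U (toIcoMod hT a x) with hP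
  have hPT : ∀ x, P (x + T) = P x := fun x => by simp [hP]
  have hPU : ∀ x ∈ Icc a (a + T), P x = U x := by
    intro x hx
    rcases hx.2.eq_or_lt with rfl | h
    · simp [hP, hUT]
    · simp only [hP]
      rw [(toIcoMod_eq_self hT).2 ⟨hx.1, h⟩]
  set f : ℝ → ℝ := fun s => q s * G (P s) with hf
  have hfT : Function.Periodic f T := fun x => by simp only [hf, hqT, hPT]
  have hqU : ∀ x y, IntervalIntegrable (fun s => q s * G (U s)) volume x y := fun x y =>
    (hq x y).mul_continuousOn (hG.comp hU).continuousOn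
  have hfU : ∀ s ∈ Icc a (a + T), f s = q s * G (U s) := fun s hs => by
    simp only [hf, hPU s hs]
  have hfi : ∀ x y, IntervalIntegrable f volume x y := by
    refine hfT.intervalIntegrable hT.ne' ((hqU a (a + T)).congr fun s hs => ?_)
    rw [uIoc_of_le (by linarith)] at hs
    exact (hfU s ⟨hs.1.le, hs.2⟩).symm
  have hf0 : ∀ x, ∫ s in x..x + T, f s = 0 := by
    intro x
    rw [hfT.intervalIntegral_add_eq x a, ← hint]
    refine intervalIntegral.integral_congr fun s hs => ?_
    rw [uIcc_of_le (by linarith)] at hs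
    exact hfU s hs
  set v : ℝ → ℝ := fun x => y - ∫ s in a..x, f s with hv
  set u : ℝ → ℝ := fun x => U a + y * (x - a) - ∫ s in a..x, f s * (x - s) with hu
  have hd : ∀ x, HasDerivAt u (v x) x := by
    intro x
    have h1 : HasDerivAt (fun x : ℝ => U a + y * (x - a)) y x := by
      simpa using (((hasDerivAt_id x).sub_const a).const_mul y).const_add (U a)
    exact h1.sub (hasDerivAt_integral_mul_sub hfi a x)
  have hvT : ∀ x, v (x + T) = v x := by
    intro x
    simp only [hv]
    rw [← intervalIntegral.integral_add_adjacent_intervals (hfi a x) (hfi x (x + T)), hf0,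
      add_zero]
  have huU : ∀ x ∈ Icc a (a + T), u x = U x := by
    intro x hx
    rw [heq x hx]
    simp only [hu]
    congr 1
    have hqm : ∀ x' y', IntervalIntegrable (fun s => q s * (G (U s) * max (x - s) 0)) volume
        x' y' := fun x' y' => (hq x' y').mul_continuousOn
      ((hG.comp hU).mul (by fun_prop : Continuous fun s => max (x - s) 0)).continuousOn
    rw [← intervalIntegral.integral_add_adjacent_intervals (hqm a x) (hqm x (a + T))]
    have e1 : ∫ s in x..a + T, q s * (G (U s) * max (x - s) 0) = 0 := by
      rw [← intervalIntegral.integral_zero (μ := volume) (a := x) (b := a + T)]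
      refine intervalIntegral.integral_congr fun s hs => ?_
      rw [uIcc_of_le hx.2] at hs
      simp [max_eq_right (sub_nonpos.2 hs.1)]
    rw [e1, add_zero]
    refine intervalIntegral.integral_congr fun s hs => ?_
    rw [uIcc_of_le hx.1] at hs
    simp only [hfU s ⟨hs.1, hs.2.trans hx.2⟩, max_eq_left (sub_nonneg.2 hs.2), mul_assoc]
  have huT : ∀ x, u (x + T) = u x := by
    intro x
    have hd' : ∀ x, HasDerivAt (fun x => u (x + T) - u x) 0 x := by
      intro x
      have := ((hd (x + T)).comp_add_const x T).sub (hd x)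
      rwa [hvT, sub_self] at this
    have h := is_const_of_deriv_eq_zero (fun x => (hd' x).differentiableAt)
      (fun x => (hd' x).deriv) x a
    rw [huU a ⟨le_rfl, by linarith⟩, huU (a + T) ⟨by linarith, le_rfl⟩, hUT, sub_self] at h
    exact sub_eq_zero.1 h
  have huP : ∀ x, u x = P x := by
    intro x
    have hmem := toIcoMod_mem_Ico hT a x
    simp only [hP]
    rw [← huU _ ⟨hmem.1, hmem.2.le⟩, toIcoMod]
    exact ((show Function.Periodic u T from huT).sub_zsmul_eq _).symm
  refine ⟨u, v, ⟨hd, fun x₀ x => ?_⟩, huT, huU⟩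
  have e : (fun s => q s * G (u s)) = f := by
    ext s
    rw [huP]
  rw [e]
  simp only [hv]
  rw [← intervalIntegral.integral_add_adjacent_intervals (hfi a x₀) (hfi x₀ x)]
  ring

/-- The weight `λ a⁺ - μ a⁻`. -/
noncomputable def weight (a : ℝ → ℝ) (lam mu : ℝ) (t : ℝ) : ℝ :=
  lam * max (a t) 0 - mu * max (-a t) 0

/-- The quantitative relations between the weight, the nonlinearity and the thresholds. The times
`e (6 i), …, e (6 i + 6)` delimit the `i`-th interval of negativity `[e (6 i), e (6 i + 3)]` and
the `i`-th interval of positivity `[e (6 i + 3), e (6 i + 6)]`. -/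
structure Tuning (a G : ℝ → ℝ) (e : ℕ → ℝ) (m : ℕ) (T ℓ lam mu r ρ R c cρ ε : ℝ) : Prop where
  int : ∀ x y, IntervalIntegrable a volume x y
  strictMono : StrictMono e
  lam_nonneg : 0 ≤ lam
  mu_nonneg : 0 ≤ mu
  l_pos : 0 < ℓ
  gap : ∀ k < 6 * m, ℓ ≤ e (k + 1) - e k
  T_pos : 0 < T
  period : e (6 * m) = e 0 + T
  nonpos : ∀ i < m, ∀ᵐ s, s ∈ Icc (e (6 * i)) (e (6 * i + 3)) → a s ≤ 0
  nonneg : ∀ i < m, ∀ᵐ s, s ∈ Icc (e (6 * i + 3)) (e (6 * i + 6)) → 0 ≤ a s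
  r_pos : 0 < r
  r_lt : r < ρ
  lt_R : ρ < R
  G_nonneg : ∀ s, 0 ≤ G s
  le_mid : ∀ s ∈ Icc (ρ * ℓ / T) ρ, cρ ≤ G s
  mid : ∀ i < m, 2 * ρ / ℓ < cρ * ∫ s in e (6 * i + 4)..e (6 * i + 5), lam * max (a s) 0
  le_top : ∀ s ∈ Icc (min (r / 2) (r / (8 * T) * ℓ)) R, c ≤ G s
  top : ∀ i < m, 2 * R / ℓ < c * ∫ s in e (6 * i + 1)..e (6 * i + 2), mu * max (-a s) 0
  low_r : ∀ s ≤ r, G s ≤ ε * r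
  low_R : ∀ s ≤ R, G s ≤ ε * R
  low : ∀ i < m, ε * (∫ s in e (6 * i + 3)..e (6 * i + 6), lam * max (a s) 0) ≤ 1 / (8 * T)

namespace Tuning

variable {a G : ℝ → ℝ} {e : ℕ → ℝ} {m : ℕ} {T ℓ lam mu r ρ R c cρ ε : ℝ}

theorem int_pos (h : Tuning a G e m T ℓ lam mu r ρ R c cρ ε) (x y : ℝ) :
    IntervalIntegrable (fun s => lam * max (a s) 0) volume x y := by
  refine IntervalIntegrable.const_mul ?_ lam
  exact ⟨(h.int x y).1.pos_part, (h.int x y).2.pos_part⟩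

theorem int_neg (h : Tuning a G e m T ℓ lam mu r ρ R c cρ ε) (x y : ℝ) :
    IntervalIntegrable (fun s => mu * max (-a s) 0) volume x y := by
  refine IntervalIntegrable.const_mul ?_ mu
  exact ⟨(h.int x y).1.neg.pos_part, (h.int x y).2.neg.pos_part⟩

theorem int_weight (h : Tuning a G e m T ℓ lam mu r ρ R c cρ ε) (x y : ℝ) :
    IntervalIntegrable (weight a lam mu) volume x y :=
  (h.int_pos x y).sub (h.int_neg x y)

theorem integral_weight_neg (h : Tuning a G e m T ℓ lam mu r ρ R c cρ ε) {i : ℕ} (hi : i < m)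
    {x y : ℝ} (hx : e (6 * i) ≤ x) (hxy : x ≤ y) (hy : y ≤ e (6 * i + 3)) (f : ℝ → ℝ) :
    ∫ s in x..y, weight a lam mu s * f s = -∫ s in x..y, mu * max (-a s) 0 * f s := by
  rw [← intervalIntegral.integral_neg]
  refine intervalIntegral.integral_congr_ae ?_
  filter_upwards [h.nonpos i hi] with s hs hmem
  rw [uIoc_of_le hxy] at hmem
  rw [weight, max_eq_right (hs ⟨hx.trans hmem.1.le, hmem.2.trans hy⟩)]
  ring

theorem integral_weight_pos (h : Tuning a G e m T ℓ lam mu r ρ R c cρ ε) {i : ℕ} (hi : i < m)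
    {x y : ℝ} (hx : e (6 * i + 3) ≤ x) (hxy : x ≤ y) (hy : y ≤ e (6 * i + 6)) (f : ℝ → ℝ) :
    ∫ s in x..y, weight a lam mu s * f s = ∫ s in x..y, lam * max (a s) 0 * f s := by
  refine intervalIntegral.integral_congr_ae ?_
  filter_upwards [h.nonneg i hi] with s hs hmem
  rw [uIoc_of_le hxy] at hmem
  have := hs ⟨hx.trans hmem.1.le, hmem.2.trans hy⟩
  rw [weight, max_eq_right (neg_nonpos.2 this)]
  ring

theorem blockLaw_of_arcs {ι : Type*} [LinearOrder ι] {t : ι → ℝ}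
    (h : Tuning a G e m T ℓ lam mu r ρ R c cρ ε) (ht : Monotone t) {P : ℕ → ι} (hP : Monotone P)
    (htP : ∀ k, t (P k) = e k) {i : ℕ} (hi : i < m) {u v : ι → ℝ}
    (h₁ : ConcaveArc t (fun s => mu * max (-a s) 0) (P (6 * i)) (P (6 * i + 3))
      (fun k => G (u k)) (-u) (-v))
    (h₂ : ConcaveArc t (fun s => lam * max (a s) 0) (P (6 * i + 3)) (P (6 * i + 6))
      (fun k => G (u k)) u v) :
    BlockLaw u v r ρ R (r / (8 * T)) (P (6 * i)) (P (6 * i + 3)) (P (6 * i + 6)) := by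
  have hmono := h.strictMono.monotone
  have hle : ∀ j k, 0 ≤ j → k ≤ 6 * m → e k - e j ≤ T := by
    intro j k hj hk
    have h1 := hmono hj
    have h2 := hmono hk
    rw [h.period] at h2
    linarith
  refine _root_.blockLaw_of_arcs h₁ h₂ ht (hP (Nat.le_add_right _ 1)) (hP (Nat.le_succ _))
    (hP (Nat.le_succ _)) (hP (Nat.le_succ _)) (hP (Nat.le_succ _)) (hP (Nat.le_succ _))
    h.l_pos h.T_pos ?_ ?_ ?_ ?_ ?_ ?_ h.r_pos h.r_lt h.lt_R h.le_mid ?_ h.le_top ?_ h.low_r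
    h.low_R ?_
  · rw [htP, htP]; exact h.gap (6 * i) (by omega)
  · rw [htP, htP]; exact h.gap (6 * i + 2) (by omega)
  · rw [htP, htP]; exact h.gap (6 * i + 3) (by omega)
  · rw [htP, htP]; exact h.gap (6 * i + 5) (by omega)
  · rw [htP, htP]; exact hle _ _ (Nat.zero_le _) (by omega)
  · rw [htP, htP]; exact hle _ _ (Nat.zero_le _) (by omega)
  · rw [htP, htP]; exact h.mid i hi
  · rw [htP, htP]; exact h.top i hi
  · rw [htP, htP]; exact h.low i hi

theorem blockLaw_orbit (h : Tuning a G e m T ℓ lam mu r ρ R c cρ ε) {t : ℕ → ℝ}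
    (ht : Monotone t) {P : ℕ → ℕ} (hP : Monotone P) (htP : ∀ k, t (P k) = e k) {i : ℕ}
    (hi : i < m) (z : ℝ × ℝ) :
    BlockLaw (fun k => (orbit t (weight a lam mu) G z k).1)
      (fun k => (orbit t (weight a lam mu) G z k).2) r ρ R (r / (8 * T))
      (P (6 * i)) (P (6 * i + 3)) (P (6 * i + 6)) := by
  refine h.blockLaw_of_arcs ht hP htP hi ?_ ?_
  · refine concaveArc_of_recurrence ht (fun k => h.int_neg _ _)
      (fun s => mul_nonneg h.mu_nonneg (le_max_right _ _)) (fun k => h.G_nonneg _) ?_ ?_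
    · intro k _ _
      simp only [Pi.neg_apply, orbit_fst_succ]
      ring
    · intro k h1 h2
      have := h.integral_weight_neg hi (x := t k) (y := t (k + 1)) (htP (6 * i) ▸ ht h1)
        (ht k.le_succ) (htP (6 * i + 3) ▸ ht h2) fun _ => 1
      simp only [mul_one] at this
      simp only [Pi.neg_apply]
      rw [orbit_snd_succ, this]
      ring
  · refine concaveArc_of_recurrence ht (fun k => h.int_pos _ _)
      (fun s => mul_nonneg h.lam_nonneg (le_max_right _ _)) (fun k => h.G_nonneg _)
      (fun k _ _ => orbit_fst_succ k) ?_
    intro k h1 h2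
    have := h.integral_weight_pos hi (x := t k) (y := t (k + 1)) (htP (6 * i + 3) ▸ ht h1)
      (ht k.le_succ) (htP (6 * i + 6) ▸ ht h2) fun _ => 1
    simp only [mul_one] at this
    rw [orbit_snd_succ, this]

theorem blockLaw_sol (h : Tuning a G e m T ℓ lam mu r ρ R c cρ ε) (hG : Continuous G)
    {u v : ℝ → ℝ} (hu : IsSolR (weight a lam mu) G u v) {i : ℕ} (hi : i < m) :
    BlockLaw u v r ρ R (r / (8 * T)) (e (6 * i)) (e (6 * i + 3)) (e (6 * i + 6)) := by
  have huc : Continuous u := continuous_iff_continuousAt.2 fun s => (hu.1 s).continuousAt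
  refine h.blockLaw_of_arcs monotone_id h.strictMono.monotone (fun k => rfl) hi ?_ ?_
  · refine concaveArc_of_hasDerivAt h.int_neg
      (fun s => mul_nonneg h.mu_nonneg (le_max_right _ _)) (fun k => h.G_nonneg _)
      (hG.comp huc) (fun s => (hu.1 s).neg) ?_
    intro x y hx hxy hy
    have := hu.2 x y
    rw [h.integral_weight_neg hi hx hxy hy] at this
    simp only [Pi.neg_apply]
    linarith
  · refine concaveArc_of_hasDerivAt h.int_pos
      (fun s => mul_nonneg h.lam_nonneg (le_max_right _ _)) (fun k => h.G_nonneg _)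
      (hG.comp huc) hu.1 ?_
    intro x y hx hxy hy
    rw [hu.2 x y, h.integral_weight_pos hi hx hxy hy]

end Tuning

/-- The grid dividing each interval `[e j, e (j + 1)]` into `n + 1` equal parts. -/
noncomputable def grid (e : ℕ → ℝ) (n k : ℕ) : ℝ :=
  e (k / (n + 1)) + (k % (n + 1) : ℕ) / (n + 1 : ℝ) * (e (k / (n + 1) + 1) - e (k / (n + 1)))

theorem grid_mul (e : ℕ → ℝ) (n j : ℕ) : grid e n ((n + 1) * j) = e j := by
  simp [grid]

theorem grid_succ (e : ℕ → ℝ) (n k : ℕ) : grid e n (k + 1) =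
    grid e n k + (e (k / (n + 1) + 1) - e (k / (n + 1))) / (n + 1 : ℝ) := by
  have hk : (n + 1) * (k / (n + 1)) + k % (n + 1) = k := Nat.div_add_mod k (n + 1)
  have hlt : k % (n + 1) + 1 ≤ n + 1 := Nat.mod_lt k n.succ_pos
  rcases hlt.eq_or_lt with h | h
  · have e1 : k + 1 = (n + 1) * (k / (n + 1) + 1) := by
      rw [mul_add, mul_one]
      omega
    have e2 : ((k % (n + 1) : ℕ) : ℝ) = n := by exact_mod_cast Nat.succ.inj h
    rw [e1, grid_mul, grid, e2]
    field_simp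
    ring
  · have hk' : k + 1 = (n + 1) * (k / (n + 1)) + (k % (n + 1) + 1) := by omega
    have e1 : (k + 1) / (n + 1) = k / (n + 1) := by
      rw [hk', Nat.mul_add_div n.succ_pos, Nat.div_eq_of_lt h, add_zero]
    have e2 : (k + 1) % (n + 1) = k % (n + 1) + 1 := by
      rw [hk', Nat.mul_add_mod, Nat.mod_eq_of_lt h]
    rw [grid, grid, e1, e2]
    push_cast
    ring

theorem strictMono_grid {e : ℕ → ℝ} (he : StrictMono e) (n : ℕ) : StrictMono (grid e n) := by
  refine strictMono_nat_of_lt_succ fun k => ?_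
  rw [grid_succ]
  have : 0 < e (k / (n + 1) + 1) - e (k / (n + 1)) := sub_pos.2 (he (Nat.lt_succ_self _))
  have : 0 < (e (k / (n + 1) + 1) - e (k / (n + 1))) / (n + 1 : ℝ) := by positivity
  linarith

theorem eventually_grid_mesh_lt {e : ℕ → ℝ} (he : StrictMono e) (M : ℕ) {δ : ℝ} (hδ : 0 < δ) :
    ∀ᶠ n in atTop, ∀ k < (n + 1) * M, grid e n (k + 1) - grid e n k < δ := by
  have hlim : Tendsto (fun n : ℕ => (e M - e 0) / (n + 1 : ℝ)) atTop (𝓝 0) := by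
    simpa [div_eq_mul_inv] using (tendsto_one_div_add_atTop_nhds_zero_nat (𝕜 := ℝ)).const_mul
      (e M - e 0)
  filter_upwards [hlim.eventually (gt_mem_nhds hδ)] with n hn k hk
  rw [grid_succ, add_sub_cancel_left]
  refine lt_of_le_of_lt (div_le_div_of_nonneg_right ?_ (by positivity)) hn
  have h1 : k / (n + 1) < M := Nat.div_lt_of_lt_mul hk
  linarith [he.monotone (Nat.succ_le_of_lt h1), he.monotone (Nat.zero_le (k / (n + 1)))]

theorem exists_grid_near {t : ℕ → ℝ} {A B : ℕ} (hAB : A ≤ B) {δ : ℝ} (hδ : 0 < δ)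
    (hmesh : ∀ k < B, t (k + 1) - t k < δ) {s : ℝ} (hs : s ∈ Icc (t A) (t B)) :
    ∃ k, A ≤ k ∧ k ≤ B ∧ |s - t k| < δ := by
  induction B, hAB using Nat.le_induction with
  | base =>
    refine ⟨A, le_rfl, le_rfl, ?_⟩
    rwa [le_antisymm hs.2 hs.1, sub_self, abs_zero]
  | succ B h ih =>
    rcases le_total s (t B) with h1 | h1
    · obtain ⟨k, hk1, hk2, hk⟩ := ih (fun k hk => hmesh k (by omega)) ⟨hs.1, h1⟩
      exact ⟨k, hk1, by omega, hk⟩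
    · refine ⟨B, h, by omega, ?_⟩
      rw [abs_of_nonneg (sub_nonneg.2 h1)]
      linarith [hmesh B B.lt_succ_self, hs.2]

theorem abs_peak_sub_sSup_le {t x : ℕ → ℝ} {u : ℝ → ℝ} {A B : ℕ} (ht : Monotone t) (hAB : A ≤ B)
    (hu : Continuous u) {ε : ℝ} (hx : ∀ k, k ≤ B → |x k - u (t k)| ≤ ε)
    (hnear : ∀ s ∈ Icc (t A) (t B), ∃ k, A ≤ k ∧ k ≤ B ∧ |u s - u (t k)| ≤ ε) :
    |peak x A B - sSup (u '' Icc (t A) (t B))| ≤ 2 * ε := by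
  have hε : 0 ≤ ε := (abs_nonneg _).trans (hx A hAB)
  have hbdd : BddAbove (u '' Icc (t A) (t B)) :=
    (isCompact_Icc.image hu).bddAbove
  obtain ⟨k, hk1, hk2, hk⟩ := exists_eq_peak x hAB
  obtain ⟨s, hs, hsup⟩ := (isCompact_Icc (a := t A) (b := t B)).exists_sSup_image_eq
    (nonempty_Icc.2 (ht hAB)) hu.continuousOn
  obtain ⟨l, hl1, hl2, hl⟩ := hnear s hs
  have h1 : u (t k) ≤ sSup (u '' Icc (t A) (t B)) :=
    le_csSup hbdd (mem_image_of_mem u ⟨ht hk1, ht hk2⟩)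
  have h2 : x l ≤ peak x A B := le_peak hl1 hl2
  have h3 := abs_le.1 (hx k hk2)
  have h4 := abs_le.1 (hx l hl2)
  have h5 := abs_le.1 hl
  rw [abs_le]
  exact ⟨by rw [hsup]; linarith [h4.1, h5.2], by linarith [h3.2]⟩

/-- A periodic solution with a given itinerary, up to the boundary of the strips. -/
theorem Tuning.exists_sol {a G : ℝ → ℝ} {e : ℕ → ℝ} {m : ℕ}
    {T ℓ lam mu r ρ R c cρ ε : ℝ} (h : Tuning a G e m T ℓ lam mu r ρ R c cρ ε) (hm : 0 < m)
    (ha : ∀ x, a (x + T) = a x) (hG : UniformContinuous G) (hG0 : ∀ s ≤ 0, G s = 0) {C : ℝ}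
    (hC : ∀ s, |G s| ≤ C) {S : ℕ → Fin 3} (hS : ∃ i < m, S i ≠ 0) :
    ∃ u v : ℝ → ℝ, IsSolR (weight a lam mu) G u v ∧ (∀ x, u (x + T) = u x) ∧
      (∀ x, u x ∈ Icc 0 R) ∧
      ∀ i < m, sSup (u '' Icc (e (6 * i + 3)) (e (6 * i + 6))) ∈ strip r ρ R (S i) := by
  have hT := h.T_pos
  have hmono : ∀ n, StrictMono (grid e n) := strictMono_grid h.strictMono
  have hP : ∀ n : ℕ, Monotone fun j => (n + 1) * j := fun n j k hjk => Nat.mul_le_mul_left _ hjk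
  have hper : ∀ n, ∃ z, orbit (grid e n) (weight a lam mu) G z ((n + 1) * (6 * m)) = z ∧
      (∀ k ≤ (n + 1) * (6 * m), (orbit (grid e n) (weight a lam mu) G z k).1 ∈ Icc 0 R) ∧
      ∀ i < m, peak (fun k => (orbit (grid e n) (weight a lam mu) G z k).1)
        ((n + 1) * (6 * i + 3)) ((n + 1) * (6 * i + 6)) ∈ strip r ρ R (S i) := by
    intro n
    refine exists_periodic_orbit (hmono n) hG.continuous hG0 (O := fun i => (n + 1) * (6 * i))
      (A := fun i => (n + 1) * (6 * i + 3)) (by simp) (by simp) (fun i => hP n (by omega))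
      (fun i => hP n (by omega)) hm h.r_pos h.r_lt h.lt_R (κ := r / (8 * T)) ?_ ?_ hS
    · have := h.r_pos
      positivity
    · intro z i hi
      exact h.blockLaw_orbit (hmono n).monotone (hP n) (grid_mul e n) hi z
  choose z hz hzR hzS using hper
  have he0 : ∀ n, grid e n 0 = e 0 := fun n => by simpa using grid_mul e n 0
  have heT : ∀ n, grid e n ((n + 1) * (6 * m)) = e 0 + T := fun n => by
    rw [grid_mul, h.period]
  have hmesh : ∀ δ > 0, ∀ᶠ n in atTop, ∀ k < (n + 1) * (6 * m),
      grid e n (k + 1) - grid e n k < δ := fun δ hδ =>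
    eventually_grid_mesh_lt h.strictMono (6 * m) hδ
  obtain ⟨φ, hφ, U, y, hU, heq, hint, hUT, hlim⟩ := exists_limit_of_periodic_orbits
    (N := fun n => (n + 1) * (6 * m)) (lt_add_of_pos_right (e 0) hT)
    (fun n => (hmono n).monotone) he0 heT hmesh h.int_weight hG hC hz
    (fun n => hzR n 0 (Nat.zero_le _))
  obtain ⟨u, v, hsol, huT, huU⟩ := exists_isSolR_of_integral_eq hT
    (fun x => by simp only [weight, ha]) h.int_weight hG.continuous hU heq hint hUT
  have huc : Continuous u := continuous_iff_continuousAt.2 fun s => (hsol.1 s).continuousAt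
  -- approximation of `u` by the orbits
  have happrox : ∀ δ > 0, ∃ n, (∀ k ≤ (n + 1) * (6 * m),
        |(orbit (grid e n) (weight a lam mu) G (z n) k).1 - u (grid e n k)| ≤ δ) ∧
      ∀ A B, A ≤ B → B ≤ (n + 1) * (6 * m) → ∀ s ∈ Icc (grid e n A) (grid e n B),
        ∃ k, A ≤ k ∧ k ≤ B ∧ |u s - u (grid e n k)| ≤ δ := by
    intro δ hδ
    have huc' := (isCompact_Icc (a := e 0) (b := e 0 + T)).uniformContinuousOn_of_continuous
      huc.continuousOn
    obtain ⟨δ', hδ', hδu⟩ := Metric.uniformContinuousOn_iff.1 huc' δ hδ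
    obtain ⟨n, hn1, hn2⟩ := ((hlim δ hδ).and
      (hφ.tendsto_atTop.eventually (hmesh δ' hδ'))).exists
    have hmem : ∀ k ≤ (φ n + 1) * (6 * m), grid e (φ n) k ∈ Icc (e 0) (e 0 + T) := fun k hk =>
      ⟨he0 (φ n) ▸ (hmono _).monotone (Nat.zero_le _), heT (φ n) ▸ (hmono _).monotone hk⟩
    refine ⟨φ n, fun k hk => ?_, fun A B hAB hB s hs => ?_⟩
    · rw [huU _ (hmem k hk)]
      exact hn1 k hk
    · obtain ⟨k, hk1, hk2, hk⟩ := exists_grid_near hAB hδ' (fun k hk => hn2 k (by omega)) hs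
      refine ⟨k, hk1, hk2, (hδu s ?_ _ (hmem k (by omega)) hk).le⟩
      exact ⟨(hmem A (by omega)).1.trans hs.1, hs.2.trans (hmem B hB).2⟩
  have hrange : ∀ x ∈ Icc (e 0) (e 0 + T), u x ∈ Icc 0 R := by
    intro x hx
    have key : ∀ δ > 0, -(2 * δ) ≤ u x ∧ u x ≤ R + 2 * δ := by
      intro δ hδ
      obtain ⟨n, hn1, hn2⟩ := happrox δ hδ
      obtain ⟨k, _, hk2, hk⟩ := hn2 0 _ (Nat.zero_le _) le_rfl x (by rwa [he0, heT])
      have h1 := abs_le.1 (hn1 k hk2)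
      have h2 := hzR n k hk2
      rw [abs_le] at hk
      exact ⟨by linarith [h1.2, h2.1, hk.1], by linarith [h1.1, h2.2, hk.2]⟩
    constructor
    · by_contra! hlt
      linarith [(key (-u x / 4) (by linarith)).1]
    · by_contra! hlt
      linarith [(key ((u x - R) / 4) (by linarith)).2]
  refine ⟨u, v, hsol, huT, fun x => ?_, fun i hi => ?_⟩
  · obtain ⟨x', hx', e'⟩ := (show Function.Periodic u T from huT).exists_mem_Ico hT x (e 0)
    rw [e']
    exact hrange x' ⟨hx'.1, hx'.2.le⟩
  · rw [Metric.mem_of_closed' (isClosed_strip r ρ R (S i))]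
    intro δ hδ
    obtain ⟨n, hn1, hn2⟩ := happrox (δ / 4) (by positivity)
    have hB : (n + 1) * (6 * i + 6) ≤ (n + 1) * (6 * m) := hP n (by omega)
    have hAB : (n + 1) * (6 * i + 3) ≤ (n + 1) * (6 * i + 6) := hP n (by omega)
    refine ⟨_, hzS n i hi, ?_⟩
    have := abs_peak_sub_sSup_le (hmono n).monotone hAB huc (fun k hk => hn1 k (hk.trans hB))
      (hn2 _ _ hAB hB)
    rw [grid_mul, grid_mul] at this
    rw [dist_comm, Real.dist_eq]
    linarith

theorem IsSolR.continuous {q G u v : ℝ → ℝ} (h : IsSolR q G u v) : Continuous u :=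
  continuous_iff_continuousAt.2 fun s => (h.1 s).continuousAt

/-- A nonnegative solution which is not identically zero is positive when the nonlinearity is at
most linear. -/
theorem IsSolR.pos {q G u v : ℝ → ℝ} (h : IsSolR q G u v)
    (hq : ∀ x y, IntervalIntegrable q volume x y) (hu : ∀ x, 0 ≤ u x) {D : ℝ}
    (hG : ∀ x, |G (u x)| ≤ D * u x) (hne : ∃ x, u x ≠ 0) (x : ℝ) : 0 < u x := by
  have huc := h.continuous
  have hopen : IsOpen {x | u x = 0} := by
    rw [isOpen_iff_mem_nhds]
    intro t₀ (ht₀ : u t₀ = 0)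
    have hmin : IsLocalMin u t₀ := Eventually.of_forall fun x => by rw [ht₀]; exact hu x
    have hv₀ : v t₀ = 0 := hmin.hasDerivAt_eq_zero (h.1 t₀)
    have hcont : Continuous fun x => |(∫ s in t₀..x, |q s|)| * |D| :=
      ((intervalIntegral.continuous_primitive (fun y z => (hq y z).abs) t₀).abs).mul_const _
    have hlim := hcont.tendsto t₀
    simp only [intervalIntegral.integral_same, abs_zero, zero_mul] at hlim
    obtain ⟨δ₀, hδ₀, hball⟩ := Metric.eventually_nhds_iff.1
      (hlim.eventually (gt_mem_nhds (show (0 : ℝ) < 1 / 2 by norm_num)))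
    set δ := min (δ₀ / 2) 1 with hδ
    have hδ0 : 0 < δ := by positivity
    have hδ1 : δ ≤ 1 := min_le_right _ _
    have hδ2 : δ < δ₀ := (min_le_left _ _).trans_lt (by linarith)
    set J := Metric.closedBall t₀ δ with hJ
    have ht₀J : t₀ ∈ J := Metric.mem_closedBall_self hδ0.le
    obtain ⟨p, hp, hmax⟩ := (isCompact_closedBall t₀ δ).exists_isMaxOn ⟨t₀, ht₀J⟩
      huc.continuousOn
    have hmax' : ∀ y ∈ J, u y ≤ u p := fun y hy => hmax hy
    have hvb : ∀ y ∈ J, ‖v y‖ ≤ 1 / 2 * u p := by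
      intro y hy
      rw [h.2 t₀ y, hv₀, zero_sub, norm_neg]
      have h1 := intervalIntegral.norm_integral_le_abs_of_norm_le (μ := volume) (a := t₀) (b := y)
        (f := fun s => q s * G (u s)) (g := fun s => |q s| * (|D| * u p)) ?_
        ((hq t₀ y).abs.mul_const _)
      · refine h1.trans ?_
        have h2 := hball ((Metric.mem_closedBall.1 hy).trans_lt hδ2)
        rw [intervalIntegral.integral_mul_const, abs_mul, abs_mul, abs_abs, abs_of_nonneg (hu p),
          ← mul_assoc]
        exact mul_le_mul_of_nonneg_right h2.le (hu p)
      · refine (ae_restrict_mem measurableSet_uIoc).mono fun s hs => ?_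
        have hsJ : s ∈ J := by
          rw [hJ, Metric.mem_closedBall, Real.dist_eq]
          refine (abs_sub_left_of_mem_uIcc (uIoc_subset_uIcc hs)).trans ?_
          rw [← Real.dist_eq]
          exact hy
        rw [Real.norm_eq_abs, abs_mul]
        refine mul_le_mul_of_nonneg_left ((hG s).trans ?_) (abs_nonneg _)
        exact mul_le_mul (le_abs_self D) (hmax' s hsJ) (hu s) (abs_nonneg _)
    have hp0 : u p ≤ 0 := by
      have h1 := (convex_closedBall t₀ δ).norm_image_sub_le_of_norm_hasDerivWithin_le
        (fun y _ => (h.1 y).hasDerivWithinAt) hvb ht₀J hp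
      rw [ht₀, sub_zero, Real.norm_eq_abs, abs_of_nonneg (hu p)] at h1
      have h2 : ‖p - t₀‖ ≤ 1 := (mem_closedBall_iff_norm.1 hp).trans hδ1
      nlinarith [mul_le_mul_of_nonneg_left h2 (mul_nonneg (by norm_num : (0 : ℝ) ≤ 1 / 2) (hu p))]
    filter_upwards [Metric.closedBall_mem_nhds t₀ hδ0] with y hy
    exact le_antisymm ((hmax' y hy).trans hp0) (hu y)
  have hclosed : IsClosed {x | u x = 0} := isClosed_eq huc continuous_const
  refine lt_of_le_of_ne (hu x) fun hx => ?_
  have huniv := IsClopen.eq_univ ⟨hclosed, hopen⟩ ⟨x, hx.symm⟩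
  obtain ⟨y, hy⟩ := hne
  exact hy (huniv ▸ mem_univ y : y ∈ {x | u x = 0})

/-- A periodic solution between `0` and `R` never realizes a threshold as its maximum over an
interval of positivity. -/
theorem Tuning.sSup_ne {a G : ℝ → ℝ} {e : ℕ → ℝ} {m : ℕ}
    {T ℓ lam mu r ρ R c cρ ε : ℝ} (h : Tuning a G e m T ℓ lam mu r ρ R c cρ ε) (hm : 0 < m)
    (hG : Continuous G) {u v : ℝ → ℝ} (hu : IsSolR (weight a lam mu) G u v)
    (huT : ∀ x, u (x + T) = u x) (huR : ∀ x, u x ∈ Icc 0 R) {i : ℕ} (hi : i < m) :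
    sSup (u '' Icc (e (6 * i + 3)) (e (6 * i + 6))) ≠ r ∧
      sSup (u '' Icc (e (6 * i + 3)) (e (6 * i + 6))) ≠ ρ ∧
      sSup (u '' Icc (e (6 * i + 3)) (e (6 * i + 6))) ≠ R := by
  have huc := hu.continuous
  have hvT : v (e 0 + T) = v (e 0) := by
    refine ((hu.1 (e 0 + T)).comp_add_const (e 0) T).unique ?_
    rw [show (fun x => u (x + T)) = u from funext huT]
    exact hu.1 (e 0)
  set M := sSup (u '' Icc (e (6 * i + 3)) (e (6 * i + 6))) with hM
  obtain ⟨k, hk, hMk⟩ := (isCompact_Icc (a := e (6 * i + 3)) (b := e (6 * i + 6))).exists_sSup_image_eq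
    (nonempty_Icc.2 (h.strictMono.monotone (by omega))) huc.continuousOn
  have hle : ∀ z, e (6 * i + 3) ≤ z → z ≤ e (6 * i + 6) → u z ≤ M := fun z h1 h2 =>
    le_csSup (isCompact_Icc.image huc).bddAbove (mem_image_of_mem u ⟨h1, h2⟩)
  have hlaw := h.blockLaw_sol hG hu hi
  have hslope : ¬ (M = r ∨ M = R) := by
    intro hx
    have h1 := hlaw.slope_ge M hx (huR _).2 (huR _).1 hle k hk.1 hk.2 hMk.symm
    rcases Nat.lt_or_ge (i + 1) m with hlt | hge
    · have h2 := (h.blockLaw_sol hG hu hlt).gt_top (huR _).1 (huR _).2 h1.1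
      exact absurd h2 (not_lt.2 (huR _).2)
    · have h3 : 6 * i + 6 = 6 * m := by omega
      rw [h3, h.period, hvT] at h1
      have h2 := (h.blockLaw_sol hG hu hm).gt_top (huR _).1 (huR _).2 h1.1
      exact absurd h2 (not_lt.2 (huR _).2)
  refine ⟨fun hx => hslope (Or.inl hx), fun hx => ?_, fun hx => hslope (Or.inr hx)⟩
  exact hlaw.ne_mid (huR _).1 (huR _).1 (fun z h1 h2 => (hle z h1 h2).trans_eq hx) k hk.1 hk.2
    (hMk.symm.trans hx)

theorem exists_pos_forall_lt_le {f : ℕ → ℝ} {n : ℕ} (hf : ∀ k < n, 0 < f k) :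
    ∃ δ, 0 < δ ∧ ∀ k < n, δ ≤ f k := by
  induction n with
  | zero => exact ⟨1, one_pos, fun k hk => absurd hk k.not_lt_zero⟩
  | succ n ih =>
    obtain ⟨δ, hδ, h⟩ := ih fun k hk => hf k (hk.trans n.lt_succ_self)
    refine ⟨min δ (f n), lt_min hδ (hf n n.lt_succ_self), fun k hk => ?_⟩
    rcases Nat.lt_succ_iff_lt_or_eq.1 hk with hk | rfl
    · exact (min_le_left _ _).trans (h k hk)
    · exact min_le_right _ _

theorem exists_forall_lt_le (f : ℕ → ℝ) (n : ℕ) : ∃ A, 0 < A ∧ ∀ k < n, f k ≤ A := by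
  refine ⟨1 + ∑ k ∈ Finset.range n, |f k|, by positivity, fun k hk => ?_⟩
  have h := Finset.single_le_sum (f := fun k => |f k|) (fun i _ => abs_nonneg (f i))
    (Finset.mem_range.2 hk)
  linarith [le_abs_self (f k)]

theorem exists_inner_integral_pos {f : ℝ → ℝ} (hf : ∀ x y, IntervalIntegrable f volume x y)
    {x y : ℝ} (hxy : x < y) (h : 0 < ∫ s in x..y, f s) :
    ∃ α β, x < α ∧ α < β ∧ β < y ∧ 0 < ∫ s in α..β, f s := by
  have hF := intervalIntegral.continuous_primitive hf x
  have hcont : Continuous fun δ => (∫ s in x..(y - δ), f s) - ∫ s in x..(x + δ), f s :=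
    (hF.comp (by fun_prop : Continuous fun δ : ℝ => y - δ)).sub
      (hF.comp (by fun_prop : Continuous fun δ : ℝ => x + δ))
  have hlim := hcont.tendsto 0
  simp only [sub_zero, add_zero, intervalIntegral.integral_same] at hlim
  have hev : ∀ᶠ δ in 𝓝[>] (0 : ℝ), 0 < δ ∧ δ < (y - x) / 2 ∧
      0 < (∫ s in x..(y - δ), f s) - ∫ s in x..(x + δ), f s := by
    filter_upwards [self_mem_nhdsWithin, nhdsWithin_le_nhds (gt_mem_nhds
      (show (0 : ℝ) < (y - x) / 2 by linarith)), nhdsWithin_le_nhds (hlim.eventually (lt_mem_nhds h))]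
      with δ h1 h2 h3 using ⟨h1, h2, h3⟩
  obtain ⟨δ, h1, h2, h3⟩ := hev.exists
  refine ⟨x + δ, y - δ, by linarith, by linarith, by linarith, ?_⟩
  rwa [intervalIntegral.integral_interval_sub_left (hf _ _) (hf _ _)] at h3

/-- The intervals of positivity and negativity of a periodic weight can be subdivided so that the
weight is nontrivial in the middle of each of them. -/
theorem exists_subdivision {a : ℝ → ℝ} {T : ℝ} {m : ℕ} {σ τ : ℕ → ℝ} (hm : 1 ≤ m)
    (hστ : ∀ i, 1 ≤ i → i ≤ m → σ i < τ i) (hτσ : ∀ i, 1 ≤ i → i ≤ m → τ i < σ (i + 1))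
    (hσ1 : σ 1 = 0) (hσm : σ (m + 1) = T) (haT : ∀ t, a (t + T) = a t)
    (ha : ∀ x y, IntervalIntegrable a volume x y)
    (hpos : ∀ i, 1 ≤ i → i ≤ m → (∀ᵐ t : ℝ ∂volume, t ∈ Icc (σ i) (τ i) → 0 ≤ a t) ∧
      0 < ∫ t in (σ i)..(τ i), a t)
    (hneg : ∀ i, 1 ≤ i → i ≤ m → (∀ᵐ t : ℝ ∂volume, t ∈ Icc (τ i) (σ (i + 1)) → a t ≤ 0) ∧
      (∫ t in (τ i)..(σ (i + 1)), a t) < 0) :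
    ∃ (e : ℕ → ℝ) (ℓ η A : ℝ), StrictMono e ∧ 0 < ℓ ∧ 0 < η ∧ 0 < A ∧
      (∀ k < 6 * m, ℓ ≤ e (k + 1) - e k) ∧ e (6 * m) = e 0 + T ∧ ∀ i < m,
        e (6 * i + 3) = σ (i + 1) ∧ e (6 * i + 6) = τ (i + 1) ∧
        (∀ᵐ s, s ∈ Icc (e (6 * i)) (e (6 * i + 3)) → a s ≤ 0) ∧
        (∀ᵐ s, s ∈ Icc (e (6 * i + 3)) (e (6 * i + 6)) → 0 ≤ a s) ∧
        η ≤ (∫ s in e (6 * i + 1)..e (6 * i + 2), max (-a s) 0) ∧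
        η ≤ (∫ s in e (6 * i + 4)..e (6 * i + 5), max (a s) 0) ∧
        (∫ s in e (6 * i + 3)..e (6 * i + 6), max (a s) 0) ≤ A := by
  have hap : ∀ x y, IntervalIntegrable (fun s => max (a s) 0) volume x y := fun x y =>
    ⟨(ha x y).1.pos_part, (ha x y).2.pos_part⟩
  have han : ∀ x y, IntervalIntegrable (fun s => max (-a s) 0) volume x y := fun x y =>
    ⟨(ha x y).1.neg.pos_part, (ha x y).2.neg.pos_part⟩
  let b : ℕ → ℝ := fun i => if i = 0 then τ m - T else τ i
  have hb0 : b 0 = τ m - T := if_pos rfl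
  have hb : ∀ i, b (i + 1) = τ (i + 1) := fun i => if_neg i.succ_ne_zero
  have hbneg : ∀ i < m, b i < σ (i + 1) ∧ (∀ᵐ s, s ∈ Icc (b i) (σ (i + 1)) → a s ≤ 0) ∧
      (∫ s in b i..σ (i + 1), a s) < 0 := by
    intro i hi
    rcases i with _ | i
    · have h1 := hneg m hm le_rfl
      have h2 := hτσ m hm le_rfl
      rw [hσm] at h1 h2
      rw [hb0, zero_add, hσ1]
      refine ⟨by linarith, ?_, ?_⟩
      · have h3 := (measurePreserving_add_right volume T).quasiMeasurePreserving.ae h1.1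
        filter_upwards [h3] with s hs hmem
        rw [← haT]
        exact hs ⟨by linarith [hmem.1], by linarith [hmem.2]⟩
      · have h3 := intervalIntegral.integral_comp_add_right (a := τ m - T) (b := 0) a T
        simp only [haT, sub_add_cancel, zero_add] at h3
        rw [h3]
        exact h1.2
    · rw [hb]
      exact ⟨hτσ _ (by omega) (by omega), hneg _ (by omega) (by omega)⟩
  have hblock : ∀ i, ∃ f : ℕ → ℝ, i < m → f 0 = b i ∧ f 3 = σ (i + 1) ∧
      (∀ k < 5, f k < f (k + 1)) ∧ f 5 < τ (i + 1) ∧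
      (0 < ∫ s in f 1..f 2, max (-a s) 0) ∧ 0 < ∫ s in f 4..f 5, max (a s) 0 := by
    intro i
    by_cases hi : i < m
    swap
    · exact ⟨fun _ => 0, fun h => absurd h hi⟩
    obtain ⟨h1, h2, h3⟩ := hbneg i hi
    obtain ⟨-, h5⟩ := hpos (i + 1) (by omega) (by omega)
    have h6 : 0 < ∫ s in b i..σ (i + 1), max (-a s) 0 := by
      refine (neg_pos.2 h3).trans_le ?_
      rw [← intervalIntegral.integral_neg]
      exact intervalIntegral.integral_mono_on h1.le (ha _ _).neg (han _ _) fun s _ =>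
        le_max_left _ _
    have h7 : 0 < ∫ s in σ (i + 1)..τ (i + 1), max (a s) 0 :=
      h5.trans_le (intervalIntegral.integral_mono_on (hστ _ (by omega) (by omega)).le (ha _ _)
        (hap _ _) fun s _ => le_max_left _ _)
    obtain ⟨α, β, k1, k2, k3, k4⟩ := exists_inner_integral_pos han h1 h6
    obtain ⟨α', β', l1, l2, l3, l4⟩ := exists_inner_integral_pos hap
      (hστ (i + 1) (by omega) (by omega)) h7
    refine ⟨fun k => match k with
      | 0 => b i
      | 1 => α
      | 2 => β
      | 3 => σ (i + 1)
      | 4 => α'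
      | _ => β', fun _ => ⟨rfl, rfl, fun k hk => ?_, l3, k4, l4⟩⟩
    interval_cases k <;> assumption
  choose f hf using hblock
  let e : ℕ → ℝ := fun k => if k < 6 * m then f (k / 6) (k % 6) else τ m + (k - 6 * m : ℕ)
  have he : ∀ i < m, ∀ j < 6, e (6 * i + j) = f i j := by
    intro i hi j hj
    have h1 : (6 * i + j) / 6 = i := by omega
    have h2 : (6 * i + j) % 6 = j := by omega
    simp only [e, h1, h2]
    exact if_pos (by omega)
  have he0 : ∀ i < m, e (6 * i) = f i 0 := fun i hi => he i hi 0 (by norm_num)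
  have hem : e (6 * m) = τ m := by simp [e]
  have he6 : ∀ i < m, e (6 * i + 6) = τ (i + 1) := by
    intro i hi
    rcases Nat.lt_or_ge (i + 1) m with h | h
    · rw [show 6 * i + 6 = 6 * (i + 1) by ring, he0 _ h, (hf _ h).1, hb]
    · obtain rfl : m = i + 1 := by omega
      exact hem
  have hmono : StrictMono e := by
    refine strictMono_nat_of_lt_succ fun k => ?_
    rcases Nat.lt_or_ge k (6 * m) with hk | hk
    · obtain ⟨i, j, hj, rfl⟩ : ∃ i j, j < 6 ∧ k = 6 * i + j :=
        ⟨k / 6, k % 6, Nat.mod_lt _ (by norm_num), by omega⟩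
      have hi : i < m := by omega
      rw [he i hi j hj]
      rcases Nat.lt_or_ge j 5 with h5 | h5
      · rw [add_assoc, he i hi (j + 1) (by omega)]
        exact (hf i hi).2.2.1 j h5
      · obtain rfl : j = 5 := by omega
        rw [add_assoc, he6 i hi]
        exact (hf i hi).2.2.2.1
    · simp only [e, if_neg (not_lt.2 hk), if_neg (show ¬ k + 1 < 6 * m by omega)]
      have : k - 6 * m < k + 1 - 6 * m := by omega
      have : ((k - 6 * m : ℕ) : ℝ) < ((k + 1 - 6 * m : ℕ) : ℝ) := by exact_mod_cast this
      linarith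
  obtain ⟨ℓ, hℓ, hgap⟩ := exists_pos_forall_lt_le (f := fun k => e (k + 1) - e k) (n := 6 * m)
    fun k _ => sub_pos.2 (hmono k.lt_succ_self)
  obtain ⟨η₁, hη₁, hn⟩ := exists_pos_forall_lt_le (n := m)
    (f := fun i => ∫ s in f i 1..f i 2, max (-a s) 0) fun i hi => (hf i hi).2.2.2.2.1
  obtain ⟨η₂, hη₂, hp⟩ := exists_pos_forall_lt_le (n := m)
    (f := fun i => ∫ s in f i 4..f i 5, max (a s) 0) fun i hi => (hf i hi).2.2.2.2.2
  obtain ⟨A, hA, hAle⟩ := exists_forall_lt_le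
    (fun i => ∫ s in e (6 * i + 3)..e (6 * i + 6), max (a s) 0) m
  refine ⟨e, ℓ, min η₁ η₂, A, hmono, hℓ, lt_min hη₁ hη₂, hA, hgap, ?_, fun i hi => ?_⟩
  · have h0 := he0 0 (by omega)
    rw [mul_zero] at h0
    rw [hem, h0, (hf 0 (by omega)).1, hb0]
    ring
  have h3 : e (6 * i + 3) = σ (i + 1) := (he i hi 3 (by norm_num)).trans (hf i hi).2.1
  refine ⟨h3, he6 i hi, ?_, ?_, ?_, ?_, hAle i hi⟩
  · rw [h3, he0 i hi, (hf i hi).1]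
    exact (hbneg i hi).2.1
  · rw [h3, he6 i hi]
    exact (hpos (i + 1) (by omega) (by omega)).1
  · rw [he i hi 1 (by norm_num), he i hi 2 (by norm_num)]
    exact (min_le_left _ _).trans (hn i hi)
  · rw [he i hi 4 (by norm_num), he i hi 5 (by norm_num)]
    exact (min_le_right _ _).trans (hp i hi)

theorem exists_pos_le_of_continuousOn {g : ℝ → ℝ} (hg : ContinuousOn g (Ici 0))
    (hpos : ∀ s : ℝ, 0 < s → 0 < g s) {x : ℝ} (hx : 0 < x) (y : ℝ) :
    ∃ c, 0 < c ∧ ∀ s ∈ Icc x y, c ≤ g s := by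
  rcases lt_or_ge y x with h | h
  · exact ⟨1, one_pos, fun s hs => absurd (hs.1.trans hs.2) (not_le.2 h)⟩
  obtain ⟨p, hp, hmin⟩ := isCompact_Icc.exists_isMinOn (nonempty_Icc.2 h)
    (hg.mono fun s hs => hx.le.trans hs.1)
  exact ⟨g p, hpos p (hx.trans_le hp.1), fun s hs => hmin hs⟩

theorem exists_le_of_continuousOn {g : ℝ → ℝ} (hg : ContinuousOn g (Ici 0)) (y : ℝ) :
    ∃ C, 0 ≤ C ∧ ∀ s ∈ Icc 0 y, g s ≤ C := by
  obtain ⟨C, hC⟩ := (isCompact_Icc (a := (0 : ℝ)) (b := y)).bddAbove_image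
    (hg.mono fun s hs => hs.1)
  exact ⟨max C 0, le_max_right _ _, fun s hs =>
    (hC (mem_image_of_mem g hs)).trans (le_max_left _ _)⟩

theorem exists_forall_le_mul {g : ℝ → ℝ} (hzero : g 0 = 0)
    (hg0 : Tendsto (fun s => g s / s) (𝓝[>] 0) (𝓝 0)) {ε : ℝ} (hε : 0 < ε) :
    ∃ δ, 0 < δ ∧ ∀ s ∈ Ico 0 δ, g s ≤ ε * s := by
  obtain ⟨δ, hδ, h⟩ := mem_nhdsGT_iff_exists_Ioo_subset.1 (hg0.eventually (gt_mem_nhds hε))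
  refine ⟨δ, hδ, fun s hs => ?_⟩
  rcases hs.1.eq_or_lt with rfl | h0
  · rw [hzero, mul_zero]
  · exact ((div_lt_iff₀ h0).1 (h ⟨h0, hs.2⟩)).le

theorem exists_lt_forall_le {g : ℝ → ℝ} (hzero : g 0 = 0)
    (hg0 : Tendsto (fun s => g s / s) (𝓝[>] 0) (𝓝 0)) {ε ρ : ℝ} (hε : 0 < ε) (hρ : 0 < ρ) :
    ∃ r, 0 < r ∧ r < ρ ∧ ∀ s ∈ Icc 0 r, g s ≤ ε * r := by
  obtain ⟨δ, hδ, h⟩ := exists_forall_le_mul hzero hg0 hε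
  have h1 : 0 < min δ ρ := lt_min hδ hρ
  refine ⟨min δ ρ / 2, by linarith, by linarith [min_le_right δ ρ], fun s hs => ?_⟩
  refine (h s ⟨hs.1, by linarith [hs.2, min_le_left δ ρ]⟩).trans ?_
  exact mul_le_mul_of_nonneg_left hs.2 hε.le

theorem exists_gt_forall_le {g : ℝ → ℝ} (hg : ContinuousOn g (Ici 0))
    (hginf : Tendsto (fun s => g s / s) atTop (𝓝 0)) {ε : ℝ} (hε : 0 < ε) (ρ : ℝ) :
    ∃ R, ρ < R ∧ ∀ s ∈ Icc 0 R, g s ≤ ε * R := by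
  obtain ⟨K, hK⟩ := eventually_atTop.1 (hginf.eventually (gt_mem_nhds hε))
  obtain ⟨C, -, hC⟩ := exists_le_of_continuousOn hg (max K 1)
  refine ⟨max (ρ + 1) (C / ε), by linarith [le_max_left (ρ + 1) (C / ε)], fun s hs => ?_⟩
  rcases le_total s (max K 1) with h | h
  · refine (hC s ⟨hs.1, h⟩).trans ?_
    rw [mul_comm, ← div_le_iff₀ hε]
    exact le_max_right _ _
  · have h0 : 0 < s := one_pos.trans_le ((le_max_right _ _).trans h)
    have h1 := (div_lt_iff₀ h0).1 (hK s ((le_max_left _ _).trans h))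
    exact h1.le.trans (mul_le_mul_of_nonneg_left hs.2 hε.le)

theorem exists_linear_bound {g : ℝ → ℝ} (hg : ContinuousOn g (Ici 0)) (hzero : g 0 = 0)
    (hg0 : Tendsto (fun s => g s / s) (𝓝[>] 0) (𝓝 0)) (R : ℝ) :
    ∃ D, ∀ s ∈ Icc 0 R, g s ≤ D * s := by
  obtain ⟨δ, hδ, h⟩ := exists_forall_le_mul hzero hg0 one_pos
  obtain ⟨C, hC0, hC⟩ := exists_le_of_continuousOn hg R
  have hCδ : 0 ≤ C / δ := by positivity
  refine ⟨1 + C / δ, fun s hs => ?_⟩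
  rcases lt_or_ge s δ with hlt | hge
  · have := mul_nonneg hCδ hs.1
    linarith [h s ⟨hs.1, hlt⟩]
  · have h1 : C ≤ C / δ * s := by
      calc C = C / δ * δ := by field_simp
        _ ≤ C / δ * s := mul_le_mul_of_nonneg_left hge hCδ
    linarith [hC s hs, hs.1]

/-- The nonlinearity `g` frozen outside `[0, R]`. -/
noncomputable def clamp (g : ℝ → ℝ) (R s : ℝ) : ℝ := g (max 0 (min s R))

theorem clamp_of_mem (g : ℝ → ℝ) {R s : ℝ} (hs : s ∈ Icc 0 R) : clamp g R s = g s := by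
  rw [clamp, min_eq_left hs.2, max_eq_right hs.1]

theorem clamp_of_nonpos {g : ℝ → ℝ} (hzero : g 0 = 0) {R s : ℝ} (hs : s ≤ 0) :
    clamp g R s = 0 := by
  rw [clamp, max_eq_left ((min_le_left _ _).trans hs), hzero]

theorem clamp_nonneg {g : ℝ → ℝ} (hzero : g 0 = 0) (hpos : ∀ s : ℝ, 0 < s → 0 < g s)
    (R s : ℝ) : 0 ≤ clamp g R s := by
  rw [clamp]
  rcases (le_max_left 0 (min s R)).eq_or_lt with h | h
  · rw [← h, hzero]
  · exact (hpos _ h).le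

theorem clamp_le {g : ℝ → ℝ} (hzero : g 0 = 0) {R x B s : ℝ} (hB : 0 ≤ B) (hxR : x ≤ R)
    (h : ∀ s ∈ Icc 0 x, g s ≤ B) (hs : s ≤ x) : clamp g R s ≤ B := by
  rcases le_total s 0 with h0 | h0
  · rwa [clamp_of_nonpos hzero h0]
  · rw [clamp_of_mem g ⟨h0, hs.trans hxR⟩]
    exact h s ⟨h0, hs⟩

theorem uniformContinuous_clamp {g : ℝ → ℝ} (hg : ContinuousOn g (Ici 0)) {R : ℝ} (hR : 0 ≤ R) :
    UniformContinuous (clamp g R) := by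
  have h1 : UniformContinuousOn g (Icc 0 R) :=
    isCompact_Icc.uniformContinuousOn_of_continuous (hg.mono fun s hs => hs.1)
  have h2 : UniformContinuous fun s : ℝ => max 0 (min s R) :=
    ((LipschitzWith.id.min_const R).const_max 0).uniformContinuous
  have h3 : ∀ s : ℝ, max 0 (min s R) ∈ Icc 0 R := fun s =>
    ⟨le_max_left _ _, max_le hR (min_le_right _ _)⟩
  rw [← uniformContinuousOn_univ] at h2 ⊢
  exact h1.comp h2 fun s _ => h3 s

theorem stmt_0 (g a : ℝ → ℝ) (T : ℝ) (m : ℕ) (σ τ : ℕ → ℝ)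
    (hg_cont : ContinuousOn g (Ici 0)) (hg_zero : g 0 = 0)
    (hg_pos : ∀ s : ℝ, 0 < s → 0 < g s)
    (hg0 : Tendsto (fun s => g s / s) (nhdsWithin 0 (Ioi 0)) (nhds 0))
    (hginf : Tendsto (fun s => g s / s) atTop (nhds 0))
    (hm : 1 ≤ m)
    (hστ : ∀ i, 1 ≤ i → i ≤ m → σ i < τ i)
    (hτσ : ∀ i, 1 ≤ i → i ≤ m → τ i < σ (i + 1))
    (hσ1 : σ 1 = 0) (hσm : σ (m + 1) = T)
    (ha_per : ∀ t, a (t + T) = a t)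
    (ha_loc : LocallyIntegrable a)
    (ha_pos : ∀ i, 1 ≤ i → i ≤ m →
      (∀ᵐ t : ℝ ∂volume, t ∈ Icc (σ i) (τ i) → 0 ≤ a t) ∧
        0 < ∫ t in (σ i)..(τ i), a t)
    (ha_neg : ∀ i, 1 ≤ i → i ≤ m →
      (∀ᵐ t : ℝ ∂volume, t ∈ Icc (τ i) (σ (i + 1)) → a t ≤ 0) ∧
        (∫ t in (τ i)..(σ (i + 1)), a t) < 0) :
    ∀ ρ : ℝ, 0 < ρ → ∃ lamStar : ℝ, 0 < lamStar ∧
      ∀ lam : ℝ, lamStar < lam → ∃ r R : ℝ, 0 < r ∧ r < ρ ∧ ρ < R ∧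
        ∃ muStar : ℝ, 0 < muStar ∧ ∀ mu : ℝ, muStar < mu →
          ∀ S : ℕ → Fin 3, (∃ i, 1 ≤ i ∧ i ≤ m ∧ S i ≠ 0) →
            ∃ u v : ℝ → ℝ,
              IsSolR (fun t => lam * max (a t) 0 - mu * max (-a t) 0) g u v ∧
              (∀ t, u (t + T) = u t) ∧ (∀ t, 0 < u t) ∧
              ∀ i, 1 ≤ i → i ≤ m →
                (S i = 0 → sSup (u '' Icc (σ i) (τ i)) < r) ∧
                (S i = 1 → r < sSup (u '' Icc (σ i) (τ i)) ∧
                  sSup (u '' Icc (σ i) (τ i)) < ρ) ∧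
                (S i = 2 → ρ < sSup (u '' Icc (σ i) (τ i)) ∧
                  sSup (u '' Icc (σ i) (τ i)) < R) := by
  intro ρ hρ
  have ha : ∀ x y, IntervalIntegrable a volume x y := fun x y =>
    (ha_loc.integrableOn_isCompact isCompact_uIcc).intervalIntegrable
  obtain ⟨e, ℓ, η, A, hmono, hℓ, hη, hA, hgap, hper, he⟩ :=
    exists_subdivision hm hστ hτσ hσ1 hσm ha_per ha ha_pos ha_neg
  have hT : 0 < T := by linarith [hmono (show 0 < 6 * m by omega)]
  obtain ⟨cρ, hcρ, hmid⟩ := exists_pos_le_of_continuousOn hg_cont hg_pos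
    (show 0 < ρ * ℓ / T by positivity) ρ
  refine ⟨2 * ρ / ℓ / (cρ * η), by positivity, fun lam hlam => ?_⟩
  have hlam0 : 0 < lam := lt_trans (by positivity) hlam
  have hε : 0 < 1 / (8 * T) / (lam * A) := by positivity
  obtain ⟨r, hr, hrρ, hlow⟩ := exists_lt_forall_le hg_zero hg0 hε hρ
  obtain ⟨R, hρR, hhigh⟩ := exists_gt_forall_le hg_cont hginf hε ρ
  have hR : 0 < R := hρ.trans hρR
  have hmin : 0 < min (r / 2) (r / (8 * T) * ℓ) := by positivity
  obtain ⟨c, hc, htop⟩ := exists_pos_le_of_continuousOn hg_cont hg_pos hmin R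
  refine ⟨r, R, hr, hrρ, hρR, 2 * R / ℓ / (c * η), by positivity, fun mu hmu S hS => ?_⟩
  have hmu0 : 0 < mu := lt_trans (by positivity) hmu
  have htune : Tuning a (clamp g R) e m T ℓ lam mu r ρ R c cρ (1 / (8 * T) / (lam * A)) :=
    { int := ha
      strictMono := hmono
      lam_nonneg := hlam0.le
      mu_nonneg := hmu0.le
      l_pos := hℓ
      gap := hgap
      T_pos := hT
      period := hper
      nonpos := fun i hi => (he i hi).2.2.1
      nonneg := fun i hi => (he i hi).2.2.2.1
      r_pos := hr
      r_lt := hrρ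
      lt_R := hρR
      G_nonneg := clamp_nonneg hg_zero hg_pos R
      le_mid := fun s hs => by
        have h0 : 0 < ρ * ℓ / T := by positivity
        rw [clamp_of_mem g ⟨h0.le.trans hs.1, hs.2.trans hρR.le⟩]
        exact hmid s hs
      mid := fun i hi => by
        obtain ⟨-, -, -, -, -, h, -⟩ := he i hi
        rw [intervalIntegral.integral_const_mul]
        rw [div_lt_iff₀ (by positivity)] at hlam
        calc 2 * ρ / ℓ < lam * (cρ * η) := hlam
          _ = cρ * (lam * η) := by ring
          _ ≤ _ := by gcongr
      le_top := fun s hs => by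
        rw [clamp_of_mem g ⟨hmin.le.trans hs.1, hs.2⟩]
        exact htop s hs
      top := fun i hi => by
        obtain ⟨-, -, -, -, h, -, -⟩ := he i hi
        rw [intervalIntegral.integral_const_mul]
        rw [div_lt_iff₀ (by positivity)] at hmu
        calc 2 * R / ℓ < mu * (c * η) := hmu
          _ = c * (mu * η) := by ring
          _ ≤ _ := by gcongr
      low_r := fun s hs => clamp_le hg_zero (by positivity) (hrρ.trans hρR).le hlow hs
      low_R := fun s hs => clamp_le hg_zero (by positivity) le_rfl hhigh hs
      low := fun i hi => by
        obtain ⟨-, -, -, -, -, -, h⟩ := he i hi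
        rw [intervalIntegral.integral_const_mul]
        calc 1 / (8 * T) / (lam * A) * (lam * ∫ s in e (6 * i + 3)..e (6 * i + 6), max (a s) 0)
            ≤ 1 / (8 * T) / (lam * A) * (lam * A) := by gcongr
          _ = 1 / (8 * T) := by field_simp }
  have hG := uniformContinuous_clamp hg_cont hR.le
  obtain ⟨C, hC0, hC⟩ := exists_le_of_continuousOn hg_cont R
  have hCabs : ∀ s, |clamp g R s| ≤ C := fun s => by
    rw [abs_of_nonneg (clamp_nonneg hg_zero hg_pos R s)]
    exact hC _ ⟨le_max_left _ _, max_le hR.le (min_le_right _ _)⟩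
  obtain ⟨j, hj1, hjm, hjS⟩ := hS
  have hS' : ∃ i < m, (fun i => S (i + 1)) i ≠ 0 :=
    ⟨j - 1, by omega, by simpa only [Nat.sub_add_cancel hj1] using hjS⟩
  obtain ⟨u, v, hu, huT, huR, hstrip⟩ := htune.exists_sol hm ha_per hG
    (fun s hs => clamp_of_nonpos hg_zero hs) hCabs hS'
  have huG : ∀ x, clamp g R (u x) = g (u x) := fun x => clamp_of_mem g (huR x)
  obtain ⟨D, hD⟩ := exists_linear_bound hg_cont hg_zero hg0 R
  have hne : ∃ x, u x ≠ 0 := by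
    obtain ⟨i, hi, hSi⟩ := hS'
    obtain ⟨x, -, hx⟩ := (isCompact_Icc (a := e (6 * i + 3)) (b := e (6 * i + 6))).exists_sSup_image_eq
      (nonempty_Icc.2 (hmono.monotone (by omega))) hu.continuous.continuousOn
    have h1 := le_of_mem_strip_of_ne hrρ hSi (hstrip i hi)
    rw [hx] at h1
    exact ⟨x, (hr.trans_le h1).ne'⟩
  refine ⟨u, v, ⟨hu.1, fun t₀ t => ?_⟩, huT, ?_, fun i hi1 him => ?_⟩
  · have h := hu.2 t₀ t
    simp only [huG] at h
    exact h
  · refine hu.pos htune.int_weight (fun x => (huR x).1) (D := D) (fun x => ?_) hne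
    rw [abs_of_nonneg (clamp_nonneg hg_zero hg_pos R _), huG]
    exact hD _ (huR x)
  · obtain ⟨k, rfl⟩ : ∃ k, i = k + 1 := ⟨i - 1, by omega⟩
    have hk : k < m := by omega
    have h1 := hstrip k hk
    obtain ⟨h2, h3, h4⟩ := htune.sSup_ne hm hG.continuous hu huT huR hk
    obtain ⟨h5, h6, -⟩ := he k hk
    rw [h5, h6] at h1 h2 h3 h4
    refine ⟨fun hSk => ?_, fun hSk => ?_, fun hSk => ?_⟩
    · simp only [hSk] at h1
      exact lt_of_le_of_ne h1 h2
    · simp only [hSk] at h1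
      exact ⟨lt_of_le_of_ne h1.1 h2.symm, lt_of_le_of_ne h1.2 h3⟩
    · simp only [hSk] at h1
      exact ⟨lt_of_le_of_ne h1.1 h3.symm, lt_of_le_of_ne h1.2 h4⟩
end

section
/- For any ρ > 0 there exists λ* = λ*(ρ) > 0 such that, for any λ > λ*, any α ≥ 0 and any i ∈ {1,…,m}, there is no non-negative solution u of u'' + λ a⁺(t) g(u) + α = 0 defined on the whole interval I⁺_i with max_{t∈I⁺_i} u(t) = ρ. -/
open MeasureTheory Set Filter Topology

/-- A (Carathéodory) solution of `u'' + q(t) G(u) + α = 0` on a set `J ⊆ ℝ`: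
`u` is `C¹` on `J` with derivative `v`, and `v t = v t₀ - ∫_{t₀}^{t} (q s * G (u s) + α) ds`. -/
def IsSolOnC (q G : ℝ → ℝ) (α : ℝ) (J : Set ℝ) (u v : ℝ → ℝ) : Prop :=
  (∀ t ∈ J, HasDerivWithinAt u (v t) J t) ∧
    ∀ t₀ ∈ J, ∀ t ∈ J, v t = v t₀ - ∫ s in t₀..t, (q s * G (u s) + α)

/-- The forcing term of a non-negative Carathéodory solution is integrable. -/
lemma IsSolOnC.intervalIntegrable_forcing {q G u v : ℝ → ℝ} {α x y s t : ℝ}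
    (hG : ContinuousOn G (Ici 0)) (hq : ∀ x y, IntervalIntegrable q volume x y)
    (h : IsSolOnC q G α (Icc x y) u v) (hu : ∀ t ∈ Icc x y, 0 ≤ u t)
    (hs : s ∈ Icc x y) (ht : t ∈ Icc x y) :
    IntervalIntegrable (fun r => q r * G (u r) + α) volume s t := by
  have hGu : ContinuousOn (fun r => G (u r)) (Icc x y) :=
    hG.comp (fun r hr => (h.1 r hr).continuousWithinAt) hu
  exact ((hq s t).mul_continuousOn (hGu.mono (uIcc_subset_Icc hs ht))).add
    intervalIntegrable_const

/-- The derivative of a non-negative solution with non-negative forcing is non-increasing. -/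
lemma IsSolOnC.antitoneOn {q G u v : ℝ → ℝ} {α x y : ℝ}
    (hGpos : ∀ s, 0 ≤ s → 0 ≤ G s) (hq0 : ∀ t, 0 ≤ q t) (hα : 0 ≤ α)
    (h : IsSolOnC q G α (Icc x y) u v) (hu : ∀ t ∈ Icc x y, 0 ≤ u t) :
    AntitoneOn v (Icc x y) := by
  intro s hs t ht hst
  have h0 : 0 ≤ ∫ r in s..t, (q r * G (u r) + α) := by
    refine intervalIntegral.integral_nonneg hst fun r hr => ?_
    have := hGpos _ (hu r ⟨hs.1.trans hr.1, hr.2.trans ht.2⟩)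
    have := hq0 r
    positivity
  linarith [h.2 s hs t ht]

/-- A non-negative concave function on `[x, y]` which attains the value `ρ` is at least
`ε / (y - x) * ρ` at distance `ε` from the endpoints. -/
lemma ConcaveOn.mul_le_of_mem_Icc {u : ℝ → ℝ} {x y ε p t : ℝ}
    (hc : ConcaveOn ℝ (Icc x y) u) (hu : ∀ t ∈ Icc x y, 0 ≤ u t) (hp : p ∈ Icc x y)
    (hε : 0 < ε) (hεxy : ε < y - x) (ht : t ∈ Icc (x + ε) (y - ε)) :
    ε / (y - x) * u p ≤ u t := by
  have hxy : 0 < y - x := hε.trans hεxy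
  set w := ε / (y - x) with hw
  have hwε : w * (y - x) = ε := div_mul_cancel₀ _ hxy.ne'
  have hw0 : 0 < w := div_pos hε hxy
  have hw1 : 0 < 1 - w := by
    have : w < 1 := (div_lt_one hxy).2 hεxy
    linarith
  have hr : (t - w * p) / (1 - w) ∈ Icc x y := by
    rw [mem_Icc, le_div_iff₀ hw1, div_le_iff₀ hw1]
    constructor
    · nlinarith [ht.1, hp.2]
    · nlinarith [ht.2, hp.1]
  have key := hc.2 hp hr hw0.le hw1.le (by ring)
  simp only [smul_eq_mul] at key
  rw [mul_div_cancel₀ _ hw1.ne', add_sub_cancel] at key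
  nlinarith [hu _ hr]

/-- A positive integral over `[x, y]` stays positive on slightly smaller intervals. -/
lemma exists_integral_pos_shrink {b : ℝ → ℝ} {x y : ℝ} (hxy : x < y)
    (hb : ∀ x y, IntervalIntegrable b volume x y) (hpos : 0 < ∫ t in x..y, b t) :
    ∃ ε, 0 < ε ∧ 2 * ε < y - x ∧ 0 < ∫ t in (x + ε)..(y - ε), b t := by
  have hF : Continuous fun z => ∫ t in (0 : ℝ)..z, b t :=
    intervalIntegral.continuous_primitive hb 0
  have hD : Continuous fun ε => (∫ t in (0 : ℝ)..(y - ε), b t) - ∫ t in (0 : ℝ)..(x + ε), b t :=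
    (hF.comp (continuous_const.sub continuous_id)).sub
      (hF.comp (continuous_const.add continuous_id))
  simp only [intervalIntegral.integral_interval_sub_left (hb _ _) (hb _ _)] at hD
  have h1 : ∀ᶠ ε in 𝓝 (0 : ℝ), 0 < ∫ t in (x + ε)..(y - ε), b t :=
    hD.continuousAt.eventually (lt_mem_nhds (by simpa using hpos))
  have h2 : ∀ᶠ ε in 𝓝 (0 : ℝ), ε < (y - x) / 2 := gt_mem_nhds (by linarith)
  obtain ⟨ε, ⟨hε1, hε2⟩, hε0⟩ := (((h1.and h2).filter_mono nhdsWithin_le_nhds).and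
    (eventually_mem_nhdsWithin (a := (0 : ℝ)) (s := Ioi 0))).exists
  exact ⟨ε, hε0, by linarith, hε1⟩

/-- For large `lam`, non-negative solutions of `u'' + lam * b(t) g(u) + α = 0` on `[x, y]`
do not have maximum `ρ`. -/
lemma exists_forall_sSup_ne {g b : ℝ → ℝ} {x y ρ : ℝ} (hxy : x < y) (hρ : 0 < ρ)
    (hg_cont : ContinuousOn g (Ici 0)) (hg_zero : g 0 = 0)
    (hg_pos : ∀ s : ℝ, 0 < s → 0 < g s)
    (hb : ∀ x y, IntervalIntegrable b volume x y) (hb0 : ∀ t, 0 ≤ b t)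
    (hpos : 0 < ∫ t in x..y, b t) :
    ∃ L : ℝ, 0 < L ∧ ∀ lam, L < lam → ∀ α, 0 ≤ α → ∀ u v : ℝ → ℝ,
      IsSolOnC (fun t => lam * b t) g α (Icc x y) u v → (∀ t ∈ Icc x y, 0 ≤ u t) →
      sSup (u '' Icc x y) ≠ ρ := by
  obtain ⟨ε, hε, hεxy, hA⟩ := exists_integral_pos_shrink hxy hb hpos
  set A := ∫ t in (x + ε)..(y - ε), b t
  have hwρ : 0 < ε / (y - x) * ρ := mul_pos (div_pos hε (by linarith)) hρ
  have hwle : ε / (y - x) * ρ ≤ ρ :=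
    mul_le_of_le_one_left hρ.le ((div_le_one (by linarith)).2 (by linarith))
  obtain ⟨z, hz, hzmin⟩ := isCompact_Icc.exists_isMinOn (nonempty_Icc.2 hwle)
    (hg_cont.mono fun s hs => hwρ.le.trans hs.1)
  have hη : 0 < g z := hg_pos z (hwρ.trans_le hz.1)
  refine ⟨2 * ρ / (ε * (g z * A)), by positivity, ?_⟩
  intro lam hlam α hα u v hsol hu hsup
  have hlam0 : 0 < lam := lt_trans (by positivity) hlam
  have hg0 : ∀ s, 0 ≤ s → 0 ≤ g s := fun s hs =>
    hs.eq_or_lt.elim (fun h => by rw [← h, hg_zero]) fun h => (hg_pos s h).le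
  have hq0 : ∀ t, 0 ≤ lam * b t := fun t => mul_nonneg hlam0.le (hb0 t)
  have hanti := hsol.antitoneOn hg0 hq0 hα hu
  have hcont : ContinuousOn u (Icc x y) := fun r hr => (hsol.1 r hr).continuousWithinAt
  have hder : ∀ t ∈ Ioo x y, HasDerivAt u (v t) t := fun t ht =>
    (hsol.1 t (Ioo_subset_Icc_self ht)).hasDerivAt (Icc_mem_nhds ht.1 ht.2)
  have hconc : ConcaveOn ℝ (Icc x y) u := by
    refine AntitoneOn.concaveOn_of_deriv (convex_Icc x y) hcont ?_ ?_ <;> rw [interior_Icc]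
    · exact fun t ht => (hder t ht).differentiableAt.differentiableWithinAt
    · exact (hanti.mono Ioo_subset_Icc_self).congr fun t ht => (hder t ht).deriv.symm
  obtain ⟨p, hp, hpmax, hple⟩ := isCompact_Icc.exists_sSup_image_eq_and_ge
    (nonempty_Icc.2 hxy.le) hcont
  rw [hsup] at hpmax
  have hx' : x + ε ∈ Icc x y := ⟨by linarith, by linarith⟩
  have hy' : y - ε ∈ Icc x y := ⟨by linarith, by linarith⟩
  have hleft : v (x + ε) * ε ≤ ρ := by
    obtain ⟨c, hc, hcv⟩ := exists_hasDerivAt_eq_slope u v (by linarith : x < x + ε)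
      (hcont.mono (Icc_subset_Icc_right hx'.2))
      fun t ht => hder t ⟨ht.1, ht.2.trans_le hx'.2⟩
    have hvc := hanti ⟨hc.1.le, hc.2.le.trans hx'.2⟩ hx' hc.2.le
    rw [add_sub_cancel_left, eq_div_iff hε.ne'] at hcv
    nlinarith [hple _ hx', hu x (left_mem_Icc.2 hxy.le)]
  have hright : -ρ ≤ v (y - ε) * ε := by
    obtain ⟨c, hc, hcv⟩ := exists_hasDerivAt_eq_slope u v (by linarith : y - ε < y)
      (hcont.mono (Icc_subset_Icc_left hy'.1))
      fun t ht => hder t ⟨hy'.1.trans_lt ht.1, ht.2⟩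
    have hvc := hanti hy' ⟨hy'.1.trans hc.1.le, hc.2.le⟩ hc.1.le
    rw [sub_sub_cancel, eq_div_iff hε.ne'] at hcv
    nlinarith [hple _ hy', hu y (right_mem_Icc.2 hxy.le)]
  have hint : lam * g z * A ≤
      ∫ r in (x + ε)..(y - ε), (lam * b r * g (u r) + α) := by
    rw [← intervalIntegral.integral_const_mul]
    refine intervalIntegral.integral_mono_on (by linarith) ((hb _ _).const_mul _)
      (hsol.intervalIntegrable_forcing hg_cont (fun _ _ => (hb _ _).const_mul _) hu hx' hy')
      fun r hr => ?_
    have hr' : r ∈ Icc x y := ⟨hx'.1.trans hr.1, hr.2.trans hy'.2⟩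
    have hlow := hconc.mul_le_of_mem_Icc hu hp hε (by linarith) hr
    rw [← hpmax] at hlow
    have hgz : g z ≤ g (u r) := hzmin ⟨hlow, hpmax ▸ hple r hr'⟩
    nlinarith [mul_le_mul_of_nonneg_left hgz (hq0 r)]
  have hv := hsol.2 _ hx' _ hy'
  rw [div_lt_iff₀ (by positivity)] at hlam
  nlinarith [mul_le_mul_of_nonneg_right hint hε.le]

theorem stmt_1 (g a : ℝ → ℝ) (T : ℝ) (m : ℕ) (σ τ : ℕ → ℝ)
    (hg_cont : ContinuousOn g (Ici 0)) (hg_zero : g 0 = 0)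
    (hg_pos : ∀ s : ℝ, 0 < s → 0 < g s)
    (hm : 1 ≤ m)
    (hστ : ∀ i, 1 ≤ i → i ≤ m → σ i < τ i)
    (hτσ : ∀ i, 1 ≤ i → i ≤ m → τ i < σ (i + 1))
    (hσT : σ (m + 1) - σ 1 = T)
    (ha_per : ∀ t, a (t + T) = a t)
    (ha_loc : LocallyIntegrable a)
    (ha_pos : ∀ i, 1 ≤ i → i ≤ m →
      (∀ᵐ t : ℝ ∂volume, t ∈ Icc (σ i) (τ i) → 0 ≤ a t) ∧
        0 < ∫ t in (σ i)..(τ i), a t)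
    (ha_neg : ∀ i, 1 ≤ i → i ≤ m →
      (∀ᵐ t : ℝ ∂volume, t ∈ Icc (τ i) (σ (i + 1)) → a t ≤ 0) ∧
        (∫ t in (τ i)..(σ (i + 1)), a t) < 0) :
    ∀ ρ : ℝ, 0 < ρ → ∃ lamStar : ℝ, 0 < lamStar ∧
      ∀ lam : ℝ, lamStar < lam → ∀ α : ℝ, 0 ≤ α → ∀ i, 1 ≤ i → i ≤ m →
        ∀ u v : ℝ → ℝ,
          IsSolOnC (fun t => lam * max (a t) 0) g α (Icc (σ i) (τ i)) u v →
          (∀ t ∈ Icc (σ i) (τ i), 0 ≤ u t) →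
          sSup (u '' Icc (σ i) (τ i)) ≠ ρ := by
  intro ρ hρ
  have hex : ∀ i, ∃ L : ℝ, 0 < L ∧ (1 ≤ i → i ≤ m → ∀ lam, L < lam → ∀ α, 0 ≤ α →
      ∀ u v : ℝ → ℝ, IsSolOnC (fun t => lam * max (a t) 0) g α (Icc (σ i) (τ i)) u v →
      (∀ t ∈ Icc (σ i) (τ i), 0 ≤ u t) → sSup (u '' Icc (σ i) (τ i)) ≠ ρ) := by
    intro i
    by_cases hi : 1 ≤ i ∧ i ≤ m
    · have ha : ∀ x y, IntervalIntegrable a volume x y := fun x y =>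
        (ha_loc.integrableOn_isCompact isCompact_uIcc).intervalIntegrable
      have hb : ∀ x y, IntervalIntegrable (fun t => max (a t) 0) volume x y := fun x y =>
        ⟨(ha x y).1.pos_part, (ha x y).2.pos_part⟩
      have hlt := hστ i hi.1 hi.2
      have hpos : 0 < ∫ t in (σ i)..(τ i), max (a t) 0 :=
        (ha_pos i hi.1 hi.2).2.trans_le (intervalIntegral.integral_mono_on hlt.le (ha _ _)
          (hb _ _) fun t _ => le_max_left _ _)
      obtain ⟨L, hL, h⟩ := exists_forall_sSup_ne hlt hρ hg_cont hg_zero hg_pos hb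
        (fun t => le_max_right _ _) hpos
      exact ⟨L, hL, fun _ _ => h⟩
    · exact ⟨1, one_pos, fun h1 h2 => absurd ⟨h1, h2⟩ hi⟩
  choose L hL h using hex
  refine ⟨∑ i ∈ Finset.Icc 1 m, L i,
    Finset.sum_pos (fun i _ => hL i) (Finset.nonempty_Icc.2 hm), ?_⟩
  intro lam hlam α hα i h1 h2 u v
  exact h i h1 h2 lam ((Finset.single_le_sum (fun j _ => (hL j).le)
    (Finset.mem_Icc.2 ⟨h1, h2⟩)).trans_lt hlam) α hα u v
end

section
/- Let λ > 0 and 0 < d < D. For any i ∈ {1,…,m} (intervals counted cyclically, with I⁺_{m+1} := I⁺₁ + T) there exists a constant μ*⁺_i > 0 (one may take μ*⁺_i = λ‖a‖_{+,i+1} g*(D) / (‖a‖_{−,i} g_*(d,D))) such that for all μ > μ*⁺_i, every non-negative solution u of u'' + ϑ(λa⁺(t) − μa⁻(t)) g(u) = 0, ϑ ∈ (0,1], defined on I⁻_i ∪ I⁺_{i+1} and satisfying sup u ≤ D, u(τ_i) > d and u'(τ_i) > 0, satisfies u(t) > d and u'(t) > 0 for all t ∈ I⁻_i ∪ I⁺_{i+1}.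 -/
open MeasureTheory Set Filter Topology

/-- A (Carathéodory) solution of `u'' + q(t) G(u) = 0` on a set `J ⊆ ℝ`:
`u` is `C¹` on `J` with derivative `v`, and `v t = v t₀ - ∫_{t₀}^{t} q s * G (u s) ds`. -/
def IsSolOn (q G : ℝ → ℝ) (J : Set ℝ) (u v : ℝ → ℝ) : Prop :=
  (∀ t ∈ J, HasDerivWithinAt u (v t) J t) ∧
    ∀ t₀ ∈ J, ∀ t ∈ J, v t = v t₀ - ∫ s in t₀..t, q s * G (u s)

/-- The positivity interval following the `i`-th one, for `i = m` the translate of the first one by a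
period, is nondegenerate, and the weight has positive integral on it. -/
lemma pos_interval_succ {a : ℝ → ℝ} {T : ℝ} {m : ℕ} {σ τ : ℕ → ℝ} (hm : 1 ≤ m)
    (hστ : ∀ i, 1 ≤ i → i ≤ m → σ i < τ i) (hσT : σ (m + 1) - σ 1 = T)
    (ha_per : ∀ t, a (t + T) = a t)
    (ha_pos : ∀ i, 1 ≤ i → i ≤ m → 0 < ∫ t in (σ i)..(τ i), a t)
    (hτm1 : τ (m + 1) = τ 1 + T) {i : ℕ} (him : i ≤ m) :
    σ (i + 1) < τ (i + 1) ∧ 0 < ∫ t in (σ (i + 1))..(τ (i + 1)), a t := by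
  rcases him.lt_or_eq with h | rfl
  · exact ⟨hστ _ (by omega) h, ha_pos _ (by omega) h⟩
  · have hσ : σ (i + 1) = σ 1 + T := by linarith
    have h := ha_pos 1 le_rfl hm
    rw [hσ, hτm1, ← intervalIntegral.integral_comp_add_right]
    simp only [ha_per]
    exact ⟨by linarith [hστ 1 le_rfl hm], h⟩

/-- A continuous function that is positive on `(0, ∞)` has a positive infimum on `[d, D]`,
`0 < d ≤ D`. -/
lemma sInf_image_Icc_pos {g : ℝ → ℝ} {d D : ℝ} (hg : ContinuousOn g (Ici 0))
    (hg_pos : ∀ s : ℝ, 0 < s → 0 < g s) (hd : 0 < d) (hdD : d ≤ D) :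
    0 < sInf (g '' Icc d D) := by
  have hc : IsCompact (g '' Icc d D) :=
    isCompact_Icc.image_of_continuousOn (hg.mono fun x hx => hd.le.trans hx.1)
  obtain ⟨s, hs, h⟩ := hc.sInf_mem ((nonempty_Icc.2 hdD).image g)
  exact h ▸ hg_pos s (hd.trans_le hs.1)

/-- If `u` is differentiable on `[α, γ]` with positive derivative on `[α, β]`, then `u` stays above
its initial value on `[α, β]`. -/
lemma le_of_hasDerivWithinAt_pos {u v : ℝ → ℝ} {α β γ : ℝ} (hβγ : β ≤ γ)
    (hu : ∀ t ∈ Icc α γ, HasDerivWithinAt u (v t) (Icc α γ) t)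
    (hv : ∀ t ∈ Icc α β, 0 < v t) {t : ℝ} (ht : t ∈ Icc α β) : u α ≤ u t := by
  have hsub : Icc α β ⊆ Icc α γ := Icc_subset_Icc_right hβγ
  have hmono : MonotoneOn u (Icc α β) := by
    refine monotoneOn_of_hasDerivWithinAt_nonneg (f' := v) (convex_Icc α β)
      (fun x hx => ((hu x (hsub hx)).mono hsub).continuousWithinAt) ?_ ?_
    · intro x hx
      exact (hu x (hsub (interior_subset hx))).mono (interior_subset.trans hsub)
    · exact fun x hx => (hv x (interior_subset hx)).le
  exact hmono (left_mem_Icc.2 (ht.1.trans ht.2)) ht ht.1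

/-- If the weight is nonpositive on `[α, β]` and its negative part there outweighs its positive
part on `[β, γ]`, then a solution starting at `α` above `d` with positive slope keeps a positive
slope and stays above `d` on `[α, γ]`. -/
lemma solution_increasing {g a u v : ℝ → ℝ} {α β γ lam mu ϑ d D : ℝ}
    (hg : ContinuousOn g (Ici 0)) (hg_nonneg : ∀ s : ℝ, 0 ≤ s → 0 ≤ g s)
    (ha : LocallyIntegrable a) (hαβ : α ≤ β) (hβγ : β ≤ γ)
    (ha_neg : ∀ᵐ t : ℝ, t ∈ Icc α β → a t ≤ 0)
    (hlam : 0 ≤ lam) (hmu : 0 ≤ mu) (hϑ : 0 ≤ ϑ) (hd : 0 ≤ d)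
    (hbal : lam * (∫ t in β..γ, max (a t) 0) * sSup (g '' Icc 0 D) ≤
      mu * ((∫ t in α..β, max (-a t) 0) * sInf (g '' Icc d D)))
    (hsol : IsSolOn (fun t => ϑ * (lam * max (a t) 0 - mu * max (-a t) 0)) g (Icc α γ) u v)
    (hu0 : ∀ t ∈ Icc α γ, 0 ≤ u t) (huD : ∀ t ∈ Icc α γ, u t ≤ D)
    (hdu : d < u α) (hv : 0 < v α) :
    ∀ t ∈ Icc α γ, d < u t ∧ 0 < v t := by
  obtain ⟨hder, hint⟩ := hsol
  have hα : α ∈ Icc α γ := ⟨le_rfl, hαβ.trans hβγ⟩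
  have hβ : β ∈ Icc α γ := ⟨hαβ, hβγ⟩
  have ha_int (x y : ℝ) : IntervalIntegrable a volume x y :=
    (ha.integrableOn_isCompact isCompact_uIcc).intervalIntegrable
  have hpos_int (x y : ℝ) : IntervalIntegrable (fun t => max (a t) 0) volume x y :=
    ⟨(ha_int x y).1.pos_part, (ha_int x y).2.pos_part⟩
  have hneg_int (x y : ℝ) : IntervalIntegrable (fun t => max (-a t) 0) volume x y :=
    ⟨(ha_int x y).1.neg_part, (ha_int x y).2.neg_part⟩
  have hq_int {x y : ℝ} (hx : x ∈ Icc α γ) (hy : y ∈ Icc α γ) : IntervalIntegrable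
      (fun t => ϑ * (lam * max (a t) 0 - mu * max (-a t) 0) * g (u t)) volume x y := by
    refine ((((hpos_int x y).const_mul lam).sub ((hneg_int x y).const_mul mu)).const_mul
      ϑ).mul_continuousOn ?_
    refine ContinuousOn.mono ?_ (uIcc_subset_Icc hx hy)
    exact hg.comp (fun t ht => (hder t ht).continuousWithinAt) hu0
  have hbelow : BddBelow (g '' Icc d D) :=
    ⟨0, by rintro _ ⟨s, hs, rfl⟩; exact hg_nonneg s (hd.trans hs.1)⟩
  have habove : BddAbove (g '' Icc 0 D) :=
    (isCompact_Icc.image_of_continuousOn (hg.mono fun x hx => hx.1)).bddAbove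
  have hvα : ∀ t ∈ Icc α β, 0 < v t := by
    intro t ht
    have htγ : t ∈ Icc α γ := ⟨ht.1, ht.2.trans hβγ⟩
    have hle : ∫ s in α..t, ϑ * (lam * max (a s) 0 - mu * max (-a s) 0) * g (u s) ≤
        ∫ _ in α..t, (0 : ℝ) := by
      refine intervalIntegral.integral_mono_ae_restrict ht.1 (hq_int hα htγ) (by simp) ?_
      refine (ae_restrict_iff' measurableSet_Icc).2 ?_
      filter_upwards [ha_neg] with s hs hst
      have hsa := hs ⟨hst.1, hst.2.trans ht.2⟩
      have hgu := hg_nonneg _ (hu0 s ⟨hst.1, hst.2.trans htγ.2⟩)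
      rw [max_eq_right hsa]
      have h1 : 0 ≤ mu * max (-a s) 0 := mul_nonneg hmu (le_max_right _ _)
      have h2 : ϑ * (lam * 0 - mu * max (-a s) 0) ≤ 0 :=
        mul_nonpos_of_nonneg_of_nonpos hϑ (by linarith)
      exact mul_nonpos_of_nonpos_of_nonneg h2 hgu
    rw [hint α hα t htγ]
    simp only [intervalIntegral.integral_zero] at hle
    linarith
  have huα : ∀ t ∈ Icc α β, d < u t := fun t ht =>
    hdu.trans_le (le_of_hasDerivWithinAt_pos hβγ hder hvα ht)
  have hvβ : v α + ϑ * (mu * ((∫ t in α..β, max (-a t) 0) * sInf (g '' Icc d D))) ≤ v β := by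
    have hle : ∫ s in α..β, ϑ * (lam * max (a s) 0 - mu * max (-a s) 0) * g (u s) ≤
        ∫ s in α..β, -(ϑ * mu * sInf (g '' Icc d D)) * max (-a s) 0 := by
      refine intervalIntegral.integral_mono_ae_restrict hαβ (hq_int hα hβ)
        ((hneg_int α β).const_mul _) ?_
      refine (ae_restrict_iff' measurableSet_Icc).2 ?_
      filter_upwards [ha_neg] with s hs hst
      have hgu : sInf (g '' Icc d D) ≤ g (u s) :=
        csInf_le hbelow (mem_image_of_mem g ⟨(huα s hst).le, huD s ⟨hst.1, hst.2.trans hβγ⟩⟩)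
      rw [max_eq_right (hs hst)]
      have h1 : 0 ≤ ϑ * mu * max (-a s) 0 :=
        mul_nonneg (mul_nonneg hϑ hmu) (le_max_right _ _)
      have h2 := mul_le_mul_of_nonneg_left hgu h1
      linarith
    rw [intervalIntegral.integral_const_mul] at hle
    rw [hint α hα β hβ]
    linarith
  have hv_pos : ∀ t ∈ Icc α γ, 0 < v t := by
    intro t ht
    rcases le_total t β with htβ | hβt
    · exact hvα t ⟨ht.1, htβ⟩
    have hM : 0 ≤ sSup (g '' Icc 0 D) :=
      Real.sSup_nonneg (by rintro _ ⟨s, hs, rfl⟩; exact hg_nonneg s hs.1)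
    have hle : ∫ s in β..t, ϑ * (lam * max (a s) 0 - mu * max (-a s) 0) * g (u s) ≤
        ∫ s in β..t, ϑ * lam * sSup (g '' Icc 0 D) * max (a s) 0 := by
      refine intervalIntegral.integral_mono_on hβt (hq_int hβ ht) ((hpos_int β t).const_mul _) ?_
      intro s hst
      have hs : s ∈ Icc α γ := ⟨hαβ.trans hst.1, hst.2.trans ht.2⟩
      have hgu : g (u s) ≤ sSup (g '' Icc 0 D) :=
        le_csSup habove (mem_image_of_mem g ⟨hu0 s hs, huD s hs⟩)
      have h1 : 0 ≤ ϑ * lam * max (a s) 0 :=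
        mul_nonneg (mul_nonneg hϑ hlam) (le_max_right _ _)
      have h2 := mul_le_mul_of_nonneg_left hgu h1
      have h3 : 0 ≤ ϑ * mu * max (-a s) 0 * g (u s) :=
        mul_nonneg (mul_nonneg (mul_nonneg hϑ hmu) (le_max_right _ _)) (hg_nonneg _ (hu0 s hs))
      linarith
    have hmono : ∫ s in β..t, max (a s) 0 ≤ ∫ s in β..γ, max (a s) 0 :=
      intervalIntegral.integral_mono_interval le_rfl hβt ht.2
        (Eventually.of_forall fun s => le_max_right _ _) (hpos_int β γ)
    rw [intervalIntegral.integral_const_mul] at hle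
    have h1 := mul_le_mul_of_nonneg_left hmono (mul_nonneg (mul_nonneg hϑ hlam) hM)
    have h2 := mul_le_mul_of_nonneg_left hbal hϑ
    rw [hint β hβ t ht]
    linarith
  exact fun t ht =>
    ⟨hdu.trans_le (le_of_hasDerivWithinAt_pos le_rfl hder hv_pos ht), hv_pos t ht⟩

theorem stmt_4 (g a : ℝ → ℝ) (T : ℝ) (m : ℕ) (σ τ : ℕ → ℝ)
    (hg_cont : ContinuousOn g (Ici 0)) (hg_zero : g 0 = 0)
    (hg_pos : ∀ s : ℝ, 0 < s → 0 < g s)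
    (hm : 1 ≤ m)
    (hστ : ∀ i, 1 ≤ i → i ≤ m → σ i < τ i)
    (hτσ : ∀ i, 1 ≤ i → i ≤ m → τ i < σ (i + 1))
    (hσT : σ (m + 1) - σ 1 = T)
    (ha_per : ∀ t, a (t + T) = a t)
    (ha_loc : LocallyIntegrable a)
    (ha_pos : ∀ i, 1 ≤ i → i ≤ m →
      (∀ᵐ t : ℝ ∂volume, t ∈ Icc (σ i) (τ i) → 0 ≤ a t) ∧
        0 < ∫ t in (σ i)..(τ i), a t)
    (ha_neg : ∀ i, 1 ≤ i → i ≤ m →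
      (∀ᵐ t : ℝ ∂volume, t ∈ Icc (τ i) (σ (i + 1)) → a t ≤ 0) ∧
        (∫ t in (τ i)..(σ (i + 1)), a t) < 0)
    -- cyclic convention: `I⁺_{m+1} := I⁺₁ + T`, i.e. `τ (m+1) = τ 1 + T`
    -- (its left endpoint is `σ (m+1) = σ 1 + T`)
    (hτm1 : τ (m + 1) = τ 1 + T)
    (lam d D : ℝ) (hlam : 0 < lam) (hd : 0 < d) (hdD : d < D)
    (i : ℕ) (hi1 : 1 ≤ i) (him : i ≤ m) :
    0 < lam * (∫ t in (σ (i + 1))..(τ (i + 1)), max (a t) 0) * sSup (g '' Icc 0 D) /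
        ((∫ t in (τ i)..(σ (i + 1)), max (-a t) 0) * sInf (g '' Icc d D)) ∧
    ∀ mu : ℝ,
      lam * (∫ t in (σ (i + 1))..(τ (i + 1)), max (a t) 0) * sSup (g '' Icc 0 D) /
        ((∫ t in (τ i)..(σ (i + 1)), max (-a t) 0) * sInf (g '' Icc d D)) < mu →
      ∀ ϑ : ℝ, 0 < ϑ → ϑ ≤ 1 →
        ∀ u v : ℝ → ℝ,
          IsSolOn (fun t => ϑ * (lam * max (a t) 0 - mu * max (-a t) 0)) g
            (Icc (τ i) (τ (i + 1))) u v →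
          (∀ t ∈ Icc (τ i) (τ (i + 1)), 0 ≤ u t) →
          (∀ t ∈ Icc (τ i) (τ (i + 1)), u t ≤ D) →
          d < u (τ i) → 0 < v (τ i) →
          ∀ t ∈ Icc (τ i) (τ (i + 1)), d < u t ∧ 0 < v t := by
  obtain ⟨hlt, hpos⟩ := pos_interval_succ hm hστ hσT ha_per
    (fun j h1 h2 => (ha_pos j h1 h2).2) hτm1 him
  obtain ⟨hneg, hneg_int⟩ := ha_neg i hi1 him
  have ha_int (x y : ℝ) : IntervalIntegrable a volume x y :=
    (ha_loc.integrableOn_isCompact isCompact_uIcc).intervalIntegrable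
  have hA : 0 < ∫ t in (σ (i + 1))..(τ (i + 1)), max (a t) 0 :=
    hpos.trans_le <| intervalIntegral.integral_mono hlt.le (ha_int _ _)
      ⟨(ha_int _ _).1.pos_part, (ha_int _ _).2.pos_part⟩ fun t => le_max_left _ _
  have hB : 0 < ∫ t in (τ i)..(σ (i + 1)), max (-a t) 0 := by
    have h : ∫ t in (τ i)..(σ (i + 1)), -a t ≤ ∫ t in (τ i)..(σ (i + 1)), max (-a t) 0 :=
      intervalIntegral.integral_mono (hτσ i hi1 him).le (ha_int _ _).neg
        ⟨(ha_int _ _).1.neg_part, (ha_int _ _).2.neg_part⟩ fun t => le_max_left _ _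
    rw [intervalIntegral.integral_neg] at h
    linarith
  have hinf := sInf_image_Icc_pos hg_cont hg_pos hd hdD.le
  have hsup : 0 < sSup (g '' Icc 0 D) :=
    (hg_pos D (hd.trans hdD)).trans_le <| le_csSup
      (isCompact_Icc.image_of_continuousOn (hg_cont.mono fun x hx => hx.1)).bddAbove
      (mem_image_of_mem g ⟨(hd.trans hdD).le, le_rfl⟩)
  have hstar := div_pos (mul_pos (mul_pos hlam hA) hsup) (mul_pos hB hinf)
  refine ⟨hstar, fun mu hmu ϑ hϑ _ u v hsol hu0 huD hdu hv => ?_⟩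
  have hg_nonneg : ∀ s : ℝ, 0 ≤ s → 0 ≤ g s := fun s hs =>
    hs.eq_or_lt.elim (fun h => h ▸ hg_zero.ge) fun h => (hg_pos s h).le
  exact solution_increasing hg_cont hg_nonneg ha_loc (hτσ i hi1 him).le hlt.le hneg hlam.le
    (hstar.trans hmu).le hϑ.le hd.le ((div_lt_iff₀ (mul_pos hB hinf)).1 hmu).le hsol hu0 huD hdu hv
end

section
/- Let λ > 0 and 0 < d < D. For any i ∈ {1,…,m} (intervals counted cyclically, with I⁺₀ := I⁺_m − T and I⁻₀ := I⁻_m − T) there exists a constant μ*⁻_i > 0 (one may take μ*⁻_i = λ‖a‖_{+,i−1} g*(D) / (‖a‖_{−,i−1} g_*(d,D))) such that for all μ > μ*⁻_i, every non-negative solution u of u'' + ϑ(λa⁺(t) − μa⁻(t)) g(u) = 0, ϑ ∈ (0,1], defined on I⁺_{i−1} ∪ I⁻_{i−1} and satisfying sup u ≤ D, u(σ_i) > d and u'(σ_i) < 0, satisfies u(t) > d and u'(t) < 0 for all t ∈ I⁺_{i−1} ∪ I⁻_{i−1}. -/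
open MeasureTheory Set Filter Topology

theorem IntervalIntegrable.max_zero {f : ℝ → ℝ} {x y : ℝ} (hf : IntervalIntegrable f volume x y) :
    IntervalIntegrable (fun t => max (f t) 0) volume x y :=
  ⟨hf.1.pos_part, hf.2.pos_part⟩

/-- If a sign-changing weight is positive on `[s, r]` and negative on `[r, e]`, and the negative part
dominates in the integral sense, then a solution decreasing at `e` above the level `d` is decreasing
and above `d` on the whole of `[s, e]`. -/
theorem IsSolOn.lt_and_neg_of_lt_of_neg {g a : ℝ → ℝ} {s r e lam mu ϑ d D gsup ginf : ℝ}
    (hg_cont : ContinuousOn g (Ici 0)) (hg_nonneg : ∀ x, 0 ≤ x → 0 ≤ g x)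
    (hsr : s ≤ r) (hre : r ≤ e)
    (hai : ∀ x y, IntervalIntegrable a volume x y)
    (ha_pos : ∀ᵐ t : ℝ, t ∈ Icc s r → 0 ≤ a t)
    (ha_neg : ∀ᵐ t : ℝ, t ∈ Icc r e → a t ≤ 0)
    (hlam : 0 ≤ lam) (hmu : 0 ≤ mu) (hϑ : 0 ≤ ϑ)
    (hsup : ∀ x ∈ Icc 0 D, g x ≤ gsup) (hinf : ∀ x ∈ Icc d D, ginf ≤ g x)
    (hdom : lam * (∫ t in s..r, max (a t) 0) * gsup ≤
      mu * ((∫ t in r..e, max (-a t) 0) * ginf))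
    {u v : ℝ → ℝ}
    (hsol : IsSolOn (fun t => ϑ * (lam * max (a t) 0 - mu * max (-a t) 0)) g (Icc s e) u v)
    (hu0 : ∀ t ∈ Icc s e, 0 ≤ u t) (huD : ∀ t ∈ Icc s e, u t ≤ D)
    (hue : d < u e) (hve : v e < 0) :
    ∀ t ∈ Icc s e, d < u t ∧ v t < 0 := by
  obtain ⟨hderiv, hint⟩ := hsol
  have hucont : ContinuousOn u (Icc s e) := fun t ht => (hderiv t ht).continuousWithinAt
  have hgu : ContinuousOn (fun t => g (u t)) (Icc s e) := hg_cont.comp hucont hu0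
  have hr : r ∈ Icc s e := ⟨hsr, hre⟩
  have he : e ∈ Icc s e := ⟨hsr.trans hre, le_rfl⟩
  have hposi : ∀ x y, IntervalIntegrable (fun t => max (a t) 0) volume x y := fun x y =>
    (hai x y).max_zero
  have hnegi : ∀ x y, IntervalIntegrable (fun t => max (-a t) 0) volume x y := fun x y =>
    (hai x y).neg.max_zero
  have hqi : ∀ x ∈ Icc s e, ∀ y ∈ Icc s e, IntervalIntegrable
      (fun t => ϑ * (lam * max (a t) 0 - mu * max (-a t) 0) * g (u t)) volume x y := by
    intro x hx y hy
    exact ((((hposi x y).const_mul lam).sub ((hnegi x y).const_mul mu)).const_mul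
      ϑ).mul_continuousOn (hgu.mono (uIcc_subset_Icc hx hy))
  -- a negative derivative to the right of `t` keeps `u` above its final value
  have habove : ∀ t ∈ Icc s e, (∀ x ∈ Icc t e, v x < 0) → u e ≤ u t := by
    intro t ht hv
    have hsub : Icc t e ⊆ Icc s e := Icc_subset_Icc_left ht.1
    refine antitoneOn_of_hasDerivWithinAt_nonpos (convex_Icc t e) (hucont.mono hsub)
      (f' := v) (fun x hx => ?_) (fun x hx => ?_) (left_mem_Icc.2 ht.2) (right_mem_Icc.2 ht.2) ht.2
    · exact (hderiv x (hsub (interior_subset hx))).mono (interior_subset.trans hsub)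
    · exact (hv x (interior_subset hx)).le
  have hvneg : ∀ t ∈ Icc r e, v t < 0 := by
    intro t ht
    have hts : t ∈ Icc s e := ⟨hsr.trans ht.1, ht.2⟩
    have hnonneg : 0 ≤ ∫ x in t..e, -(ϑ * (lam * max (a x) 0 - mu * max (-a x) 0) * g (u x)) := by
      refine intervalIntegral.integral_nonneg_of_ae_restrict ht.2 ?_
      refine (ae_restrict_iff' measurableSet_Icc).2 ?_
      filter_upwards [ha_neg] with x hx hxt
      have hax := hx ⟨ht.1.trans hxt.1, hxt.2⟩
      have hgx := hg_nonneg _ (hu0 x ⟨hts.1.trans hxt.1, hxt.2⟩)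
      rw [max_eq_right hax, max_eq_left (neg_nonneg.2 hax)]
      have : 0 ≤ ϑ * (mu * -a x) * g (u x) :=
        mul_nonneg (mul_nonneg hϑ (mul_nonneg hmu (neg_nonneg.2 hax))) hgx
      simp only [Pi.zero_apply]
      linarith
    rw [intervalIntegral.integral_neg] at hnonneg
    have := hint t hts e he
    linarith
  have hubound : ∀ t ∈ Icc r e, d < u t := fun t ht =>
    hue.trans_le (habove t ⟨hsr.trans ht.1, ht.2⟩ fun x hx => hvneg x ⟨ht.1.trans hx.1, hx.2⟩)
  have hvr : v r ≤ v e - ϑ * (mu * ((∫ t in r..e, max (-a t) 0) * ginf)) := by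
    have hle : (∫ x in r..e, ϑ * (lam * max (a x) 0 - mu * max (-a x) 0) * g (u x)) ≤
        ∫ x in r..e, -(ϑ * mu * ginf) * max (-a x) 0 := by
      refine intervalIntegral.integral_mono_ae_restrict hre (hqi r hr e he)
        ((hnegi r e).const_mul _) ?_
      refine (ae_restrict_iff' measurableSet_Icc).2 ?_
      filter_upwards [ha_neg] with x hx hxt
      have hax := hx hxt
      have hgx := hinf _ ⟨(hubound x hxt).le, huD x ⟨hsr.trans hxt.1, hxt.2⟩⟩
      rw [max_eq_right hax, max_eq_left (neg_nonneg.2 hax)]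
      have := mul_le_mul_of_nonneg_left hgx
        (mul_nonneg hϑ (mul_nonneg hmu (neg_nonneg.2 hax)))
      linarith
    rw [intervalIntegral.integral_const_mul] at hle
    have := hint r hr e he
    linarith
  have hvall : ∀ t ∈ Icc s e, v t < 0 := by
    intro t ht
    rcases le_total r t with hrt | htr
    · exact hvneg t ⟨hrt, ht.2⟩
    have hgsup : 0 ≤ gsup :=
      (hg_nonneg _ (hu0 e he)).trans (hsup _ ⟨hu0 e he, huD e he⟩)
    have hle : (∫ x in t..r, ϑ * (lam * max (a x) 0 - mu * max (-a x) 0) * g (u x)) ≤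
        ∫ x in t..r, ϑ * lam * gsup * max (a x) 0 := by
      refine intervalIntegral.integral_mono_ae_restrict htr (hqi t ht r hr)
        ((hposi t r).const_mul _) ?_
      refine (ae_restrict_iff' measurableSet_Icc).2 ?_
      filter_upwards [ha_pos] with x hx hxt
      have hax := hx ⟨ht.1.trans hxt.1, hxt.2⟩
      have hxs : x ∈ Icc s e := ⟨ht.1.trans hxt.1, hxt.2.trans hre⟩
      have hgx := hsup _ ⟨hu0 x hxs, huD x hxs⟩
      rw [max_eq_left hax, max_eq_right (neg_nonpos.2 hax)]
      have := mul_le_mul_of_nonneg_left hgx (mul_nonneg hϑ (mul_nonneg hlam hax))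
      linarith
    rw [intervalIntegral.integral_const_mul] at hle
    have hmono : (∫ x in t..r, max (a x) 0) ≤ ∫ x in s..r, max (a x) 0 :=
      intervalIntegral.integral_mono_interval ht.1 htr le_rfl
        (Eventually.of_forall fun x => le_max_right _ _) (hposi s r)
    have hmono' := mul_le_mul_of_nonneg_left hmono (mul_nonneg (mul_nonneg hϑ hlam) hgsup)
    have hdom' := mul_le_mul_of_nonneg_left hdom hϑ
    have := hint t ht r hr
    linarith
  exact fun t ht => ⟨hue.trans_le (habove t ht fun x hx => hvall x ⟨ht.1.trans hx.1, hx.2⟩),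
    hvall t ht⟩

/-- An almost everywhere sign condition on `[x, y]` passes to `[x - T, y - T]` for a `T`-periodic
function. -/
theorem Function.Periodic.ae_mem_Icc_sub {a : ℝ → ℝ} {T x y : ℝ} (ha : Function.Periodic a T)
    {p : ℝ → Prop} (h : ∀ᵐ t : ℝ, t ∈ Icc x y → p (a t)) :
    ∀ᵐ t : ℝ, t ∈ Icc (x - T) (y - T) → p (a t) := by
  filter_upwards [(measurePreserving_add_right (volume : Measure ℝ) T).quasiMeasurePreserving.ae h]
    with t ht htm
  rw [← ha t]
  exact ht ⟨by linarith [htm.1], by linarith [htm.2]⟩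

theorem Function.Periodic.intervalIntegral_sub {a : ℝ → ℝ} {T : ℝ} (ha : Function.Periodic a T)
    (x y : ℝ) : ∫ t in (x - T)..(y - T), a t = ∫ t in x..y, a t := by
  rw [← intervalIntegral.integral_comp_sub_right]
  simp only [ha.sub_eq]

theorem stmt_5 (g a : ℝ → ℝ) (T : ℝ) (m : ℕ) (σ τ : ℕ → ℝ)
    (hg_cont : ContinuousOn g (Ici 0)) (hg_zero : g 0 = 0)
    (hg_pos : ∀ s : ℝ, 0 < s → 0 < g s)
    (hm : 1 ≤ m)
    (hστ : ∀ i, 1 ≤ i → i ≤ m → σ i < τ i)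
    (hτσ : ∀ i, 1 ≤ i → i ≤ m → τ i < σ (i + 1))
    (hσT : σ (m + 1) - σ 1 = T)
    (ha_per : ∀ t, a (t + T) = a t)
    (ha_loc : LocallyIntegrable a)
    (ha_pos : ∀ i, 1 ≤ i → i ≤ m →
      (∀ᵐ t : ℝ ∂volume, t ∈ Icc (σ i) (τ i) → 0 ≤ a t) ∧
        0 < ∫ t in (σ i)..(τ i), a t)
    (ha_neg : ∀ i, 1 ≤ i → i ≤ m →
      (∀ᵐ t : ℝ ∂volume, t ∈ Icc (τ i) (σ (i + 1)) → a t ≤ 0) ∧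
        (∫ t in (τ i)..(σ (i + 1)), a t) < 0)
    -- cyclic convention: `I⁺₀ := I⁺_m - T` and `I⁻₀ := I⁻_m - T`, i.e.
    -- `σ 0 = σ m - T` and `τ 0 = τ m - T`
    (hσ0 : σ 0 = σ m - T) (hτ0 : τ 0 = τ m - T)
    (lam d D : ℝ) (hlam : 0 < lam) (hd : 0 < d) (hdD : d < D)
    (i : ℕ) (hi1 : 1 ≤ i) (him : i ≤ m) :
    0 < lam * (∫ t in (σ (i - 1))..(τ (i - 1)), max (a t) 0) * sSup (g '' Icc 0 D) /
        ((∫ t in (τ (i - 1))..(σ i), max (-a t) 0) * sInf (g '' Icc d D)) ∧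
    ∀ mu : ℝ,
      lam * (∫ t in (σ (i - 1))..(τ (i - 1)), max (a t) 0) * sSup (g '' Icc 0 D) /
        ((∫ t in (τ (i - 1))..(σ i), max (-a t) 0) * sInf (g '' Icc d D)) < mu →
      ∀ ϑ : ℝ, 0 < ϑ → ϑ ≤ 1 →
        ∀ u v : ℝ → ℝ,
          IsSolOn (fun t => ϑ * (lam * max (a t) 0 - mu * max (-a t) 0)) g
            (Icc (σ (i - 1)) (σ i)) u v →
          (∀ t ∈ Icc (σ (i - 1)) (σ i), 0 ≤ u t) →
          (∀ t ∈ Icc (σ (i - 1)) (σ i), u t ≤ D) →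
          d < u (σ i) → v (σ i) < 0 →
          ∀ t ∈ Icc (σ (i - 1)) (σ i), d < u t ∧ v t < 0 := by
  have ha_per' : Function.Periodic a T := ha_per
  obtain ⟨hsr, hre, ⟨hpos, hA⟩, hneg, hB⟩ : σ (i - 1) < τ (i - 1) ∧ τ (i - 1) < σ i ∧
      ((∀ᵐ t : ℝ, t ∈ Icc (σ (i - 1)) (τ (i - 1)) → 0 ≤ a t) ∧
        0 < ∫ t in (σ (i - 1))..(τ (i - 1)), a t) ∧
      (∀ᵐ t : ℝ, t ∈ Icc (τ (i - 1)) (σ i) → a t ≤ 0) ∧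
        (∫ t in (τ (i - 1))..(σ i), a t) < 0 := by
    obtain rfl | hi := hi1.eq_or_lt
    · have hσ1 : σ 1 = σ (m + 1) - T := by linarith
      have h1 := hστ m hm le_rfl
      have h2 := hτσ m hm le_rfl
      obtain ⟨h3, h4⟩ := ha_pos m hm le_rfl
      obtain ⟨h5, h6⟩ := ha_neg m hm le_rfl
      rw [Nat.sub_self, hσ0, hτ0, hσ1, ha_per'.intervalIntegral_sub, ha_per'.intervalIntegral_sub]
      exact ⟨by linarith, by linarith, ⟨ha_per'.ae_mem_Icc_sub (p := fun x => 0 ≤ x) h3, h4⟩,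
        ha_per'.ae_mem_Icc_sub (p := fun x => x ≤ 0) h5, h6⟩
    · obtain ⟨j, rfl⟩ : ∃ j, i = j + 1 := ⟨i - 1, by omega⟩
      rw [Nat.add_sub_cancel]
      have hj : 1 ≤ j := by omega
      have hjm : j ≤ m := by omega
      exact ⟨hστ j hj hjm, hτσ j hj hjm, ha_pos j hj hjm, ha_neg j hj hjm⟩
  have hai : ∀ x y, IntervalIntegrable a volume x y := fun x y =>
    (ha_loc.integrableOn_isCompact isCompact_uIcc).intervalIntegrable
  have hA' : 0 < ∫ t in (σ (i - 1))..(τ (i - 1)), max (a t) 0 :=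
    hA.trans_le (intervalIntegral.integral_mono hsr.le (hai _ _) (hai _ _).max_zero
      fun t => le_max_left _ _)
  have hB' : 0 < ∫ t in (τ (i - 1))..(σ i), max (-a t) 0 := by
    have hle : (∫ t in (τ (i - 1))..(σ i), -a t) ≤ ∫ t in (τ (i - 1))..(σ i), max (-a t) 0 :=
      intervalIntegral.integral_mono hre.le (hai _ _).neg (hai _ _).neg.max_zero
        fun t => le_max_left _ _
    rw [intervalIntegral.integral_neg] at hle
    linarith
  have hD : 0 < D := hd.trans hdD
  have hcomp : IsCompact (g '' Icc 0 D) :=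
    isCompact_Icc.image_of_continuousOn (hg_cont.mono fun x hx => hx.1)
  have hcomp' : IsCompact (g '' Icc d D) :=
    isCompact_Icc.image_of_continuousOn (hg_cont.mono fun x hx => hd.le.trans hx.1)
  have hsup : ∀ x ∈ Icc 0 D, g x ≤ sSup (g '' Icc 0 D) := fun x hx =>
    le_csSup hcomp.bddAbove (mem_image_of_mem g hx)
  have hinf : ∀ x ∈ Icc d D, sInf (g '' Icc d D) ≤ g x := fun x hx =>
    csInf_le hcomp'.bddBelow (mem_image_of_mem g hx)
  have hsup_pos : 0 < sSup (g '' Icc 0 D) := (hg_pos D hD).trans_le (hsup D ⟨hD.le, le_rfl⟩)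
  have hinf_pos : 0 < sInf (g '' Icc d D) := by
    obtain ⟨x, hx, hxe⟩ := hcomp'.sInf_mem ⟨g d, mem_image_of_mem g ⟨le_rfl, hdD.le⟩⟩
    exact hxe ▸ hg_pos x (hd.trans_le hx.1)
  have hquot := div_pos (mul_pos (mul_pos hlam hA') hsup_pos) (mul_pos hB' hinf_pos)
  refine ⟨hquot, fun mu hmu ϑ hϑ _ u v hsol hu0 huD hue hve => ?_⟩
  have hg_nonneg : ∀ x, 0 ≤ x → 0 ≤ g x := fun x hx =>
    hx.eq_or_lt.elim (fun h => by rw [← h, hg_zero]) fun h => (hg_pos x h).le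
  exact hsol.lt_and_neg_of_lt_of_neg hg_cont hg_nonneg hsr.le hre.le hai hpos hneg hlam.le
    (hquot.trans hmu).le hϑ.le hsup hinf
    ((div_lt_iff₀ (mul_pos hB' hinf_pos)).1 hmu).le hu0 huD hue hve
end
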